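/- Let Ω ⊂ ℝ be an open bounded interval, let f satisfy hypothesis (F), and let T > 0. Suppose (u^{(k)})_{k∈ℕ} ⊂ C⁰([0,T];W₀^{1,2}(Ω)) and (Θ^{(k)})_{k∈ℕ} ⊂ C⁰([0,T];L²(Ω)) ∩ L²((0,T);W^{1,2}(Ω)) are such that (u_t^{(k)})_{k∈ℕ} ⊂ C⁰([0,T];L²(Ω)), that for each k the pair (u^{(k)},Θ^{(k)}) is a weak solution of system (P) on Ω×(0,T) with initial data (u₀^{(k)},u_{0t}^{(k)},Θ₀^{(k)}) satisfying hypothesis (I), and that (u₀^{(k)}), (u_{0t}^{(k)}), (Θ₀^{(k)}) are Cauchy sequences in W₀^{1,2}(Ω), L²(Ω) and L²(Ω) respectively. Then sup_{k'>k} sup_{t∈(0,T)} {∫_Ω |u_t^{(k)}(·,t)−u_t^{(k')}(·,t)|² + ∫_Ω |u_x^{(k)}(·,t)−u_x^{(k')}(·,t)|² + ∫_Ω |Θ^{(k)}(·,t)−Θ^{(k')}(·,t)|²} + sup_{k'>k} ∫₀^T∫_Ω |Θ_x^{(k)}−Θ_x^{(k')}|² → 0 as k → ∞. -/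

import Mathlib

open MeasureTheory Filter Set Function

noncomputable section

/-- Integral over `Ω = (a,b)`. -/
def intOm (a b : ℝ) (g : ℝ → ℝ) : ℝ := ∫ x in Ioo a b, g x

/-- Double integral over `Ω × (0,T)`. -/
def intOmT (a b T : ℝ) (F : ℝ → ℝ → ℝ) : ℝ :=
  ∫ p in (Ioo a b) ×ˢ (Ioo 0 T), F p.1 p.2

/-- Squared `L²(Ω)` integral of `g`. -/
def sqOm (a b : ℝ) (g : ℝ → ℝ) : ℝ := ∫ x in Ioo a b, (g x) ^ 2

/-- `L²(Ω)` norm. -/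
def nrmL2 (a b : ℝ) (g : ℝ → ℝ) : ℝ := (∫ x in Ioo a b, (g x) ^ 2) ^ (1 / 2 : ℝ)

/-- `L¹(Ω)` norm. -/
def nrmL1 (a b : ℝ) (g : ℝ → ℝ) : ℝ := ∫ x in Ioo a b, |g x|

/-- Membership in `L²(Ω)`. -/
def MemL2 (a b : ℝ) (g : ℝ → ℝ) : Prop :=
  AEStronglyMeasurable g (volume.restrict (Ioo a b)) ∧
    IntegrableOn (fun x => (g x) ^ 2) (Ioo a b)

/-- Zero-trace weak derivative on `(a,b)`: `g ∈ W₀^{1,1}(a,b)` with weak derivative `g'`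
(integration by parts against all smooth test functions, with no boundary terms). -/
def WeakDerivZ (a b : ℝ) (g g' : ℝ → ℝ) : Prop :=
  ∀ ψ : ℝ → ℝ, ContDiff ℝ (⊤ : ℕ∞) ψ →
    ∫ x in Ioo a b, g x * deriv ψ x = - ∫ x in Ioo a b, g' x * ψ x

/-- Interior weak derivative on `(a,b)`: `g ∈ W^{1,1}(a,b)` with weak derivative `g'`. -/
def WeakDerivI (a b : ℝ) (g g' : ℝ → ℝ) : Prop :=
  ∀ ψ : ℝ → ℝ, ContDiff ℝ (⊤ : ℕ∞) ψ → tsupport ψ ⊆ Ioo a b →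
    ∫ x in Ioo a b, g x * deriv ψ x = - ∫ x in Ioo a b, g' x * ψ x

/-- Hypothesis (F) on the nonlinearity `f`, where `f'`, `f''` denote its first and second
derivatives on `[0,∞)`: `f ∈ C²([0,∞))`, `f(0)=0`, `f' > 0` on `[0,∞)`,
and `f' ∈ W^{1,∞}((0,∞))` (i.e. `f'` and `f''` are bounded). -/
structure HypF (f f' f'' : ℝ → ℝ) : Prop where
  hasDeriv₁ : ∀ x ∈ Ici (0 : ℝ), HasDerivWithinAt f (f' x) (Ici 0) x
  hasDeriv₂ : ∀ x ∈ Ici (0 : ℝ), HasDerivWithinAt f' (f'' x) (Ici 0) x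
  cont₂ : ContinuousOn f'' (Ici 0)
  zero : f 0 = 0
  pos : ∀ x ∈ Ici (0 : ℝ), 0 < f' x
  bdd : ∃ M : ℝ, ∀ x ∈ Ici (0 : ℝ), |f' x| ≤ M ∧ |f'' x| ≤ M

/-- Partial derivative in the first (spatial) variable. -/
def pdx (w : ℝ → ℝ → ℝ) : ℝ → ℝ → ℝ := fun x t => deriv (fun y => w y t) x

/-- Partial derivative in the second (time) variable. -/
def pdt (w : ℝ → ℝ → ℝ) : ℝ → ℝ → ℝ := fun x t => deriv (fun s => w x s) t

/-- Test functions in `C₀^∞(Ω × [0,T))`. -/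
structure TestU (a b T : ℝ) (φ : ℝ → ℝ → ℝ) : Prop where
  smooth : ContDiff ℝ (⊤ : ℕ∞) (uncurry φ)
  suppx : ∃ K : Set ℝ, IsCompact K ∧ K ⊆ Ioo a b ∧ ∀ x t, x ∉ K → φ x t = 0
  suppt : ∃ T' : ℝ, T' < T ∧ ∀ x t, T' ≤ t → φ x t = 0

/-- Test functions in `C^∞(Ω̄ × [0,T))`, compactly supported in time. -/
structure TestT (T : ℝ) (φ : ℝ → ℝ → ℝ) : Prop where
  smooth : ContDiff ℝ (⊤ : ℕ∞) (uncurry φ)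
  suppt : ∃ T' : ℝ, T' < T ∧ ∀ x t, T' ≤ t → φ x t = 0

/-- Test functions in `C₀^∞(Ω × (0,T))`. -/
structure TestInt (a b T : ℝ) (φ : ℝ → ℝ → ℝ) : Prop where
  smooth : ContDiff ℝ (⊤ : ℕ∞) (uncurry φ)
  suppx : ∃ K : Set ℝ, IsCompact K ∧ K ⊆ Ioo a b ∧ ∀ x t, x ∉ K → φ x t = 0
  supptime : ∃ K : Set ℝ, IsCompact K ∧ K ⊆ Ioo 0 T ∧ ∀ x t, t ∉ K → φ x t = 0

/-- Definition (W): weak solution of (P) on `Ω × (0,T)`.  Here `ut`, `ux`, `Θx` denote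
the weak derivatives of `u` (in time and space) and of `Θ` (in space). -/
structure IsWeakSol (a b T : ℝ) (f f' : ℝ → ℝ) (u0 u0t Θ0 : ℝ → ℝ)
    (u ut ux Θ Θx : ℝ → ℝ → ℝ) : Prop where
  u_sliceL1 : ∀ t ∈ Icc 0 T, IntegrableOn (fun x => u x t) (Ioo a b)
  u_contL1 : ∀ t₀ ∈ Icc 0 T,
    Tendsto (fun t => ∫ x in Ioo a b, |u x t - u x t₀|) (nhdsWithin t₀ (Icc 0 T)) (nhds 0)
  u_int : IntegrableOn (fun p : ℝ × ℝ => u p.1 p.2) ((Ioo a b) ×ˢ (Ioo 0 T))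
  ux_int : IntegrableOn (fun p : ℝ × ℝ => ux p.1 p.2) ((Ioo a b) ×ˢ (Ioo 0 T))
  u_W0 : ∀ᵐ t ∂volume.restrict (Ioo 0 T), WeakDerivZ a b (fun x => u x t) (fun x => ux x t)
  Θ_int : IntegrableOn (fun p : ℝ × ℝ => Θ p.1 p.2) ((Ioo a b) ×ˢ (Ioo 0 T))
  Θx_int : IntegrableOn (fun p : ℝ × ℝ => Θx p.1 p.2) ((Ioo a b) ×ˢ (Ioo 0 T))
  Θ_W : ∀ᵐ t ∂volume.restrict (Ioo 0 T), WeakDerivI a b (fun x => Θ x t) (fun x => Θx x t)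
  Θ_nonneg : ∀ᵐ p ∂volume.restrict ((Ioo a b) ×ˢ (Ioo 0 T)), 0 ≤ Θ p.1 p.2
  ut_weak : ∀ φ : ℝ → ℝ → ℝ, TestInt a b T φ →
    intOmT a b T (fun x t => u x t * pdt φ x t) = - intOmT a b T (fun x t => ut x t * φ x t)
  ut_int : IntegrableOn (fun p : ℝ × ℝ => ut p.1 p.2) ((Ioo a b) ×ˢ (Ioo 0 T))
  g1_int : IntegrableOn (fun p : ℝ × ℝ => f' (Θ p.1 p.2) * Θx p.1 p.2)
    ((Ioo a b) ×ˢ (Ioo 0 T))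
  g2_int : IntegrableOn (fun p : ℝ × ℝ => f' (Θ p.1 p.2) * Θx p.1 p.2 * ut p.1 p.2)
    ((Ioo a b) ×ˢ (Ioo 0 T))
  g3_int : IntegrableOn (fun p : ℝ × ℝ => f (Θ p.1 p.2) * ut p.1 p.2)
    ((Ioo a b) ×ˢ (Ioo 0 T))
  weak_u : ∀ φ : ℝ → ℝ → ℝ, TestU a b T φ →
    intOmT a b T (fun x t => u x t * pdt (pdt φ) x t)
        - intOm a b (fun x => u0t x * φ x 0) + intOm a b (fun x => u0 x * pdt φ x 0)
      = - intOmT a b T (fun x t => ux x t * pdx φ x t)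
        - intOmT a b T (fun x t => f' (Θ x t) * Θx x t * φ x t)
  weak_Θ : ∀ φ : ℝ → ℝ → ℝ, TestT T φ →
    - intOmT a b T (fun x t => Θ x t * pdt φ x t) - intOm a b (fun x => Θ0 x * φ x 0)
      = - intOmT a b T (fun x t => Θx x t * pdx φ x t)
        + intOmT a b T (fun x t => f' (Θ x t) * Θx x t * ut x t * φ x t)
        + intOmT a b T (fun x t => f (Θ x t) * ut x t * pdx φ x t)

/-- Continuity of `t ↦ w(·,t)` as a map `J → L²(Ω)` (with slices in `L²(Ω)`). -/
def ContL2 (a b : ℝ) (J : Set ℝ) (w : ℝ → ℝ → ℝ) : Prop :=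
  (∀ t ∈ J, MemL2 a b (fun x => w x t)) ∧
    ∀ t₀ ∈ J, Tendsto (fun t => ∫ x in Ioo a b, (w x t - w x t₀) ^ 2)
      (nhdsWithin t₀ J) (nhds 0)

/-- The regularity class (R_T):  `u ∈ C⁰([0,T];W₀^{1,2})`, `u_t ∈ C⁰([0,T];L²)`,
`Θ ∈ C⁰([0,T];L²) ∩ L²((0,T);W^{1,2})`. -/
structure RegT (a b T : ℝ) (u ut ux Θ Θx : ℝ → ℝ → ℝ) : Prop where
  u_cont : ContL2 a b (Icc 0 T) u
  ux_cont : ContL2 a b (Icc 0 T) ux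
  u_W0 : ∀ t ∈ Icc (0 : ℝ) T, WeakDerivZ a b (fun x => u x t) (fun x => ux x t)
  ut_cont : ContL2 a b (Icc 0 T) ut
  Θ_cont : ContL2 a b (Icc 0 T) Θ
  Θ_sq_int : IntegrableOn (fun p : ℝ × ℝ => (Θ p.1 p.2) ^ 2) ((Ioo a b) ×ˢ (Ioo 0 T))
  Θx_sq_int : IntegrableOn (fun p : ℝ × ℝ => (Θx p.1 p.2) ^ 2) ((Ioo a b) ×ˢ (Ioo 0 T))

/-- Data hypothesis (I), with `u0x` the weak derivative of `u0 ∈ W₀^{1,2}(Ω)`. -/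
structure DataI (a b : ℝ) (u0 u0x u0t Θ0 : ℝ → ℝ) : Prop where
  u0_L2 : MemL2 a b u0
  u0x_L2 : MemL2 a b u0x
  u0_W0 : WeakDerivZ a b u0 u0x
  u0t_L2 : MemL2 a b u0t
  Θ0_L2 : MemL2 a b Θ0
  Θ0_nonneg : ∀ᵐ x ∂volume.restrict (Ioo a b), 0 ≤ Θ0 x

/-- Smooth-data hypothesis (I∞). -/
structure SmoothData (a b : ℝ) (v0 u0 Θ0 : ℝ → ℝ) : Prop where
  v0_smooth : ContDiff ℝ (⊤ : ℕ∞) v0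
  v0_supp : ∃ K : Set ℝ, IsCompact K ∧ K ⊆ Ioo a b ∧ ∀ x, x ∉ K → v0 x = 0
  u0_smooth : ContDiff ℝ (⊤ : ℕ∞) u0
  u0_supp : ∃ K : Set ℝ, IsCompact K ∧ K ⊆ Ioo a b ∧ ∀ x, x ∉ K → u0 x = 0
  Θ0_smooth : ContDiff ℝ (⊤ : ℕ∞) Θ0
  Θ0_pos : ∀ x ∈ Icc a b, 0 < Θ0 x
  Θ0x_supp : ∃ K : Set ℝ, IsCompact K ∧ K ⊆ Ioo a b ∧ ∀ x, x ∉ K → deriv Θ0 x = 0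

/-- Classical solution of the regularized problem (P_ε), of class
`C^{4,1} × C^{2,1} × C^{2,1}(Ω̄ × [0,∞))`, with positive temperature. -/
structure IsClassicalSolEps (a b : ℝ) (f : ℝ → ℝ) (ε : ℝ) (v0 u0 Θ0 : ℝ → ℝ)
    (v u Θ : ℝ → ℝ → ℝ) : Prop where
  diffx_v : ∀ k < 4, ∀ x ∈ Icc a b, ∀ t ∈ Ici (0 : ℝ),
    DifferentiableAt ℝ (fun y => pdx^[k] v y t) x
  difft_v : ∀ x ∈ Icc a b, ∀ t ∈ Ici (0 : ℝ), DifferentiableAt ℝ (fun s => v x s) t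
  cont_v : ∀ k ≤ 4, ContinuousOn (uncurry (pdx^[k] v)) ((Icc a b) ×ˢ (Ici 0))
  contt_v : ContinuousOn (uncurry (pdt v)) ((Icc a b) ×ˢ (Ici 0))
  diffx_u : ∀ k < 2, ∀ x ∈ Icc a b, ∀ t ∈ Ici (0 : ℝ),
    DifferentiableAt ℝ (fun y => pdx^[k] u y t) x
  difft_u : ∀ x ∈ Icc a b, ∀ t ∈ Ici (0 : ℝ), DifferentiableAt ℝ (fun s => u x s) t
  cont_u : ∀ k ≤ 2, ContinuousOn (uncurry (pdx^[k] u)) ((Icc a b) ×ˢ (Ici 0))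
  contt_u : ContinuousOn (uncurry (pdt u)) ((Icc a b) ×ˢ (Ici 0))
  diffx_Θ : ∀ k < 2, ∀ x ∈ Icc a b, ∀ t ∈ Ici (0 : ℝ),
    DifferentiableAt ℝ (fun y => pdx^[k] Θ y t) x
  difft_Θ : ∀ x ∈ Icc a b, ∀ t ∈ Ici (0 : ℝ), DifferentiableAt ℝ (fun s => Θ x s) t
  cont_Θ : ∀ k ≤ 2, ContinuousOn (uncurry (pdx^[k] Θ)) ((Icc a b) ×ˢ (Ici 0))
  contt_Θ : ContinuousOn (uncurry (pdt Θ)) ((Icc a b) ×ˢ (Ici 0))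
  Θ_pos : ∀ x ∈ Icc a b, ∀ t ∈ Ici (0 : ℝ), 0 < Θ x t
  eq_v : ∀ x ∈ Ioo a b, ∀ t ∈ Ioi (0 : ℝ),
    pdt v x t = -ε * pdx^[4] v x t + pdx^[2] u x t - pdx (fun y s => f (Θ y s)) x t
  eq_u : ∀ x ∈ Ioo a b, ∀ t ∈ Ioi (0 : ℝ), pdt u x t = ε * pdx^[2] u x t + v x t
  eq_Θ : ∀ x ∈ Ioo a b, ∀ t ∈ Ioi (0 : ℝ),
    pdt Θ x t = pdx^[2] Θ x t - f (Θ x t) * pdx v x t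
  bc_v : ∀ t ∈ Ioi (0 : ℝ),
    v a t = 0 ∧ v b t = 0 ∧ pdx^[2] v a t = 0 ∧ pdx^[2] v b t = 0
  bc_u : ∀ t ∈ Ioi (0 : ℝ), u a t = 0 ∧ u b t = 0
  bc_Θ : ∀ t ∈ Ioi (0 : ℝ), pdx Θ a t = 0 ∧ pdx Θ b t = 0
  init : ∀ x ∈ Icc a b, v x 0 = v0 x ∧ u x 0 = u0 x ∧ Θ x 0 = Θ0 x

/-- Weak convergence in `L²_loc(Ω̄ × [0,∞))`. -/
def WkL2loc (a b : ℝ) (wj : ℕ → ℝ → ℝ → ℝ) (w : ℝ → ℝ → ℝ) : Prop :=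
  ∀ T > (0 : ℝ), ∀ ψ : ℝ → ℝ → ℝ,
    AEStronglyMeasurable (fun p : ℝ × ℝ => ψ p.1 p.2)
      (volume.restrict ((Icc a b) ×ˢ (Icc 0 T))) →
    IntegrableOn (fun p : ℝ × ℝ => (ψ p.1 p.2) ^ 2) ((Icc a b) ×ˢ (Icc 0 T)) →
    Tendsto (fun j => ∫ p in (Icc a b) ×ˢ (Icc 0 T), wj j p.1 p.2 * ψ p.1 p.2) atTop
      (nhds (∫ p in (Icc a b) ×ˢ (Icc 0 T), w p.1 p.2 * ψ p.1 p.2))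

/-! ### Calculus of primitives of integrable functions -/

theorem mul_eq_add_integral_of_primitive {T : ℝ} (hT : 0 ≤ T) {A B α β : ℝ → ℝ} {A0 B0 : ℝ}
    (hα : IntervalIntegrable α volume 0 T) (hβ : IntervalIntegrable β volume 0 T)
    (hA : ∀ t ∈ Icc 0 T, A t = A0 + ∫ s in 0..t, α s)
    (hB : ∀ t ∈ Icc 0 T, B t = B0 + ∫ s in 0..t, β s) {t : ℝ} (ht : t ∈ Icc 0 T) :
    A t * B t = A0 * B0 + ∫ s in 0..t, (α s * B s + A s * β s) := by
  have hsub : uIcc 0 t ⊆ uIcc 0 T := by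
    rw [uIcc_of_le hT, uIcc_of_le ht.1]; exact Icc_subset_Icc_right ht.2
  have key : ∀ {C γ : ℝ → ℝ} {C0 : ℝ}, IntervalIntegrable γ volume 0 T →
      AbsolutelyContinuousOnInterval (fun t => C0 + ∫ s in 0..t, γ s) 0 t := by
    intro C γ C0 hγ
    have h1 := ((hγ.mono_set hsub).absolutelyContinuousOnInterval_intervalIntegral
      (c := 0) (by simp))
    have h2 : AbsolutelyContinuousOnInterval (fun _ : ℝ => C0) 0 t :=
      (contDiff_const.contDiffOn (n := 1)).absolutelyContinuousOnInterval
    exact h2.add h1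
  have hA' := key (C := A) (C0 := A0) hα
  have hB' := key (C := B) (C0 := B0) hβ
  have h := hA'.integral_deriv_mul_eq_sub hB'
  simp only [intervalIntegral.integral_same, add_zero] at h
  have hder : ∀ {γ : ℝ → ℝ} {C0 : ℝ}, IntervalIntegrable γ volume 0 T →
      ∀ᵐ x, x ∈ uIoc 0 t → deriv (fun t => C0 + ∫ s in 0..t, γ s) x = γ x := by
    intro γ C0 hγ
    filter_upwards [(hγ.mono_set hsub).ae_hasDerivAt_integral] with x hx hx'
    exact ((hx (uIoc_subset_uIcc hx') 0 (by simp)).const_add C0).deriv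
  rw [hA t ht, hB t ht, ← sub_eq_iff_eq_add', ← h]
  apply intervalIntegral.integral_congr_ae
  filter_upwards [hder (C0 := A0) hα, hder (C0 := B0) hβ] with x h1 h2 hx
  have hxI : x ∈ Icc 0 T := by
    rw [uIoc_of_le ht.1] at hx
    exact ⟨hx.1.le, hx.2.trans ht.2⟩
  rw [h1 hx, h2 hx, ← hA x hxI, ← hB x hxI]

theorem continuousOn_of_primitive {T : ℝ} {A α : ℝ → ℝ} {A0 : ℝ}
    (hα : IntervalIntegrable α volume 0 T)
    (hA : ∀ t ∈ Icc 0 T, A t = A0 + ∫ s in 0..t, α s) : ContinuousOn A (Icc 0 T) := by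
  refine ContinuousOn.congr (f := fun t => A0 + ∫ s in 0..t, α s) ?_ hA
  refine continuousOn_const.add ?_
  rcases le_or_gt 0 T with hT | hT
  · have := intervalIntegral.continuousOn_primitive_interval' hα left_mem_uIcc
    rwa [uIcc_of_le hT] at this
  · simp [Icc_eq_empty (not_le.2 hT)]

/-- Integration by parts of a primitive against a `C¹` function. -/
theorem integral_primitive_mul_deriv {T : ℝ} (hT : 0 ≤ T) {A α χ : ℝ → ℝ} {A0 : ℝ}
    (hα : IntervalIntegrable α volume 0 T)
    (hA : ∀ t ∈ Icc 0 T, A t = A0 + ∫ s in 0..t, α s) (hχ : ContDiff ℝ 1 χ) (hχT : χ T = 0) :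
    ∫ s in 0..T, A s * deriv χ s = - A0 * χ 0 - ∫ s in 0..T, α s * χ s := by
  have hc : Continuous (deriv χ) := hχ.continuous_deriv le_rfl
  have hχ' : ∀ t ∈ Icc 0 T, χ t = χ 0 + ∫ s in 0..t, deriv χ s := by
    intro t _
    rw [intervalIntegral.integral_deriv_eq_sub]
    · ring
    · intro x _; exact (hχ.differentiable one_ne_zero) x
    · exact hc.intervalIntegrable _ _
  have h := mul_eq_add_integral_of_primitive hT hα (hc.intervalIntegrable _ _) hA hχ'
    (right_mem_Icc.2 hT)
  have hAc := continuousOn_of_primitive hα hA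
  rw [intervalIntegral.integral_add, hχT] at h
  · linarith
  · exact hα.mul_continuousOn hχ.continuous.continuousOn
  · refine ContinuousOn.intervalIntegrable ?_
    rw [uIcc_of_le hT]
    exact hAc.mul hc.continuousOn

theorem pow_primitive {T : ℝ} (hT : 0 ≤ T) {m : ℝ → ℝ} (hm : IntervalIntegrable m volume 0 T)
    (j : ℕ) : ∀ t ∈ Icc 0 T, (∫ s in 0..t, m s) ^ (j + 1) =
      0 + ∫ s in 0..t, ((j : ℝ) + 1) * (m s * (∫ r in 0..s, m r) ^ j) := by
  have hMc : ContinuousOn (fun t => ∫ s in 0..t, m s) (Icc 0 T) :=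
    continuousOn_of_primitive (A0 := 0) hm (fun t _ => (zero_add _).symm)
  induction j with
  | zero => intro t _; simp
  | succ j ih =>
    intro t ht
    have hInt : IntervalIntegrable (fun s => ((j : ℝ) + 1) * (m s * (∫ r in 0..s, m r) ^ j))
        volume 0 T := by
      refine (hm.mul_continuousOn ?_).const_mul _
      rw [uIcc_of_le hT]
      exact hMc.pow j
    have h := mul_eq_add_integral_of_primitive hT hm hInt
      (A := fun t => ∫ s in 0..t, m s) (A0 := 0) (fun t _ => by simp) ih ht
    rw [pow_succ', h]
    congr 1
    · ring
    · apply intervalIntegral.integral_congr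
      intro s _
      push_cast
      ring

/-- Grönwall's inequality in integral form with an integrable coefficient. -/
theorem gronwall_integral {T : ℝ} (hT : 0 ≤ T) {m y : ℝ → ℝ} {y0 K : ℝ}
    (hm : IntervalIntegrable m volume 0 T) (hm0 : ∀ᵐ s ∂volume.restrict (Ioo 0 T), 0 ≤ m s)
    (hmy : IntervalIntegrable (fun s => m s * y s) volume 0 T)
    (hy0 : 0 ≤ y0) (hyK : ∀ t ∈ Ioo 0 T, y t ≤ K)
    (hy : ∀ t ∈ Ioo 0 T, y t ≤ y0 + ∫ s in 0..t, m s * y s) :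
    ∀ t ∈ Ioo 0 T, y t ≤ y0 * Real.exp (∫ s in 0..T, m s) := by
  set M : ℝ → ℝ := fun t => ∫ s in 0..t, m s with hM
  have hm0' : ∀ᵐ s, s ∈ Ioo 0 T → 0 ≤ m s := (ae_restrict_iff' measurableSet_Ioo).1 hm0
  have hMc : ContinuousOn M (Icc 0 T) :=
    continuousOn_of_primitive (A0 := 0) hm (fun t _ => by simp [hM])
  have hsub : ∀ t ∈ Ioo 0 T, uIcc 0 t ⊆ uIcc 0 T := by
    intro t ht
    rw [uIcc_of_le hT, uIcc_of_le ht.1.le]; exact Icc_subset_Icc_right ht.2.le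
  have hMint : ∀ j, IntervalIntegrable (fun s => m s * M s ^ j) volume 0 T := by
    intro j
    refine hm.mul_continuousOn ?_
    rw [uIcc_of_le hT]
    exact hMc.pow j
  have hMpow : ∀ j : ℕ, ∀ t ∈ Icc 0 T, ∫ s in 0..t, m s * M s ^ j = M t ^ (j + 1) / (j + 1) := by
    intro j t ht
    have := pow_primitive hT hm j t ht
    rw [intervalIntegral.integral_const_mul, zero_add] at this
    rw [eq_div_iff (by positivity), mul_comm]
    exact this.symm
  have iter : ∀ k : ℕ, ∀ t ∈ Ioo 0 T,
      y t ≤ y0 * (∑ j ∈ Finset.range k, M t ^ j / j.factorial) + K * (M t ^ k / k.factorial) := by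
    intro k
    induction k with
    | zero => intro t ht; simpa using hyK t ht
    | succ k ih =>
      intro t ht
      have htI : t ∈ Icc 0 T := ⟨ht.1.le, ht.2.le⟩
      refine (hy t ht).trans ?_
      have hle : ∫ s in 0..t, m s * y s ≤ ∫ s in 0..t,
          (y0 * (∑ j ∈ Finset.range k, (m s * M s ^ j) / j.factorial)
            + K * ((m s * M s ^ k) / k.factorial)) := by
        apply intervalIntegral.integral_mono_ae_restrict ht.1.le (hmy.mono_set (hsub t ht))
        · refine IntervalIntegrable.add (IntervalIntegrable.const_mul ?_ _)
            (IntervalIntegrable.const_mul (((hMint k).mono_set (hsub t ht)).div_const _) _)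
          have := IntervalIntegrable.sum (Finset.range k) (μ := volume) (a := 0) (b := t)
            (f := fun j s => (m s * M s ^ j) / (j.factorial : ℝ))
            (fun j _ => ((hMint j).mono_set (hsub t ht)).div_const _)
          simpa only [Finset.sum_fn] using this
        · rw [← restrict_Ioo_eq_restrict_Icc]
          filter_upwards [ae_restrict_of_ae hm0', ae_restrict_mem measurableSet_Ioo] with s hs hst
          have hsT : s ∈ Ioo 0 T := ⟨hst.1, hst.2.trans ht.2⟩
          have := mul_le_mul_of_nonneg_left (ih s hsT) (hs hsT)
          refine this.trans (le_of_eq ?_)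
          rw [mul_add, ← mul_assoc, mul_comm (m s) y0, mul_assoc, Finset.mul_sum]
          congr 1
          · congr 1
            exact Finset.sum_congr rfl fun j _ => by ring
          · ring
      have heq : ∫ s in 0..t,
          (y0 * (∑ j ∈ Finset.range k, (m s * M s ^ j) / j.factorial)
            + K * ((m s * M s ^ k) / k.factorial)) =
          y0 * (∑ j ∈ Finset.range k, M t ^ (j + 1) / (j + 1).factorial)
            + K * (M t ^ (k + 1) / (k + 1).factorial) := by
        have hfac : ∀ j : ℕ, ∫ s in 0..t, (m s * M s ^ j) / (j.factorial : ℝ)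
            = M t ^ (j + 1) / (j + 1).factorial := by
          intro j
          rw [intervalIntegral.integral_div, hMpow j t htI, Nat.factorial_succ]
          push_cast
          field_simp
        rw [intervalIntegral.integral_add, intervalIntegral.integral_const_mul,
          intervalIntegral.integral_const_mul, hfac k, intervalIntegral.integral_finsetSum]
        · simp_rw [hfac]
        · exact fun j _ => ((hMint j).mono_set (hsub t ht)).div_const _
        · refine IntervalIntegrable.const_mul ?_ _
          have := IntervalIntegrable.sum (Finset.range k) (μ := volume) (a := 0) (b := t)
            (f := fun j s => (m s * M s ^ j) / (j.factorial : ℝ))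
            (fun j _ => ((hMint j).mono_set (hsub t ht)).div_const _)
          simpa only [Finset.sum_fn] using this
        · exact IntervalIntegrable.const_mul (((hMint k).mono_set (hsub t ht)).div_const _) _
      rw [heq] at hle
      rw [Finset.sum_range_succ']
      simp only [pow_zero, Nat.factorial_zero, Nat.cast_one, div_one]
      linarith
  intro t ht
  have hM0 : 0 ≤ M t := by
    apply intervalIntegral.integral_nonneg_of_ae_restrict ht.1.le
    rw [← restrict_Ioo_eq_restrict_Icc]
    filter_upwards [ae_restrict_of_ae hm0', ae_restrict_mem measurableSet_Ioo] with s hs hst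
    exact hs ⟨hst.1, hst.2.trans ht.2⟩
  have hMT : M t ≤ M T := by
    have h1 : M T - M t = ∫ s in t..T, m s := by
      apply intervalIntegral.integral_interval_sub_left hm (hm.mono_set (hsub t ht))
    have h2 : 0 ≤ ∫ s in t..T, m s := by
      apply intervalIntegral.integral_nonneg_of_ae_restrict ht.2.le
      rw [← restrict_Ioo_eq_restrict_Icc]
      filter_upwards [ae_restrict_of_ae hm0', ae_restrict_mem measurableSet_Ioo] with s hs hst
      exact hs ⟨ht.1.trans hst.1, hst.2⟩
    linarith
  have hlim : Tendsto (fun k : ℕ => y0 * Real.exp (M T) + K * (M t ^ k / k.factorial)) atTop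
      (nhds (y0 * Real.exp (M T) + K * 0)) :=
    tendsto_const_nhds.add ((FloorSemiring.tendsto_pow_div_factorial_atTop (M t)).const_mul K)
  rw [mul_zero, add_zero] at hlim
  refine ge_of_tendsto' hlim fun k => (iter k t ht).trans ?_
  gcongr
  exact (Real.sum_le_exp_of_nonneg hM0 k).trans (Real.exp_le_exp.2 hMT)

/-! ### Cosine and sine systems on an interval -/

/-- The square roots of the Neumann / Dirichlet eigenvalues on `(a,b)`. -/
def freq (a b : ℝ) (n : ℕ) : ℝ := n * Real.pi / (b - a)

/-- Cosine functions on `(a,b)`. -/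
def cosB (a b : ℝ) (n : ℕ) (x : ℝ) : ℝ := Real.cos (freq a b n * (x - a))

/-- Sine functions on `(a,b)`. -/
def sinB (a b : ℝ) (n : ℕ) (x : ℝ) : ℝ := Real.sin (freq a b n * (x - a))

/-- Cosine coefficients. -/
def cosC (a b : ℝ) (n : ℕ) (g : ℝ → ℝ) : ℝ := ∫ x in Ioo a b, g x * cosB a b n x

/-- Sine coefficients. -/
def sinC (a b : ℝ) (n : ℕ) (g : ℝ → ℝ) : ℝ := ∫ x in Ioo a b, g x * sinB a b n x

/-- Normalization weights of the cosine and sine systems. -/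
def wgt (a b : ℝ) (n : ℕ) : ℝ := if n = 0 then 1 / (b - a) else 2 / (b - a)

theorem memL2_iff {a b : ℝ} {g : ℝ → ℝ} :
    MemL2 a b g ↔ MemLp g 2 (volume.restrict (Ioo a b)) := by
  constructor
  · exact fun h => (memLp_two_iff_integrable_sq h.1).2 h.2
  · exact fun h => ⟨h.1, (memLp_two_iff_integrable_sq h.1).1 h⟩

theorem parseval_reflection {L : ℝ} (hL : 0 < L) {g : ℝ → ℝ}
    (hg : MemLp g 2 (volume.restrict (Ioo 0 L))) (σ : ℝ) (hσ : σ ^ 2 = 1) :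
    HasSum (fun n : ℤ => ‖(1 / (2 * L) : ℂ) * ∫ y in 0..L, (g y : ℂ) *
        (Complex.exp (-((n * Real.pi / L * y : ℝ) : ℂ) * Complex.I)
          + σ * Complex.exp (((n * Real.pi / L * y : ℝ) : ℂ) * Complex.I))‖ ^ 2)
      (1 / L * ∫ y in 0..L, g y ^ 2) := by
  have hg' : MemLp g 2 (volume.restrict (Ioc 0 L)) := by rwa [← restrict_Ioo_eq_restrict_Ioc]
  have hgI : IntervalIntegrable g volume 0 L := by
    rw [intervalIntegrable_iff_integrableOn_Ioc_of_le hL.le]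
    exact hg'.integrable one_le_two
  have hg2 : IntervalIntegrable (fun y => g y ^ 2) volume 0 L := by
    rw [intervalIntegrable_iff_integrableOn_Ioc_of_le hL.le]
    exact hg'.integrable_sq
  classical
  set e : ℝ → ℝ := (Ioi (0 : ℝ)).piecewise g (fun y => σ * g (-y)) with he
  have he1 : ∀ y, 0 < y → e y = g y := fun y hy => piecewise_eq_of_mem _ _ _ hy
  have he2 : ∀ y, 0 < y → e (-y) = σ * g y := fun y hy => by
    rw [he, piecewise_eq_of_notMem _ _ _ (by simp [hy.le]), neg_neg]
  have hneg : MemLp (fun y => g (-y)) 2 (volume.restrict (Ioo (-L) 0)) := by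
    have hmp : MeasurePreserving (fun y : ℝ => -y) (volume.restrict (Ioo (-L) 0))
        (volume.restrict (Ioo 0 L)) := by
      have := (Measure.measurePreserving_neg (volume : Measure ℝ)).restrict_preimage
        (measurableSet_Ioo (a := 0) (b := L))
      simpa using this
    exact hg.comp_measurePreserving hmp
  have heL : MemLp e 2 (volume.restrict (Ioc (-L) L)) := by
    refine MemLp.piecewise measurableSet_Ioi ?_ ?_
    · rw [Measure.restrict_restrict measurableSet_Ioi]
      refine hg'.mono_measure (Measure.restrict_mono ?_ le_rfl)
      intro y hy; exact ⟨hy.1, hy.2.2⟩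
    · rw [Measure.restrict_restrict measurableSet_Ioi.compl]
      refine (hneg.const_mul σ).mono_measure ?_
      rw [restrict_Ioo_eq_restrict_Ioc]
      refine Measure.restrict_mono ?_ le_rfl
      intro y hy; exact ⟨hy.2.1, not_lt.1 hy.1⟩
  have heC : MemLp (fun y => (e y : ℂ)) 2 (volume.restrict (Ioc (-L) L)) := heL.ofReal
  have hsplit : ∀ {E : Type} [NormedAddCommGroup E] [NormedSpace ℝ E] (F : ℝ → E),
      IntervalIntegrable F volume (-L) L → ∫ y in (-L)..L, F y = ∫ y in 0..L, (F y + F (-y)) := by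
    intro E _ _ F hF
    have h1 : IntervalIntegrable F volume (-L) 0 := hF.mono_set (by
      rw [uIcc_of_le (by linarith), uIcc_of_le (by linarith)]
      exact Icc_subset_Icc_right hL.le)
    have h2 : IntervalIntegrable F volume 0 L := hF.mono_set (by
      rw [uIcc_of_le (by linarith), uIcc_of_le (by linarith)]
      exact Icc_subset_Icc_left (by linarith))
    have h3 : IntervalIntegrable (fun y => F (-y)) volume 0 L := by
      have := (IntervalIntegrable.iff_comp_neg (f := F) (a := -L) (b := 0)).1 h1
      simpa using this.symm
    rw [← intervalIntegral.integral_add_adjacent_intervals h1 h2,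
      intervalIntegral.integral_add h2 h3, intervalIntegral.integral_comp_neg, neg_zero, add_comm]
  have heI : IntervalIntegrable (fun y => (e y : ℂ)) volume (-L) L := by
    rw [intervalIntegrable_iff_integrableOn_Ioc_of_le (by linarith)]
    exact heC.integrable one_le_two
  have hlt : -L < L := by linarith
  have key := hasSum_sq_fourierCoeffOn hlt heC
  convert key using 1
  · ext n
    rw [fourierCoeffOn_eq_integral]
    have hfun : ∀ y : ℝ, fourier (-n) (y : AddCircle (L - -L)) =
        Complex.exp (-((n * Real.pi / L * y : ℝ) : ℂ) * Complex.I) := by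
      intro y
      rw [fourier_coe_apply]
      congr 1
      have : (L : ℂ) ≠ 0 := by exact_mod_cast hL.ne'
      push_cast
      field_simp
      ring
    have hc : ContinuousOn (fun y : ℝ => fourier (-n) (y : AddCircle (L - -L)))
        (uIcc (-L) L) := by
      simp_rw [hfun]
      fun_prop
    rw [hsplit (fun y : ℝ => fourier (-n) (y : AddCircle (L - -L)) • (e y : ℂ))
      (by simpa [smul_eq_mul] using heI.continuousOn_mul hc)]
    have : ∫ y in 0..L, (fourier (-n) (y : AddCircle (L - -L)) • (e y : ℂ)
        + fourier (-n) ((-y : ℝ) : AddCircle (L - -L)) • (e (-y) : ℂ)) =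
        ∫ y in 0..L, (g y : ℂ) *
        (Complex.exp (-((n * Real.pi / L * y : ℝ) : ℂ) * Complex.I)
          + σ * Complex.exp (((n * Real.pi / L * y : ℝ) : ℂ) * Complex.I)) := by
      apply intervalIntegral.integral_congr_ae
      refine Eventually.of_forall fun y hy => ?_
      rw [uIoc_of_le hL.le] at hy
      rw [hfun, hfun, he1 y hy.1, he2 y hy.1, smul_eq_mul, smul_eq_mul]
      have : -((n * Real.pi / L * (-y) : ℝ) : ℂ) = ((n * Real.pi / L * y : ℝ) : ℂ) := by
        push_cast; ring
      rw [this]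
      push_cast
      ring
    rw [this, Complex.real_smul]
    congr 3
    push_cast
    ring
  · rw [hsplit (fun y => ‖(e y : ℂ)‖ ^ 2)]
    · have : ∫ y in 0..L, (‖(e y : ℂ)‖ ^ 2 + ‖(e (-y) : ℂ)‖ ^ 2) = ∫ y in 0..L, 2 * g y ^ 2 := by
        apply intervalIntegral.integral_congr_ae
        refine Eventually.of_forall fun y hy => ?_
        rw [uIoc_of_le hL.le] at hy
        rw [he1 y hy.1, he2 y hy.1]
        simp only [Complex.norm_real, Real.norm_eq_abs, sq_abs]
        rw [mul_pow, hσ]; ring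
      rw [this, intervalIntegral.integral_const_mul, smul_eq_mul]
      field_simp
      ring
    · rw [intervalIntegrable_iff_integrableOn_Ioc_of_le (by linarith)]
      simpa [IntegrableOn] using heL.integrable_sq

theorem freq_nonneg {a b : ℝ} (hab : a < b) (n : ℕ) : 0 ≤ freq a b n := by
  have : 0 < b - a := sub_pos.2 hab
  unfold freq; positivity

theorem wgt_nonneg {a b : ℝ} (hab : a < b) (n : ℕ) : 0 ≤ wgt a b n := by
  have : 0 < b - a := sub_pos.2 hab
  unfold wgt; split_ifs <;> positivity

theorem integral_Ioo_eq_shift {a b : ℝ} (hab : a < b) (F : ℝ → ℝ) :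
    ∫ x in Ioo a b, F x = ∫ y in 0..(b - a), F (y + a) := by
  rw [intervalIntegral.integral_comp_add_right, zero_add, sub_add_cancel,
    intervalIntegral.integral_of_le hab.le, integral_Ioc_eq_integral_Ioo]

theorem hasSum_nat_of_int {L S : ℝ} (hL : 0 < L) {f : ℤ → ℝ} {c : ℕ → ℝ}
    (hf : ∀ n : ℤ, f n = (1 / L * c n.natAbs) ^ 2) (h : HasSum f (1 / L * S)) :
    HasSum (fun n => (if n = 0 then 1 / L else 2 / L) * c n ^ 2) S := by
  have h1 := h.nat_add_neg
  have h2 : HasSum (fun n : ℕ => if n = 0 then f 0 else 0) (f 0) := hasSum_ite_eq 0 (f 0)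
  have h3 := (h1.sub h2).mul_left L
  have hS : L * (1 / L * S + f 0 - f 0) = S := by field_simp; ring
  rw [hS] at h3
  refine h3.congr_fun ?_
  intro n
  by_cases hn : n = 0
  · subst hn
    simp only [hf, if_true, Nat.cast_zero, neg_zero, Int.natAbs_zero]
    field_simp
    ring
  · simp only [hn, if_false, hf, Int.natAbs_neg, Int.natAbs_natCast]
    field_simp
    ring

theorem memLp_shift {a b : ℝ} {g : ℝ → ℝ} (hg : MemL2 a b g) :
    MemLp (fun y => g (y + a)) 2 (volume.restrict (Ioo 0 (b - a))) := by
  have hmp : MeasurePreserving (fun y : ℝ => y + a) (volume.restrict (Ioo 0 (b - a)))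
      (volume.restrict (Ioo a b)) := by
    have := (measurePreserving_add_right (volume : Measure ℝ) a).restrict_preimage
      (measurableSet_Ioo (a := a) (b := b))
    simpa using this
  exact (memL2_iff.1 hg).comp_measurePreserving hmp

theorem hasSum_cosC_sq {a b : ℝ} (hab : a < b) {g : ℝ → ℝ} (hg : MemL2 a b g) :
    HasSum (fun n => wgt a b n * cosC a b n g ^ 2) (sqOm a b g) := by
  have hL : 0 < b - a := sub_pos.2 hab
  have h := parseval_reflection hL (memLp_shift hg) 1 (by norm_num)
  unfold sqOm
  rw [integral_Ioo_eq_shift hab]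
  refine hasSum_nat_of_int hL (c := fun n => cosC a b n g) ?_ h
  intro n
  have hI : ∫ y in 0..(b - a), ((g (y + a) : ℝ) : ℂ) *
        (Complex.exp (-((n * Real.pi / (b - a) * y : ℝ) : ℂ) * Complex.I)
          + (1 : ℝ) * Complex.exp (((n * Real.pi / (b - a) * y : ℝ) : ℂ) * Complex.I))
      = ((2 * cosC a b n.natAbs g : ℝ) : ℂ) := by
    rw [cosC, integral_Ioo_eq_shift hab, ← intervalIntegral.integral_const_mul,
      ← intervalIntegral.integral_ofReal]
    apply intervalIntegral.integral_congr
    intro y _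
    simp only [cosB, freq, add_sub_cancel_right]
    have hcos : Real.cos (n.natAbs * Real.pi / (b - a) * y)
        = Real.cos (n * Real.pi / (b - a) * y) := by
      obtain ⟨m, rfl | rfl⟩ := n.eq_nat_or_neg
      · simp
      · rw [← Real.cos_neg, Int.natAbs_neg, Int.natAbs_natCast]
        congr 1
        push_cast
        ring
    rw [hcos]
    push_cast
    rw [Complex.cos]
    ring
  rw [hI, norm_mul, mul_pow, mul_pow, Complex.norm_real, Real.norm_eq_abs, sq_abs]
  simp only [norm_div, norm_one, norm_mul, Complex.norm_ofNat,
    Complex.norm_real, Real.norm_eq_abs, abs_of_pos hL]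
  field_simp
  try ring

theorem hasSum_sinC_sq {a b : ℝ} (hab : a < b) {g : ℝ → ℝ} (hg : MemL2 a b g) :
    HasSum (fun n => wgt a b n * sinC a b n g ^ 2) (sqOm a b g) := by
  have hL : 0 < b - a := sub_pos.2 hab
  have h := parseval_reflection hL (memLp_shift hg) (-1) (by norm_num)
  unfold sqOm
  rw [integral_Ioo_eq_shift hab]
  refine hasSum_nat_of_int hL (c := fun n => sinC a b n g) ?_ h
  intro n
  have hI : ∃ ε : ℝ, ε ^ 2 = 1 ∧ ∫ y in 0..(b - a), ((g (y + a) : ℝ) : ℂ) *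
        (Complex.exp (-((n * Real.pi / (b - a) * y : ℝ) : ℂ) * Complex.I)
          + (-1 : ℝ) * Complex.exp (((n * Real.pi / (b - a) * y : ℝ) : ℂ) * Complex.I))
      = Complex.I * ((ε * (2 * sinC a b n.natAbs g) : ℝ) : ℂ) := by
    have hsin : ∃ ε : ℝ, ε ^ 2 = 1 ∧ ∀ y, Real.sin (n * Real.pi / (b - a) * y)
        = - ε * Real.sin (n.natAbs * Real.pi / (b - a) * y) := by
      obtain ⟨m, rfl | rfl⟩ := n.eq_nat_or_neg
      · exact ⟨-1, by norm_num, fun y => by simp⟩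
      · refine ⟨1, by norm_num, fun y => ?_⟩
        rw [neg_one_mul, ← Real.sin_neg, Int.natAbs_neg, Int.natAbs_natCast]
        congr 1
        push_cast
        ring
    obtain ⟨ε, hε, hs⟩ := hsin
    refine ⟨ε, hε, ?_⟩
    rw [sinC, integral_Ioo_eq_shift hab, ← intervalIntegral.integral_const_mul,
      ← intervalIntegral.integral_const_mul,
      ← intervalIntegral.integral_ofReal, ← intervalIntegral.integral_const_mul]
    apply intervalIntegral.integral_congr
    intro y _
    simp only [sinB, freq, add_sub_cancel_right]
    have : ε * (2 * (g (y + a) * Real.sin (n.natAbs * Real.pi / (b - a) * y)))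
        = - 2 * (g (y + a) * Real.sin (n * Real.pi / (b - a) * y)) := by
      rw [hs]; ring
    rw [this]
    push_cast
    rw [Complex.sin]
    ring_nf
    rw [Complex.I_sq]
    ring
  obtain ⟨ε, hε, hI⟩ := hI
  rw [hI, norm_mul, norm_mul, mul_pow, mul_pow, Complex.norm_real, Real.norm_eq_abs,
    Complex.norm_I, one_pow, one_mul, sq_abs, mul_pow ε, hε]
  simp only [norm_div, norm_one, norm_mul, Complex.norm_ofNat,
    Complex.norm_real, Real.norm_eq_abs, abs_of_pos hL]
  field_simp
  try ring

/-! ### Square integrable functions on an interval -/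

section L2

variable {a b : ℝ} {g h : ℝ → ℝ}

theorem MemL2.add (hg : MemL2 a b g) (hh : MemL2 a b h) : MemL2 a b (fun x => g x + h x) :=
  memL2_iff.2 ((memL2_iff.1 hg).add (memL2_iff.1 hh))

theorem MemL2.sub (hg : MemL2 a b g) (hh : MemL2 a b h) : MemL2 a b (fun x => g x - h x) :=
  memL2_iff.2 ((memL2_iff.1 hg).sub (memL2_iff.1 hh))

theorem MemL2.integrable (hg : MemL2 a b g) : IntegrableOn g (Ioo a b) :=
  (memL2_iff.1 hg).integrable one_le_two

theorem MemL2.integrable_mul (hg : MemL2 a b g) (hh : MemL2 a b h) :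
    IntegrableOn (fun x => g x * h x) (Ioo a b) :=
  MemLp.integrable_mul (memL2_iff.1 hg) (memL2_iff.1 hh)

theorem memL2_of_continuous (hg : Continuous g) : MemL2 a b g := by
  refine ⟨hg.aestronglyMeasurable, ?_⟩
  exact ((hg.pow 2).integrableOn_Icc).mono_set Ioo_subset_Icc_self

theorem sqOm_nonneg (a b : ℝ) (g : ℝ → ℝ) : 0 ≤ sqOm a b g :=
  integral_nonneg fun _ => sq_nonneg _

theorem sqOm_sub (hg : MemL2 a b g) (hh : MemL2 a b h) :
    sqOm a b (fun x => g x - h x) = sqOm a b g - 2 * (∫ x in Ioo a b, g x * h x) + sqOm a b h := by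
  unfold sqOm
  have hgh : Integrable (fun x => 2 * (g x * h x)) (volume.restrict (Ioo a b)) :=
    Integrable.const_mul (hg.integrable_mul hh) 2
  have hs : Integrable (fun x => g x ^ 2 - 2 * (g x * h x)) (volume.restrict (Ioo a b)) :=
    Integrable.sub hg.2 hgh
  rw [← integral_const_mul, ← integral_sub hg.2 hgh, ← integral_add hs hh.2]
  congr 1
  ext x
  ring

theorem sqOm_add (hg : MemL2 a b g) (hh : MemL2 a b h) :
    sqOm a b (fun x => g x + h x) = sqOm a b g + 2 * (∫ x in Ioo a b, g x * h x) + sqOm a b h := by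
  unfold sqOm
  have hgh : Integrable (fun x => 2 * (g x * h x)) (volume.restrict (Ioo a b)) :=
    Integrable.const_mul (hg.integrable_mul hh) 2
  have hs : Integrable (fun x => g x ^ 2 + 2 * (g x * h x)) (volume.restrict (Ioo a b)) :=
    Integrable.add hg.2 hgh
  rw [← integral_const_mul, ← integral_add hg.2 hgh, ← integral_add hs hh.2]
  congr 1
  ext x
  ring

theorem sqOm_sub_comm (a b : ℝ) (g h : ℝ → ℝ) :
    sqOm a b (fun x => g x - h x) = sqOm a b (fun x => h x - g x) := by
  unfold sqOm
  congr 1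
  ext x
  ring

/-- The Cauchy–Schwarz inequality. -/
theorem integral_abs_mul_le (hg : MemL2 a b g) (hh : MemL2 a b h) :
    ∫ x in Ioo a b, |g x| * |h x| ≤ √(sqOm a b g) * √(sqOm a b h) := by
  have h1 := integral_mul_le_Lp_mul_Lq_of_nonneg Real.HolderConjugate.two_two
    (μ := volume.restrict (Ioo a b)) (f := fun x => |g x|) (g := fun x => |h x|)
    (Eventually.of_forall fun _ => abs_nonneg _) (Eventually.of_forall fun _ => abs_nonneg _)
    (by rw [ENNReal.ofReal_ofNat]; exact (memL2_iff.1 hg).abs)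
    (by rw [ENNReal.ofReal_ofNat]; exact (memL2_iff.1 hh).abs)
  simpa [sqOm, Real.sqrt_eq_rpow] using h1

theorem abs_integral_mul_le (hg : MemL2 a b g) (hh : MemL2 a b h) :
    |∫ x in Ioo a b, g x * h x| ≤ √(sqOm a b g) * √(sqOm a b h) := by
  refine le_trans (abs_integral_le_integral_abs) ?_
  simp_rw [abs_mul]
  exact integral_abs_mul_le hg hh

theorem sqOm_add_le (hg : MemL2 a b g) (hh : MemL2 a b h) :
    sqOm a b (fun x => g x + h x) ≤ 2 * sqOm a b g + 2 * sqOm a b h := by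
  have h1 := sqOm_add hg hh
  have h2 := sqOm_sub hg hh
  have h3 := sqOm_nonneg a b (fun x => g x - h x)
  linarith

theorem integrableOn_mul_continuous (hg : IntegrableOn g (Ioo a b)) (hh : Continuous h) :
    IntegrableOn (fun x => g x * h x) (Ioo a b) := by
  obtain ⟨K, hK⟩ := isCompact_Icc.exists_bound_of_continuousOn (hh.continuousOn (s := Icc a b))
  refine Integrable.mul_bdd (c := K) hg hh.aestronglyMeasurable ?_
  filter_upwards [ae_restrict_mem measurableSet_Ioo] with x hx
  exact hK x (Ioo_subset_Icc_self hx)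

end L2

/-! ### Orthogonal systems satisfying Parseval's identity -/

/-- Generalized Fourier coefficient of `g` with respect to the system `e`. -/
def coef (a b : ℝ) (e : ℕ → ℝ → ℝ) (n : ℕ) (g : ℝ → ℝ) : ℝ := ∫ x in Ioo a b, g x * e n x

/-- Partial sums of generalized Fourier series. -/
def partSum (a b : ℝ) (e : ℕ → ℝ → ℝ) (w : ℕ → ℝ) (N : ℕ) (g : ℝ → ℝ) (x : ℝ) : ℝ :=
  ∑ n ∈ Finset.range N, w n * coef a b e n g * e n x

/-- A continuous orthogonal system in `L²(a,b)`, with weights `w` for which Parseval's identity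
holds. -/
structure IsParsevalSystem (a b : ℝ) (e : ℕ → ℝ → ℝ) (w : ℕ → ℝ) : Prop where
  cont : ∀ n, Continuous (e n)
  nonneg : ∀ n, 0 ≤ w n
  parseval : ∀ g, MemL2 a b g → HasSum (fun n => w n * coef a b e n g ^ 2) (sqOm a b g)
  orth : ∀ m n, m ≠ n → coef a b e m (e n) = 0

theorem coef_sub {a b : ℝ} {e : ℕ → ℝ → ℝ} (n : ℕ) (he : Continuous (e n)) {g h : ℝ → ℝ}
    (hg : IntegrableOn g (Ioo a b)) (hh : IntegrableOn h (Ioo a b)) :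
    coef a b e n (fun x => g x - h x) = coef a b e n g - coef a b e n h := by
  unfold coef
  rw [← integral_sub (integrableOn_mul_continuous hg he) (integrableOn_mul_continuous hh he)]
  simp_rw [sub_mul]

theorem coef_add {a b : ℝ} {e : ℕ → ℝ → ℝ} (n : ℕ) (he : Continuous (e n)) {g h : ℝ → ℝ}
    (hg : IntegrableOn g (Ioo a b)) (hh : IntegrableOn h (Ioo a b)) :
    coef a b e n (fun x => g x + h x) = coef a b e n g + coef a b e n h := by
  unfold coef
  rw [← integral_add (integrableOn_mul_continuous hg he) (integrableOn_mul_continuous hh he)]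
  simp_rw [add_mul]

namespace IsParsevalSystem

variable {a b : ℝ} {e : ℕ → ℝ → ℝ} {w : ℕ → ℝ} {g h : ℝ → ℝ}

theorem hasSum_mul (he : IsParsevalSystem a b e w) (hg : MemL2 a b g) (hh : MemL2 a b h) :
    HasSum (fun n => w n * (coef a b e n g * coef a b e n h)) (∫ x in Ioo a b, g x * h x) := by
  have h1 := ((he.parseval _ (hg.add hh)).sub (he.parseval _ (hg.sub hh))).mul_left (1 / 4)
  rw [sqOm_add hg hh, sqOm_sub hg hh] at h1
  have hv : 1 / 4 * (sqOm a b g + 2 * (∫ x in Ioo a b, g x * h x) + sqOm a b h -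
      (sqOm a b g - 2 * (∫ x in Ioo a b, g x * h x) + sqOm a b h)) =
      ∫ x in Ioo a b, g x * h x := by ring
  rw [hv] at h1
  refine h1.congr_fun ?_
  intro n
  rw [coef_add n (he.cont n) hg.integrable hh.integrable,
    coef_sub n (he.cont n) hg.integrable hh.integrable]
  ring

theorem sum_sq_le (he : IsParsevalSystem a b e w) (hg : MemL2 a b g) (N : ℕ) :
    ∑ n ∈ Finset.range N, w n * coef a b e n g ^ 2 ≤ sqOm a b g :=
  sum_le_hasSum _ (fun n _ => mul_nonneg (he.nonneg n) (sq_nonneg _)) (he.parseval g hg)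

theorem abs_sum_mul_le (he : IsParsevalSystem a b e w) (hg : MemL2 a b g) (hh : MemL2 a b h) (N : ℕ) :
    |∑ n ∈ Finset.range N, w n * (coef a b e n g * coef a b e n h)| ≤
      sqOm a b g + sqOm a b h := by
  refine (Finset.abs_sum_le_sum_abs _ _).trans ?_
  refine le_trans ?_ (add_le_add (he.sum_sq_le hg N) (he.sum_sq_le hh N))
  rw [← Finset.sum_add_distrib]
  refine Finset.sum_le_sum fun n _ => ?_
  rw [abs_mul, abs_of_nonneg (he.nonneg n), ← mul_add, abs_mul]
  refine mul_le_mul_of_nonneg_left ?_ (he.nonneg n)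
  nlinarith [sq_nonneg (|coef a b e n g| - |coef a b e n h|), sq_abs (coef a b e n g),
    sq_abs (coef a b e n h), sq_nonneg (coef a b e n g), sq_nonneg (coef a b e n h)]

theorem coef_mul_self (he : IsParsevalSystem a b e w) (hg : MemL2 a b g) (m : ℕ) :
    w m * coef a b e m g * coef a b e m (e m) = coef a b e m g := by
  have hm := memL2_of_continuous (a := a) (b := b) (he.cont m)
  have h1 : w m * coef a b e m (e m) ^ 2 = coef a b e m (e m) := by
    have h2 := he.parseval _ hm
    have h3 : HasSum (fun n => w n * coef a b e n (e m) ^ 2) (w m * coef a b e m (e m) ^ 2) := by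
      refine hasSum_single m fun n hn => ?_
      rw [he.orth n m hn]; ring
    rw [h3.unique h2]
    unfold sqOm coef
    simp_rw [sq]
  by_cases h0 : coef a b e m (e m) = 0
  · have h4 : sqOm a b (e m) = 0 := by
      rw [← h0]; unfold sqOm coef; simp_rw [sq]
    have h5 := abs_integral_mul_le hg hm
    rw [h4, Real.sqrt_zero, mul_zero] at h5
    have h6 : coef a b e m g = 0 := abs_eq_zero.1 (le_antisymm h5 (abs_nonneg _))
    rw [h6]; ring
  · have h4 : w m * coef a b e m (e m) = 1 := by
      have : (w m * coef a b e m (e m)) * coef a b e m (e m) = 1 * coef a b e m (e m) := by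
        linarith [h1]
      exact mul_right_cancel₀ h0 this
    rw [mul_right_comm, h4, one_mul]

theorem continuous_partSum (he : IsParsevalSystem a b e w) (N : ℕ) (g : ℝ → ℝ) :
    Continuous (partSum a b e w N g) := by
  unfold partSum
  exact continuous_finsetSum _ fun n _ => continuous_const.mul (he.cont n)

theorem memL2_partSum (he : IsParsevalSystem a b e w) (N : ℕ) (g : ℝ → ℝ) :
    MemL2 a b (partSum a b e w N g) :=
  memL2_of_continuous (he.continuous_partSum N g)

theorem integral_mul_partSum (he : IsParsevalSystem a b e w) (hh : IntegrableOn h (Ioo a b)) (N : ℕ) :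
    ∫ x in Ioo a b, h x * partSum a b e w N g x =
      ∑ n ∈ Finset.range N, w n * (coef a b e n g * coef a b e n h) := by
  unfold partSum
  simp_rw [Finset.mul_sum]
  rw [integral_finsetSum]
  · refine Finset.sum_congr rfl fun n _ => ?_
    rw [← mul_assoc]
    conv_rhs => rw [coef]
    conv_rhs => arg 2; rw [coef]
    rw [← integral_const_mul]
    congr 1
    ext x
    rw [coef]
    ring
  · intro n _
    exact integrableOn_mul_continuous hh (continuous_const.mul (he.cont n))

theorem coef_partSum (he : IsParsevalSystem a b e w) (hg : MemL2 a b g) (N m : ℕ) :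
    coef a b e m (partSum a b e w N g) = if m < N then coef a b e m g else 0 := by
  have h1 : coef a b e m (partSum a b e w N g) =
      ∫ x in Ioo a b, e m x * partSum a b e w N g x := by
    unfold coef; simp_rw [mul_comm]
  have hm := memL2_of_continuous (a := a) (b := b) (he.cont m)
  rw [h1, he.integral_mul_partSum hm.integrable]
  by_cases hmN : m < N
  · rw [if_pos hmN, Finset.sum_eq_single m]
    · rw [← mul_assoc]; exact he.coef_mul_self hg m
    · intro n _ hn
      rw [he.orth n m hn]; ring
    · intro hm'; exact absurd (Finset.mem_range.2 hmN) hm'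
  · rw [if_neg hmN]
    refine Finset.sum_eq_zero fun n hn => ?_
    have : n ≠ m := fun h => hmN (h ▸ Finset.mem_range.1 hn)
    rw [he.orth n m this]; ring

theorem sqOm_partSum_le (he : IsParsevalSystem a b e w) (hg : MemL2 a b g) (N : ℕ) :
    sqOm a b (partSum a b e w N g) ≤ sqOm a b g := by
  have h1 := he.parseval _ (he.memL2_partSum N g)
  refine hasSum_le (fun n => ?_) h1 (he.parseval g hg)
  rw [he.coef_partSum hg]
  refine mul_le_mul_of_nonneg_left ?_ (he.nonneg n)
  split_ifs
  · exact le_rfl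
  · nlinarith [sq_nonneg (coef a b e n g)]

theorem tendsto_sqOm_sub_partSum (he : IsParsevalSystem a b e w) (hg : MemL2 a b g) :
    Tendsto (fun N => sqOm a b (fun x => g x - partSum a b e w N g x)) atTop (nhds 0) := by
  have hP := he.parseval g hg
  have h1 : ∀ N, sqOm a b (fun x => g x - partSum a b e w N g x) =
      sqOm a b g - ∑ n ∈ Finset.range N, w n * coef a b e n g ^ 2 := by
    intro N
    rw [sqOm_sub hg (he.memL2_partSum N g), he.integral_mul_partSum hg.integrable]
    have h2 : sqOm a b (partSum a b e w N g) =
        ∑ n ∈ Finset.range N, w n * coef a b e n g ^ 2 := by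
      have h3 : sqOm a b (partSum a b e w N g) =
        ∫ x in Ioo a b, partSum a b e w N g x * partSum a b e w N g x := by
        unfold sqOm; simp_rw [sq]
      rw [h3, he.integral_mul_partSum (he.memL2_partSum N g).integrable]
      refine Finset.sum_congr rfl fun n hn => ?_
      rw [he.coef_partSum hg, if_pos (Finset.mem_range.1 hn), sq]
    rw [h2]
    simp_rw [← sq]
    ring
  simp_rw [h1]
  have := (tendsto_const_nhds (x := sqOm a b g)).sub hP.tendsto_sum_nat
  rwa [sub_self] at this

end IsParsevalSystem

theorem continuous_cosB (a b : ℝ) (n : ℕ) : Continuous (cosB a b n) := by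
  unfold cosB; fun_prop

theorem continuous_sinB (a b : ℝ) (n : ℕ) : Continuous (sinB a b n) := by
  unfold sinB; fun_prop

theorem hasDerivAt_cosB (a b : ℝ) (n : ℕ) (x : ℝ) :
    HasDerivAt (cosB a b n) (-freq a b n * sinB a b n x) x := by
  have h1 : HasDerivAt (fun x => freq a b n * (x - a)) (freq a b n) x := by
    simpa using ((hasDerivAt_id x).sub_const a).const_mul (freq a b n)
  have := (Real.hasDerivAt_cos (freq a b n * (x - a))).comp x h1
  refine this.congr_deriv ?_
  unfold sinB
  ring

theorem hasDerivAt_sinB (a b : ℝ) (n : ℕ) (x : ℝ) :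
    HasDerivAt (sinB a b n) (freq a b n * cosB a b n x) x := by
  have h1 : HasDerivAt (fun x => freq a b n * (x - a)) (freq a b n) x := by
    simpa using ((hasDerivAt_id x).sub_const a).const_mul (freq a b n)
  have := (Real.hasDerivAt_sin (freq a b n * (x - a))).comp x h1
  refine this.congr_deriv ?_
  unfold cosB
  ring

theorem sinB_left (a b : ℝ) (n : ℕ) : sinB a b n a = 0 := by simp [sinB]

theorem sinB_right {a b : ℝ} (hab : a < b) (n : ℕ) : sinB a b n b = 0 := by
  have h : b - a ≠ 0 := (sub_pos.2 hab).ne'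
  unfold sinB freq
  rw [div_mul_cancel₀ _ h]
  exact Real.sin_nat_mul_pi n

theorem freq_sq_sub_ne {a b : ℝ} (hab : a < b) {m n : ℕ} (h : m ≠ n) :
    freq a b m ^ 2 - freq a b n ^ 2 ≠ 0 := by
  have hL : b - a ≠ 0 := (sub_pos.2 hab).ne'
  intro h0
  have h1 : freq a b m = freq a b n :=
    (sq_eq_sq₀ (freq_nonneg hab m) (freq_nonneg hab n)).1 (sub_eq_zero.1 h0)
  unfold freq at h1
  have h2 : (m : ℝ) = n := by
    have := Real.pi_ne_zero
    field_simp at h1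
    exact h1
  exact h (by exact_mod_cast h2)

theorem integral_Ioo_deriv_eq_sub {a b : ℝ} (hab : a < b) {F F' : ℝ → ℝ}
    (hF : ∀ x, HasDerivAt F (F' x) x) (hF' : Continuous F') :
    ∫ x in Ioo a b, F' x = F b - F a := by
  rw [← integral_Ioc_eq_integral_Ioo, ← intervalIntegral.integral_of_le hab.le]
  exact intervalIntegral.integral_eq_sub_of_hasDerivAt (fun x _ => hF x)
    (hF'.intervalIntegrable _ _)

theorem isParsevalSystem_cosB {a b : ℝ} (hab : a < b) :
    IsParsevalSystem a b (cosB a b) (wgt a b) where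
  cont := continuous_cosB a b
  nonneg := wgt_nonneg hab
  parseval _ hg := hasSum_cosC_sq hab hg
  orth m n hmn := by
    have h := integral_Ioo_deriv_eq_sub hab
      (F := fun x => freq a b m * (sinB a b m x * cosB a b n x)
        - freq a b n * (cosB a b m x * sinB a b n x))
      (F' := fun x => (freq a b m ^ 2 - freq a b n ^ 2) * (cosB a b n x * cosB a b m x))
      (fun x => by
        refine ((((hasDerivAt_sinB a b m x).mul (hasDerivAt_cosB a b n x)).const_mul _).sub
          (((hasDerivAt_cosB a b m x).mul (hasDerivAt_sinB a b n x)).const_mul _)).congr_deriv ?_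
        ring)
      (continuous_const.mul ((continuous_cosB a b n).mul (continuous_cosB a b m)))
    simp only [sinB_left, sinB_right hab, integral_const_mul] at h
    simp only [mul_zero, zero_mul, sub_zero, mul_eq_zero, freq_sq_sub_ne hab hmn, false_or] at h
    exact h

theorem isParsevalSystem_sinB {a b : ℝ} (hab : a < b) :
    IsParsevalSystem a b (sinB a b) (wgt a b) where
  cont := continuous_sinB a b
  nonneg := wgt_nonneg hab
  parseval _ hg := hasSum_sinC_sq hab hg
  orth m n hmn := by
    have h := integral_Ioo_deriv_eq_sub hab
      (F := fun x => freq a b n * (sinB a b m x * cosB a b n x)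
        - freq a b m * (cosB a b m x * sinB a b n x))
      (F' := fun x => (freq a b m ^ 2 - freq a b n ^ 2) * (sinB a b n x * sinB a b m x))
      (fun x => by
        refine ((((hasDerivAt_sinB a b m x).mul (hasDerivAt_cosB a b n x)).const_mul _).sub
          (((hasDerivAt_cosB a b m x).mul (hasDerivAt_sinB a b n x)).const_mul _)).congr_deriv ?_
        ring)
      (continuous_const.mul ((continuous_sinB a b n).mul (continuous_sinB a b m)))
    simp only [sinB_left, sinB_right hab, integral_const_mul] at h
    simp only [mul_zero, zero_mul, sub_zero, mul_eq_zero, freq_sq_sub_ne hab hmn, false_or] at h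
    exact h

/-! ### Integration by parts against test functions vanishing at the boundary only -/

theorem exists_bound_deriv_smoothTransition :
    ∃ C : ℝ, 0 ≤ C ∧ ∀ y, |deriv Real.smoothTransition y| ≤ C ∧
      (y ∉ Icc (0 : ℝ) 1 → deriv Real.smoothTransition y = 0) := by
  have hc : Continuous (deriv Real.smoothTransition) :=
    (Real.smoothTransition.contDiff (n := 1)).continuous_deriv le_rfl
  obtain ⟨C, hC⟩ := isCompact_Icc.exists_bound_of_continuousOn (hc.continuousOn (s := Icc 0 1))
  have h0 : ∀ y, y ∉ Icc (0 : ℝ) 1 → deriv Real.smoothTransition y = 0 := by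
    intro y hy
    rcases lt_or_ge y 0 with h | h
    · have : Real.smoothTransition =ᶠ[nhds y] fun _ => 0 := by
        filter_upwards [Iio_mem_nhds h] with z hz
        exact Real.smoothTransition.zero_of_nonpos (le_of_lt hz)
      rw [this.deriv_eq, deriv_const]
    · have h1 : 1 < y := by
        by_contra hle
        exact hy ⟨h, not_lt.1 hle⟩
      have : Real.smoothTransition =ᶠ[nhds y] fun _ => 1 := by
        filter_upwards [Ioi_mem_nhds h1] with z hz
        exact Real.smoothTransition.one_of_one_le (le_of_lt hz)
      rw [this.deriv_eq, deriv_const]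
  refine ⟨max C 0, le_max_right _ _, fun y => ⟨?_, h0 y⟩⟩
  by_cases hy : y ∈ Icc (0 : ℝ) 1
  · exact (hC y hy).trans (le_max_left _ _)
  · rw [h0 y hy, abs_zero]; exact le_max_right _ _

/-- Cutoff functions exhausting `(a,b)`. -/
def cutoff (a b : ℝ) (j : ℕ) (x : ℝ) : ℝ :=
  Real.smoothTransition (j * ((x - a) * (b - x)) - 1)

theorem contDiff_cutoff (a b : ℝ) (j : ℕ) : ContDiff ℝ (⊤ : ℕ∞) (cutoff a b j) := by
  unfold cutoff
  exact Real.smoothTransition.contDiff.comp (by fun_prop)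

theorem tsupport_cutoff_subset (a b : ℝ) (j : ℕ) :
    tsupport (cutoff a b j) ⊆ {x | 0 < (x - a) * (b - x)} := by
  have h1 : tsupport (cutoff a b j) ⊆ {x | (1 : ℝ) ≤ j * ((x - a) * (b - x))} := by
    refine closure_minimal ?_ (isClosed_le continuous_const (by fun_prop))
    intro x hx
    by_contra h
    refine hx (Real.smoothTransition.zero_of_nonpos ?_)
    simp only [Set.mem_ofPred_eq, not_le] at h
    linarith
  intro x hx
  have h2 : (1 : ℝ) ≤ j * ((x - a) * (b - x)) := h1 hx
  have hj : (0 : ℝ) ≤ j := Nat.cast_nonneg j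
  by_contra h
  have h3 : (x - a) * (b - x) ≤ 0 := not_lt.1 h
  nlinarith [mul_nonneg hj (neg_nonneg.2 h3)]

theorem mem_Ioo_of_mul_pos {a b x : ℝ} (hab : a < b) (h : 0 < (x - a) * (b - x)) : x ∈ Ioo a b := by
  rcases mul_pos_iff.1 h with ⟨h1, h2⟩ | ⟨h1, h2⟩
  · exact ⟨by linarith, by linarith⟩
  · linarith

theorem hasDerivAt_cutoff (a b : ℝ) (j : ℕ) (x : ℝ) :
    HasDerivAt (cutoff a b j) (deriv Real.smoothTransition (j * ((x - a) * (b - x)) - 1) *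
      (j * (a + b - 2 * x))) x := by
  have h1 : HasDerivAt (fun x : ℝ => (j : ℝ) * ((x - a) * (b - x)) - 1) (j * (a + b - 2 * x)) x := by
    refine (((((hasDerivAt_id x).sub_const a).mul ((hasDerivAt_id x).const_sub b)).const_mul
      (j : ℝ)).sub_const 1).congr_deriv ?_
    simp only [id]
    ring
  exact HasDerivAt.comp x ((Real.smoothTransition.contDiff (n := 1)).differentiable
    one_ne_zero _).hasDerivAt h1

theorem cutoff_eventuallyEq_one {a b x : ℝ} (hx : x ∈ Ioo a b) :
    ∀ᶠ j : ℕ in atTop, cutoff a b j =ᶠ[nhds x] fun _ => 1 := by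
  have hw : 0 < (x - a) * (b - x) := mul_pos (by linarith [hx.1]) (by linarith [hx.2])
  have h1 : ∀ᶠ j : ℕ in atTop, 2 / ((x - a) * (b - x)) < (j : ℝ) :=
    tendsto_natCast_atTop_atTop.eventually_gt_atTop _
  filter_upwards [h1] with j hj
  rw [div_lt_iff₀ hw] at hj
  have hc : Continuous fun x : ℝ => (j : ℝ) * ((x - a) * (b - x)) := by fun_prop
  filter_upwards [hc.continuousAt.eventually (lt_mem_nhds hj)] with y hy
  refine Real.smoothTransition.one_of_one_le ?_
  linarith

theorem abs_deriv_cutoff_mul_le {a b : ℝ} {ψ : ℝ → ℝ} {C K : ℝ} (hK : 0 ≤ K)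
    (hC : ∀ y, |deriv Real.smoothTransition y| ≤ C ∧
      (y ∉ Icc (0 : ℝ) 1 → deriv Real.smoothTransition y = 0))
    (hψa : ∀ x ∈ Ioo a b, |ψ x| ≤ K * (x - a)) (hψb : ∀ x ∈ Ioo a b, |ψ x| ≤ K * (b - x))
    (j : ℕ) {x : ℝ} (hx : x ∈ Ioo a b) :
    |deriv (cutoff a b j) x * ψ x| ≤ 4 * C * K := by
  have hxa : 0 < x - a := by linarith [hx.1]
  have hxb : 0 < b - x := by linarith [hx.2]
  have hC0 : 0 ≤ C := (abs_nonneg _).trans (hC 0).1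
  rw [(hasDerivAt_cutoff a b j x).deriv]
  by_cases hy : (j * ((x - a) * (b - x)) - 1 : ℝ) ∈ Icc (0 : ℝ) 1
  · have hj : (0 : ℝ) ≤ j := Nat.cast_nonneg j
    have h2 : (j : ℝ) * ((x - a) * (b - x)) ≤ 2 := by linarith [hy.2]
    have h3 : |a + b - 2 * x| * |ψ x| ≤ 2 * K * ((x - a) * (b - x)) := by
      rcases le_total (x - a) (b - x) with h | h
      · have h4 : |a + b - 2 * x| ≤ 2 * (b - x) := by rw [abs_le]; constructor <;> linarith
        calc _ ≤ (2 * (b - x)) * (K * (x - a)) :=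
              mul_le_mul h4 (hψa x hx) (abs_nonneg _) (by linarith)
          _ = _ := by ring
      · have h4 : |a + b - 2 * x| ≤ 2 * (x - a) := by rw [abs_le]; constructor <;> linarith
        calc _ ≤ (2 * (x - a)) * (K * (b - x)) :=
              mul_le_mul h4 (hψb x hx) (abs_nonneg _) (by linarith)
          _ = _ := by ring
    have h5 := mul_le_mul_of_nonneg_left h3 hj
    rw [abs_mul, abs_mul, abs_mul, abs_of_nonneg hj]
    calc _ = |deriv Real.smoothTransition (j * ((x - a) * (b - x)) - 1)| *
          (j * (|a + b - 2 * x| * |ψ x|)) := by ring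
      _ ≤ C * (j * (2 * K * ((x - a) * (b - x)))) :=
          mul_le_mul (hC _).1 h5 (by positivity) hC0
      _ = 2 * C * K * (j * ((x - a) * (b - x))) := by ring
      _ ≤ 2 * C * K * 2 := mul_le_mul_of_nonneg_left h2 (by positivity)
      _ = _ := by ring
  · rw [(hC _).2 hy]
    simp only [zero_mul, abs_zero]
    positivity

theorem WeakDerivI.of_vanish_boundary {a b : ℝ} (hab : a < b) {g g' ψ : ℝ → ℝ}
    (h : WeakDerivI a b g g') (hg : IntegrableOn g (Ioo a b)) (hg' : IntegrableOn g' (Ioo a b))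
    (hψ : ContDiff ℝ (⊤ : ℕ∞) ψ) (hψa : ψ a = 0) (hψb : ψ b = 0) :
    ∫ x in Ioo a b, g x * deriv ψ x = - ∫ x in Ioo a b, g' x * ψ x := by
  have hψ1 : ContDiff ℝ 1 ψ := hψ.of_le (by exact_mod_cast le_top)
  have hdψ : Continuous (deriv ψ) := hψ1.continuous_deriv le_rfl
  have hdiff : Differentiable ℝ ψ := hψ1.differentiable one_ne_zero
  obtain ⟨K, hK⟩ := isCompact_Icc.exists_bound_of_continuousOn (hdψ.continuousOn (s := Icc a b))
  have hK0 : 0 ≤ K := (norm_nonneg _).trans (hK a (left_mem_Icc.2 hab.le))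
  obtain ⟨C, hC0, hC⟩ := exists_bound_deriv_smoothTransition
  obtain ⟨K', hK'⟩ := isCompact_Icc.exists_bound_of_continuousOn
    (hψ1.continuous.continuousOn (s := Icc a b))
  have hlip : ∀ x ∈ Icc a b, ∀ y ∈ Icc a b, |ψ y - ψ x| ≤ K * |y - x| := fun x hx y hy =>
    Convex.norm_image_sub_le_of_norm_deriv_le (fun z _ => hdiff z) hK (convex_Icc a b) hx hy
  have hbda : ∀ x ∈ Ioo a b, |ψ x| ≤ K * (x - a) := by
    intro x hx
    have := hlip a (left_mem_Icc.2 hab.le) x (Ioo_subset_Icc_self hx)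
    rwa [hψa, sub_zero, abs_of_pos (by linarith [hx.1] : 0 < x - a)] at this
  have hbdb : ∀ x ∈ Ioo a b, |ψ x| ≤ K * (b - x) := by
    intro x hx
    have := hlip b (right_mem_Icc.2 hab.le) x (Ioo_subset_Icc_self hx)
    rwa [hψb, sub_zero, abs_sub_comm, abs_of_pos (by linarith [hx.2] : 0 < b - x)] at this
  have hcd : ∀ j, ContDiff ℝ (⊤ : ℕ∞) (fun x => cutoff a b j x * ψ x) := fun j =>
    (contDiff_cutoff a b j).mul hψ
  have hev : ∀ x ∈ Ioo a b, ∀ᶠ j : ℕ in atTop, (fun x => cutoff a b j x * ψ x) =ᶠ[nhds x] ψ := by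
    intro x hx
    filter_upwards [cutoff_eventuallyEq_one hx] with j hj
    filter_upwards [hj] with y hy
    rw [hy, one_mul]
  have hcut : ∀ j x, |cutoff a b j x| ≤ 1 := fun j x =>
    abs_le.2 ⟨le_trans (by norm_num) (Real.smoothTransition.nonneg (j * ((x - a) * (b - x)) - 1)),
      Real.smoothTransition.le_one _⟩
  have hder : ∀ j x, deriv (fun x => cutoff a b j x * ψ x) x =
      deriv (cutoff a b j) x * ψ x + cutoff a b j x * deriv ψ x := fun j x =>
    deriv_fun_mul (hasDerivAt_cutoff a b j x).differentiableAt (hdiff x)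
  have hl : Tendsto (fun j : ℕ => ∫ x in Ioo a b, g x * deriv (fun x => cutoff a b j x * ψ x) x)
      atTop (nhds (∫ x in Ioo a b, g x * deriv ψ x)) := by
    refine tendsto_integral_of_dominated_convergence (fun x => |g x| * (4 * C * K + K))
      (fun j => ?_) (hg.abs.mul_const _) (fun j => ?_) ?_
    · exact hg.aestronglyMeasurable.mul
        (((hcd j).of_le (by exact_mod_cast le_top) : ContDiff ℝ 1 _).continuous_deriv
          le_rfl).aestronglyMeasurable
    · filter_upwards [ae_restrict_mem measurableSet_Ioo] with x hx
      rw [norm_mul, hder]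
      refine mul_le_mul_of_nonneg_left ?_ (abs_nonneg _)
      refine (norm_add_le _ _).trans (add_le_add
        (abs_deriv_cutoff_mul_le hK0 hC hbda hbdb j hx) ?_)
      rw [norm_mul]
      calc _ ≤ 1 * K := mul_le_mul (hcut j x) (hK x (Ioo_subset_Icc_self hx))
            (norm_nonneg _) zero_le_one
        _ = K := one_mul K
    · filter_upwards [ae_restrict_mem measurableSet_Ioo] with x hx
      refine tendsto_const_nhds.congr' ?_
      filter_upwards [hev x hx] with j hj
      rw [hj.deriv_eq]
  have hr : Tendsto (fun j : ℕ => ∫ x in Ioo a b, g' x * (cutoff a b j x * ψ x))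
      atTop (nhds (∫ x in Ioo a b, g' x * ψ x)) := by
    refine tendsto_integral_of_dominated_convergence (fun x => |g' x| * K')
      (fun j => ?_) (hg'.abs.mul_const _) (fun j => ?_) ?_
    · exact hg'.aestronglyMeasurable.mul (hcd j).continuous.aestronglyMeasurable
    · filter_upwards [ae_restrict_mem measurableSet_Ioo] with x hx
      rw [norm_mul, norm_mul]
      refine mul_le_mul_of_nonneg_left ?_ (abs_nonneg _)
      calc _ ≤ 1 * K' := mul_le_mul (hcut j x) (hK' x (Ioo_subset_Icc_self hx))
            (norm_nonneg _) zero_le_one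
        _ = K' := one_mul K'
    · filter_upwards [ae_restrict_mem measurableSet_Ioo] with x hx
      refine tendsto_const_nhds.congr' ?_
      filter_upwards [hev x hx] with j hj
      have := hj.self_of_nhds
      simp only at this
      rw [this]
  refine tendsto_nhds_unique hl ?_
  refine hr.neg.congr fun j => ?_
  refine (h _ (hcd j) ?_).symm
  refine (closure_mono ?_).trans ((tsupport_cutoff_subset a b j).trans
    fun x hx => mem_Ioo_of_mul_pos hab hx)
  intro x hx
  exact left_ne_zero_of_mul hx

/-! ### Functions of one variable with a square integrable derivative -/

/-- `g ∈ W^{1,2}(a,b)` with derivative `g'`, expressed by Fourier coefficients. -/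
structure IsH1 (a b : ℝ) (g g' : ℝ → ℝ) : Prop where
  left : MemL2 a b g
  right : MemL2 a b g'
  coef_eq : ∀ n, coef a b (sinB a b) n g' = -freq a b n * coef a b (cosB a b) n g

theorem contDiff_sinB (a b : ℝ) (n : ℕ) : ContDiff ℝ (⊤ : ℕ∞) (sinB a b n) := by
  unfold sinB; fun_prop

theorem contDiff_cosB (a b : ℝ) (n : ℕ) : ContDiff ℝ (⊤ : ℕ∞) (cosB a b n) := by
  unfold cosB; fun_prop

theorem deriv_sinB (a b : ℝ) (n : ℕ) : deriv (sinB a b n) = fun x => freq a b n * cosB a b n x :=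
  funext fun x => (hasDerivAt_sinB a b n x).deriv

theorem deriv_cosB (a b : ℝ) (n : ℕ) : deriv (cosB a b n) = fun x => -freq a b n * sinB a b n x :=
  funext fun x => (hasDerivAt_cosB a b n x).deriv

theorem WeakDerivI.coef_sinB {a b : ℝ} (hab : a < b) {g g' : ℝ → ℝ}
    (h : WeakDerivI a b g g') (hg : IntegrableOn g (Ioo a b)) (hg' : IntegrableOn g' (Ioo a b))
    (n : ℕ) : coef a b (sinB a b) n g' = -freq a b n * coef a b (cosB a b) n g := by
  have h1 := h.of_vanish_boundary hab hg hg' (contDiff_sinB a b n) (sinB_left a b n)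
    (sinB_right hab n)
  rw [deriv_sinB] at h1
  unfold coef
  rw [neg_mul, ← integral_const_mul, ← neg_eq_iff_eq_neg, ← h1]
  congr 1
  ext x
  ring

theorem WeakDerivI.isH1 {a b : ℝ} (hab : a < b) {g g' : ℝ → ℝ}
    (h : WeakDerivI a b g g') (hg : MemL2 a b g) (hg' : MemL2 a b g') : IsH1 a b g g' :=
  ⟨hg, hg', h.coef_sinB hab hg.integrable hg'.integrable⟩

theorem WeakDerivZ.coef_cosB {a b : ℝ} {g g' : ℝ → ℝ} (h : WeakDerivZ a b g g') (n : ℕ) :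
    coef a b (cosB a b) n g' = freq a b n * coef a b (sinB a b) n g := by
  have h1 := h _ (contDiff_cosB a b n)
  rw [deriv_cosB] at h1
  unfold coef
  rw [← integral_const_mul, ← neg_eq_iff_eq_neg.2 h1, ← integral_neg]
  congr 1
  ext x
  ring

theorem IsH1.sub {a b : ℝ} {g g' h h' : ℝ → ℝ} (hg : IsH1 a b g g') (hh : IsH1 a b h h') :
    IsH1 a b (fun x => g x - h x) (fun x => g' x - h' x) := by
  refine ⟨hg.left.sub hh.left, hg.right.sub hh.right, fun n => ?_⟩
  rw [coef_sub n (continuous_sinB a b n) hg.right.integrable hh.right.integrable,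
    coef_sub n (continuous_cosB a b n) hg.left.integrable hh.left.integrable,
    hg.coef_eq, hh.coef_eq]
  ring

/-- The right-hand side of the interpolation inequality for the sup norm. -/
def supBd (a b : ℝ) (g g' : ℝ → ℝ) : ℝ :=
  1 / (b - a) * sqOm a b g + 2 * (√(sqOm a b g) * √(sqOm a b g'))

theorem supBd_nonneg {a b : ℝ} (hab : a < b) (g g' : ℝ → ℝ) : 0 ≤ supBd a b g g' := by
  have := sqOm_nonneg a b g
  have h2 : 0 < b - a := sub_pos.2 hab
  unfold supBd
  positivity

theorem sq_le_supBd_of_hasDerivAt {a b : ℝ} (hab : a < b) {q q' : ℝ → ℝ}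
    (hq : ∀ x, HasDerivAt q (q' x) x) (hq' : Continuous q') {x : ℝ} (hx : x ∈ Icc a b) :
    q x ^ 2 ≤ supBd a b q q' := by
  have hL : 0 < b - a := sub_pos.2 hab
  have hqc : Continuous q := continuous_iff_continuousAt.2 fun x => (hq x).continuousAt
  have hm := memL2_of_continuous (a := a) (b := b) hqc
  have hm' := memL2_of_continuous (a := a) (b := b) hq'
  set B := √(sqOm a b q) * √(sqOm a b q') with hB
  have h1 : ∀ y ∈ Icc a b, q x ^ 2 - q y ^ 2 ≤ 2 * B := by
    intro y hy
    have h2 : ∫ z in y..x, 2 * (q z * q' z) = q x ^ 2 - q y ^ 2 := by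
      refine intervalIntegral.integral_eq_sub_of_hasDerivAt
        (f := fun z => q z ^ 2) (fun z _ => ?_) ?_
      · refine ((hq z).fun_pow 2).congr_deriv ?_
        push_cast; ring
      · exact (continuous_const.mul (hqc.mul hq')).intervalIntegrable _ _
    rw [← h2, intervalIntegral.integral_const_mul]
    refine mul_le_mul_of_nonneg_left ?_ zero_le_two
    refine (le_abs_self _).trans (le_trans ?_ (integral_abs_mul_le hm hm'))
    refine (intervalIntegral.norm_integral_le_integral_norm_uIoc (E := ℝ)).trans ?_
    have hsub : uIoc y x ⊆ Ioc a b := by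
      intro z hz
      rw [mem_uIoc] at hz
      rcases hz with hz | hz
      · exact ⟨hy.1.trans_lt hz.1, hz.2.trans hx.2⟩
      · exact ⟨hx.1.trans_lt hz.1, hz.2.trans hy.2⟩
    rw [← integral_Ioc_eq_integral_Ioo]
    simp_rw [norm_mul, Real.norm_eq_abs]
    refine setIntegral_mono_set ?_ (Eventually.of_forall fun z => by positivity)
      (Eventually.of_forall hsub)
    exact ((hqc.abs.mul hq'.abs).integrableOn_Icc).mono_set Ioc_subset_Icc_self
  have h3 : ∫ y in Ioo a b, q x ^ 2 ≤ ∫ y in Ioo a b, (q y ^ 2 + 2 * B) := by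
    refine setIntegral_mono_on ?_ ?_ measurableSet_Ioo fun y hy => ?_
    · exact integrableOn_const (by simp)
    · exact hm.2.add (integrableOn_const (by simp))
    · linarith [h1 y (Ioo_subset_Icc_self hy)]
  rw [integral_add hm.2 (integrableOn_const (by simp)), setIntegral_const, setIntegral_const,
    Measure.real, Real.volume_Ioo, ENNReal.toReal_ofReal hL.le, smul_eq_mul, smul_eq_mul] at h3
  change (b - a) * q x ^ 2 ≤ sqOm a b q + (b - a) * (2 * B) at h3
  unfold supBd
  rw [← hB, one_div, inv_mul_eq_div]
  have h4 : q x ^ 2 - 2 * B ≤ sqOm a b q / (b - a) := by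
    rw [le_div_iff₀ hL]
    nlinarith
  linarith

theorem supBd_mono {a b : ℝ} (hab : a < b) {g g' h h' : ℝ → ℝ} (h1 : sqOm a b g ≤ sqOm a b h)
    (h2 : sqOm a b g' ≤ sqOm a b h') : supBd a b g g' ≤ supBd a b h h' := by
  have hL : 0 < b - a := sub_pos.2 hab
  unfold supBd
  gcongr

namespace IsH1

variable {a b : ℝ} {g g' h : ℝ → ℝ}

theorem hasDerivAt_partSum (hg : IsH1 a b g g') (N : ℕ) (x : ℝ) :
    HasDerivAt (partSum a b (cosB a b) (wgt a b) N g)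
      (partSum a b (sinB a b) (wgt a b) N g' x) x := by
  unfold partSum
  refine (HasDerivAt.fun_sum fun n _ => (hasDerivAt_cosB a b n x).const_mul _).congr_deriv ?_
  refine Finset.sum_congr rfl fun n _ => ?_
  rw [hg.coef_eq]
  ring

theorem sq_partSum_le (hab : a < b) (hg : IsH1 a b g g') (N : ℕ) {x : ℝ} (hx : x ∈ Icc a b) :
    partSum a b (cosB a b) (wgt a b) N g x ^ 2 ≤ supBd a b g g' :=
  (sq_le_supBd_of_hasDerivAt hab (hg.hasDerivAt_partSum N)
    ((isParsevalSystem_sinB hab).continuous_partSum N g') hx).trans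
    (supBd_mono hab ((isParsevalSystem_cosB hab).sqOm_partSum_le hg.left N)
      ((isParsevalSystem_sinB hab).sqOm_partSum_le hg.right N))

theorem ae_abs_le (hab : a < b) (hg : IsH1 a b g g') :
    ∀ᵐ x ∂volume.restrict (Ioo a b), |g x| ≤ √(supBd a b g g') := by
  set S := √(supBd a b g g') with hS
  have hle : ∀ N, ∀ x ∈ Icc a b, |partSum a b (cosB a b) (wgt a b) N g x| ≤ S := fun N x hx =>
    Real.abs_le_sqrt (hg.sq_partSum_le hab N hx)
  have hS0 : 0 ≤ S := Real.sqrt_nonneg _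
  have hInt : ∀ N, ∀ x ∈ Ioo a b, (max (|g x| - S) 0) ^ 2 ≤
      (g x - partSum a b (cosB a b) (wgt a b) N g x) ^ 2 := by
    intro N x hx
    rw [← sq_abs (g x - _)]
    refine pow_le_pow_left₀ (le_max_right _ _) (max_le ?_ (abs_nonneg _)) 2
    have := abs_sub_abs_le_abs_sub (g x) (partSum a b (cosB a b) (wgt a b) N g x)
    linarith [hle N x (Ioo_subset_Icc_self hx)]
  have hm := (isParsevalSystem_cosB hab).memL2_partSum (a := a) (b := b)
  have hmeas : AEStronglyMeasurable (fun x => (max (|g x| - S) 0) ^ 2)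
      (volume.restrict (Ioo a b)) := by
    have h1 : AEMeasurable g (volume.restrict (Ioo a b)) := hg.left.1.aemeasurable
    exact ((((continuous_abs.measurable.comp_aemeasurable h1).sub_const S).max
      aemeasurable_const).pow_const 2).aestronglyMeasurable
  have hi : IntegrableOn (fun x => (max (|g x| - S) 0) ^ 2) (Ioo a b) := by
    refine (hg.left.sub (hm 0 g)).2.mono' hmeas ?_
    filter_upwards [ae_restrict_mem measurableSet_Ioo] with x hx
    rw [Real.norm_of_nonneg (sq_nonneg _)]
    exact hInt 0 x hx
  have h0 : ∫ x in Ioo a b, (max (|g x| - S) 0) ^ 2 ≤ 0 := by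
    refine ge_of_tendsto' ((isParsevalSystem_cosB hab).tendsto_sqOm_sub_partSum hg.left)
      fun N => ?_
    exact setIntegral_mono_on hi (hg.left.sub (hm N g)).2 measurableSet_Ioo (hInt N)
  have h1 := (integral_eq_zero_iff_of_nonneg (fun _ => sq_nonneg _) hi).1
    (le_antisymm h0 (integral_nonneg fun _ => sq_nonneg _))
  filter_upwards [h1] with x hx
  have h2 : max (|g x| - S) 0 = 0 := by simpa using hx
  linarith [le_max_left (|g x| - S) 0]

theorem abs_sum_le (hab : a < b) (hg : IsH1 a b g g') (hh : IntegrableOn h (Ioo a b)) (N : ℕ) :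
    |∑ n ∈ Finset.range N, wgt a b n *
      (coef a b (cosB a b) n g * coef a b (cosB a b) n h)| ≤
      (∫ x in Ioo a b, |h x|) * √(supBd a b g g') := by
  have hP := isParsevalSystem_cosB hab
  rw [← hP.integral_mul_partSum hh N, ← integral_mul_const]
  refine norm_integral_le_of_norm_le (G := ℝ) (hh.abs.mul_const _) ?_
  filter_upwards [ae_restrict_mem measurableSet_Ioo] with x hx
  rw [norm_mul]
  exact mul_le_mul_of_nonneg_left
    (Real.abs_le_sqrt (hg.sq_partSum_le hab N (Ioo_subset_Icc_self hx))) (abs_nonneg _)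

theorem isH1_partSum (hab : a < b) (hg : IsH1 a b g g') (N : ℕ) :
    IsH1 a b (partSum a b (cosB a b) (wgt a b) N g) (partSum a b (sinB a b) (wgt a b) N g') := by
  refine ⟨(isParsevalSystem_cosB hab).memL2_partSum N g,
    (isParsevalSystem_sinB hab).memL2_partSum N g', fun n => ?_⟩
  rw [(isParsevalSystem_cosB hab).coef_partSum hg.left,
    (isParsevalSystem_sinB hab).coef_partSum hg.right]
  split_ifs
  · exact hg.coef_eq n
  · ring

theorem integrable_mul (hab : a < b) (hg : IsH1 a b g g') (hh : IntegrableOn h (Ioo a b)) :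
    IntegrableOn (fun x => h x * g x) (Ioo a b) :=
  Integrable.mul_bdd (c := √(supBd a b g g')) hh hg.left.1 (hg.ae_abs_le hab)

theorem tendsto_sum (hab : a < b) (hg : IsH1 a b g g') (hh : IntegrableOn h (Ioo a b)) :
    Tendsto (fun N => ∑ n ∈ Finset.range N, wgt a b n *
      (coef a b (cosB a b) n g * coef a b (cosB a b) n h)) atTop
      (nhds (∫ x in Ioo a b, h x * g x)) := by
  have hP := isParsevalSystem_cosB hab
  have hQ := isParsevalSystem_sinB hab
  simp_rw [← hP.integral_mul_partSum hh]
  rw [tendsto_iff_norm_sub_tendsto_zero]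
  have hd : ∀ N, IsH1 a b (fun x => g x - partSum a b (cosB a b) (wgt a b) N g x)
    (fun x => g' x - partSum a b (sinB a b) (wgt a b) N g' x) := fun N =>
    hg.sub (hg.isH1_partSum hab N)
  have hlim : Tendsto (fun N => (∫ x in Ioo a b, |h x|) * √(supBd a b
      (fun x => g x - partSum a b (cosB a b) (wgt a b) N g x)
      (fun x => g' x - partSum a b (sinB a b) (wgt a b) N g' x))) atTop (nhds 0) := by
    have h1 := hP.tendsto_sqOm_sub_partSum hg.left
    have h2 := hQ.tendsto_sqOm_sub_partSum hg.right
    have h3 := (((h1.const_mul (1 / (b - a))).add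
      ((h1.sqrt.mul h2.sqrt).const_mul 2)).sqrt).const_mul (∫ x in Ioo a b, |h x|)
    simpa [supBd] using h3
  refine squeeze_zero (fun _ => norm_nonneg _) (fun N => ?_) hlim
  rw [← integral_sub (integrableOn_mul_continuous hh (hP.continuous_partSum N g))
    (hg.integrable_mul hab hh), ← integral_mul_const]
  refine norm_integral_le_of_norm_le (G := ℝ) (hh.abs.mul_const _) ?_
  filter_upwards [(hd N).ae_abs_le hab] with x hx
  rw [← mul_sub, norm_mul, norm_sub_rev]
  exact mul_le_mul_of_nonneg_left hx (abs_nonneg _)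

end IsH1

/-! ### Continuity in time with values in `L²` -/

theorem abs_coef_le {a b : ℝ} {e : ℕ → ℝ → ℝ} (n : ℕ) (he : Continuous (e n)) {g : ℝ → ℝ}
    (hg : MemL2 a b g) : |coef a b e n g| ≤ √(sqOm a b g) * √(sqOm a b (e n)) :=
  abs_integral_mul_le hg (memL2_of_continuous he)

theorem ContL2.sub {a b : ℝ} {J : Set ℝ} {v w : ℝ → ℝ → ℝ} (hv : ContL2 a b J v)
    (hw : ContL2 a b J w) : ContL2 a b J (fun x t => v x t - w x t) := by
  refine ⟨fun t ht => (hv.1 t ht).sub (hw.1 t ht), fun t₀ ht₀ => ?_⟩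
  have h1 := ((hv.2 t₀ ht₀).const_mul 2).add ((hw.2 t₀ ht₀).const_mul 2)
  simp only [mul_zero, add_zero] at h1
  refine squeeze_zero' (Eventually.of_forall fun t => integral_nonneg fun _ => sq_nonneg _) ?_ h1
  filter_upwards [self_mem_nhdsWithin] with t ht
  have h2 := sqOm_add_le ((hv.1 t ht).sub (hv.1 t₀ ht₀)) ((hw.1 t₀ ht₀).sub (hw.1 t ht))
  rw [sqOm_sub_comm a b (fun x => w x t₀)] at h2
  refine le_trans (le_of_eq ?_) h2
  unfold sqOm
  congr 1
  ext x
  ring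

theorem ContL2.continuousOn_coef {a b : ℝ} {J : Set ℝ} {w : ℝ → ℝ → ℝ} (hw : ContL2 a b J w)
    {e : ℕ → ℝ → ℝ} (n : ℕ) (he : Continuous (e n)) :
    ContinuousOn (fun t => coef a b e n (fun x => w x t)) J := by
  intro t₀ ht₀
  rw [ContinuousWithinAt, tendsto_iff_norm_sub_tendsto_zero]
  have h1 := ((hw.2 t₀ ht₀).sqrt).mul_const (√(sqOm a b (e n)))
  simp only [Real.sqrt_zero, zero_mul] at h1
  refine squeeze_zero' (Eventually.of_forall fun t => norm_nonneg _) ?_ h1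
  filter_upwards [self_mem_nhdsWithin] with t ht
  rw [← coef_sub n he (hw.1 t ht).integrable (hw.1 t₀ ht₀).integrable]
  exact abs_coef_le n he ((hw.1 t ht).sub (hw.1 t₀ ht₀))

theorem ContL2.continuousOn_sqOm {a b : ℝ} {J : Set ℝ} {w : ℝ → ℝ → ℝ} (hw : ContL2 a b J w) :
    ContinuousOn (fun t => sqOm a b (fun x => w x t)) J := by
  intro t₀ ht₀
  rw [ContinuousWithinAt, tendsto_iff_norm_sub_tendsto_zero]
  have h0 := hw.2 t₀ ht₀
  have h1 := h0.add ((h0.sqrt.mul_const (√(sqOm a b (fun x => w x t₀)))).const_mul 2)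
  simp only [Real.sqrt_zero, zero_mul, mul_zero, add_zero] at h1
  refine squeeze_zero' (Eventually.of_forall fun t => norm_nonneg _) ?_ h1
  filter_upwards [self_mem_nhdsWithin] with t ht
  have hd := (hw.1 t ht).sub (hw.1 t₀ ht₀)
  have h2 := sqOm_add hd (hw.1 t₀ ht₀)
  simp only [sub_add_cancel] at h2
  have h3 := abs_integral_mul_le hd (hw.1 t₀ ht₀)
  have h4 := sqOm_nonneg a b (fun x => w x t - w x t₀)
  rw [Real.norm_eq_abs]
  change _ ≤ sqOm a b (fun x => w x t - w x t₀) +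
    2 * (√(sqOm a b (fun x => w x t - w x t₀)) * √(sqOm a b (fun x => w x t₀)))
  rw [h2, add_sub_cancel_right]
  refine (abs_add_le _ _).trans ?_
  rw [abs_of_nonneg h4, abs_mul, abs_two]
  linarith

theorem ContL2.exists_bound {a b T : ℝ} {w : ℝ → ℝ → ℝ} (hw : ContL2 a b (Icc 0 T) w) :
    ∃ K, 0 ≤ K ∧ ∀ t ∈ Icc 0 T, sqOm a b (fun x => w x t) ≤ K := by
  obtain ⟨K, hK⟩ := isCompact_Icc.exists_bound_of_continuousOn hw.continuousOn_sqOm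
  exact ⟨max K 0, le_max_right _ _, fun t ht =>
    (le_abs_self _).trans ((hK t ht).trans (le_max_left _ _))⟩

/-! ### Integration over the space-time cylinder -/

section Cylinder

variable {a b T : ℝ} {F : ℝ → ℝ → ℝ}

theorem volume_restrict_cylinder (a b T : ℝ) :
    (volume : Measure (ℝ × ℝ)).restrict (Ioo a b ×ˢ Ioo 0 T) =
      (volume.restrict (Ioo a b)).prod (volume.restrict (Ioo 0 T)) := by
  rw [Measure.volume_eq_prod, Measure.prod_restrict]

theorem integrableOn_cylinder_mul (hF : IntegrableOn (fun p : ℝ × ℝ => F p.1 p.2)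
    (Ioo a b ×ˢ Ioo 0 T)) {ψ : ℝ → ℝ → ℝ} (hψ : Continuous (uncurry ψ)) :
    IntegrableOn (fun p : ℝ × ℝ => F p.1 p.2 * ψ p.1 p.2) (Ioo a b ×ˢ Ioo 0 T) := by
  have hc : IsCompact (Icc a b ×ˢ Icc 0 T) := isCompact_Icc.prod isCompact_Icc
  obtain ⟨K, hK⟩ := hc.exists_bound_of_continuousOn hψ.continuousOn
  refine Integrable.mul_bdd (c := K) hF hψ.aestronglyMeasurable ?_
  filter_upwards [ae_restrict_mem (measurableSet_Ioo.prod measurableSet_Ioo)] with p hp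
  exact hK p ⟨Ioo_subset_Icc_self hp.1, Ioo_subset_Icc_self hp.2⟩

theorem ae_slice_integrable (hF : IntegrableOn (fun p : ℝ × ℝ => F p.1 p.2)
    (Ioo a b ×ˢ Ioo 0 T)) :
    ∀ᵐ t ∂volume.restrict (Ioo 0 T), IntegrableOn (fun x => F x t) (Ioo a b) := by
  rw [IntegrableOn, volume_restrict_cylinder] at hF
  exact hF.prod_left_ae

theorem integrableOn_slice_integral (hF : IntegrableOn (fun p : ℝ × ℝ => F p.1 p.2)
    (Ioo a b ×ˢ Ioo 0 T)) :
    IntegrableOn (fun t => ∫ x in Ioo a b, F x t) (Ioo 0 T) := by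
  rw [IntegrableOn, volume_restrict_cylinder] at hF
  exact hF.integral_prod_right

theorem intOmT_eq_integral_slice (hF : IntegrableOn (fun p : ℝ × ℝ => F p.1 p.2)
    (Ioo a b ×ˢ Ioo 0 T)) :
    intOmT a b T F = ∫ t in Ioo 0 T, ∫ x in Ioo a b, F x t := by
  rw [IntegrableOn, volume_restrict_cylinder] at hF
  rw [intOmT, volume_restrict_cylinder]
  exact integral_prod_symm _ hF

theorem integrableOn_time_integral (hF : IntegrableOn (fun p : ℝ × ℝ => F p.1 p.2)
    (Ioo a b ×ˢ Ioo 0 T)) :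
    IntegrableOn (fun x => ∫ t in Ioo 0 T, F x t) (Ioo a b) := by
  rw [IntegrableOn, volume_restrict_cylinder] at hF
  exact hF.integral_prod_left

theorem intOmT_eq_integral_time (hF : IntegrableOn (fun p : ℝ × ℝ => F p.1 p.2)
    (Ioo a b ×ˢ Ioo 0 T)) :
    intOmT a b T F = ∫ x in Ioo a b, ∫ t in Ioo 0 T, F x t := by
  rw [IntegrableOn, volume_restrict_cylinder] at hF
  rw [intOmT, volume_restrict_cylinder]
  exact integral_prod _ hF

theorem integrableOn_coef_slice (hF : IntegrableOn (fun p : ℝ × ℝ => F p.1 p.2)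
    (Ioo a b ×ˢ Ioo 0 T)) {e : ℕ → ℝ → ℝ} (n : ℕ) (he : Continuous (e n)) :
    IntegrableOn (fun t => coef a b e n (fun x => F x t)) (Ioo 0 T) :=
  integrableOn_slice_integral (F := fun x t => F x t * e n x)
    (integrableOn_cylinder_mul hF (ψ := fun x _ => e n x) (he.comp continuous_fst))

theorem intOmT_mul_tensor (hF : IntegrableOn (fun p : ℝ × ℝ => F p.1 p.2)
    (Ioo a b ×ˢ Ioo 0 T)) {e : ℕ → ℝ → ℝ} (n : ℕ) (he : Continuous (e n))
    {χ : ℝ → ℝ} (hχ : Continuous χ) :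
    intOmT a b T (fun x t => F x t * (e n x * χ t)) =
      ∫ t in Ioo 0 T, coef a b e n (fun x => F x t) * χ t := by
  rw [intOmT_eq_integral_slice (F := fun x t => F x t * (e n x * χ t))
    (integrableOn_cylinder_mul hF (ψ := fun x t => e n x * χ t)
    ((he.comp continuous_fst).mul (hχ.comp continuous_snd)))]
  congr 1
  ext t
  rw [coef, ← integral_mul_const]
  simp_rw [mul_assoc]

theorem intOmT_mul_tensor' (hF : IntegrableOn (fun p : ℝ × ℝ => F p.1 p.2)
    (Ioo a b ×ˢ Ioo 0 T)) {ψ : ℝ → ℝ} (hψ : Continuous ψ)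
    {χ : ℝ → ℝ} (hχ : Continuous χ) :
    intOmT a b T (fun x t => F x t * (ψ x * χ t)) =
      ∫ x in Ioo a b, (∫ t in Ioo 0 T, F x t * χ t) * ψ x := by
  rw [intOmT_eq_integral_time (F := fun x t => F x t * (ψ x * χ t))
    (integrableOn_cylinder_mul hF (ψ := fun x t => ψ x * χ t)
    ((hψ.comp continuous_fst).mul (hχ.comp continuous_snd)))]
  congr 1
  ext x
  rw [← integral_mul_const]
  congr 1
  ext t
  ring

theorem integrableOn_time_integral_mul (hF : IntegrableOn (fun p : ℝ × ℝ => F p.1 p.2)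
    (Ioo a b ×ˢ Ioo 0 T)) {χ : ℝ → ℝ} (hχ : Continuous χ) :
    IntegrableOn (fun x => ∫ t in Ioo 0 T, F x t * χ t) (Ioo a b) :=
  integrableOn_time_integral (F := fun x t => F x t * χ t)
    (integrableOn_cylinder_mul hF (ψ := fun _ t => χ t) (hχ.comp continuous_snd))

end Cylinder

theorem integral_Ioo_eq_interval {T : ℝ} (hT : 0 ≤ T) (F : ℝ → ℝ) :
    ∫ t in Ioo 0 T, F t = ∫ t in 0..T, F t := by
  rw [intervalIntegral.integral_of_le hT, integral_Ioc_eq_integral_Ioo]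

/-! ### Identification of primitives from test functions in time -/

theorem eqOn_zero_of_forall_integral_eq_zero {T : ℝ} (hT : 0 < T) {w : ℝ → ℝ}
    (hw : ContinuousOn w (Icc 0 T))
    (h : ∀ ψ : ℝ → ℝ, ContDiff ℝ (⊤ : ℕ∞) ψ →
      (∃ K : Set ℝ, IsCompact K ∧ K ⊆ Ioo 0 T ∧ ∀ t, t ∉ K → ψ t = 0) →
      ∫ s in Ioo 0 T, w s * ψ s = 0) : ∀ t ∈ Icc 0 T, w t = 0 := by
  have hloc : LocallyIntegrableOn w (Ioo 0 T) :=
    ((hw.integrableOn_Icc).mono_set Ioo_subset_Icc_self).locallyIntegrableOn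
  have h1 := isOpen_Ioo.ae_eq_zero_of_integral_contDiff_smul_eq_zero hloc (fun ψ hψ hc hs => by
    have h2 := h ψ hψ ⟨tsupport ψ, hc, hs, fun t ht => image_eq_zero_of_notMem_tsupport ht⟩
    rw [← h2, ← integral_indicator measurableSet_Ioo]
    congr 1
    ext s
    by_cases hsm : s ∈ Ioo 0 T
    · rw [indicator_of_mem hsm, smul_eq_mul, mul_comm]
    · rw [indicator_of_notMem hsm, image_eq_zero_of_notMem_tsupport fun hh => hsm (hs hh),
        zero_smul])
  have h3 : w =ᵐ[volume.restrict (Icc 0 T)] fun _ => 0 := by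
    rw [← restrict_Ioo_eq_restrict_Icc]
    exact (ae_restrict_iff' measurableSet_Ioo).2 h1
  exact Measure.eqOn_Icc_of_ae_eq volume hT.ne h3 hw continuousOn_const

theorem exists_primitive_test {T : ℝ} {ψ : ℝ → ℝ} (hψ : ContDiff ℝ (⊤ : ℕ∞) ψ)
    (hs : ∃ T' < T, ∀ t, T' ≤ t → ψ t = 0) :
    ∃ χ : ℝ → ℝ, ContDiff ℝ (⊤ : ℕ∞) χ ∧ deriv χ = ψ ∧ ∃ T' < T, ∀ t, T' ≤ t → χ t = 0 := by
  obtain ⟨T', hT', h0⟩ := hs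
  have hd : ∀ t, HasDerivAt (fun t => ∫ s in T..t, ψ s) (ψ t) t := fun t =>
    intervalIntegral.integral_hasDerivAt_right (hψ.continuous.intervalIntegrable _ _)
      (hψ.continuous.stronglyMeasurableAtFilter _ _) hψ.continuous.continuousAt
  have hde : deriv (fun t => ∫ s in T..t, ψ s) = ψ := funext fun t => (hd t).deriv
  refine ⟨fun t => ∫ s in T..t, ψ s, ?_, hde, T', hT', fun t ht => ?_⟩
  · rw [contDiff_infty_iff_deriv]
    exact ⟨fun t => (hd t).differentiableAt, by rw [hde]; exact hψ⟩
  · change ∫ s in T..t, ψ s = 0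
    rw [intervalIntegral.integral_congr (g := fun _ => (0 : ℝ)), intervalIntegral.integral_zero]
    intro s hs
    have : min T t ≤ s := hs.1
    exact h0 s ((le_min hT'.le ht).trans this)

theorem eq_primitive_of_forall_test {T : ℝ} (hT : 0 < T) {α B : ℝ → ℝ} {c : ℝ}
    (hα : IntervalIntegrable α volume 0 T) (hB : ContinuousOn B (Icc 0 T))
    (h : ∀ χ : ℝ → ℝ, ContDiff ℝ (⊤ : ℕ∞) χ → (∃ T' < T, ∀ t, T' ≤ t → χ t = 0) →
      ∫ s in 0..T, B s * deriv χ s = -c * χ 0 - ∫ s in 0..T, α s * χ s) :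
    ∀ t ∈ Icc 0 T, B t = c + ∫ s in 0..t, α s := by
  set A : ℝ → ℝ := fun t => c + ∫ s in 0..t, α s with hA
  have hAc : ContinuousOn A (Icc 0 T) := continuousOn_of_primitive hα fun t _ => rfl
  have key : ∀ t ∈ Icc 0 T, B t - A t = 0 := by
    refine eqOn_zero_of_forall_integral_eq_zero hT (hB.sub hAc) fun ψ hψ hK => ?_
    obtain ⟨K, hKc, hKs, hK0⟩ := hK
    have hs : ∃ T' < T, ∀ t, T' ≤ t → ψ t = 0 := by
      rcases K.eq_empty_or_nonempty with hKe | hKn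
      · exact ⟨0, hT, fun t _ => hK0 t (by simp [hKe])⟩
      · obtain ⟨m, hm, hmax⟩ := hKc.exists_isMaxOn hKn continuousOn_id
        refine ⟨(m + T) / 2, by linarith [(hKs hm).2], fun t ht => hK0 t fun htK => ?_⟩
        have : t ≤ m := hmax htK
        linarith [(hKs hm).2]
    obtain ⟨χ, hχ, hχd, hχ0⟩ := exists_primitive_test hψ hs
    have h1 := h χ hχ hχ0
    obtain ⟨T', hT', h0⟩ := hχ0
    have h2 := integral_primitive_mul_deriv hT.le (A := A) hα (fun t _ => rfl)
      (hχ.of_le (by exact_mod_cast le_top) : ContDiff ℝ 1 χ) (h0 T hT'.le)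
    rw [hχd] at h1 h2
    rw [integral_Ioo_eq_interval hT.le]
    simp_rw [sub_mul]
    rw [intervalIntegral.integral_sub, h1, h2, sub_self]
    · exact (hB.mul hψ.continuous.continuousOn).intervalIntegrable_of_Icc hT.le
    · exact (hAc.mul hψ.continuous.continuousOn).intervalIntegrable_of_Icc hT.le
  intro t ht
  linarith [key t ht]

/-! ### The Fourier modes of weak solutions -/

/-- The mode-by-mode form of `v_t = y_x - g`, `y_t = v_x` with `v = 0` on the boundary. -/
structure WaveSys (a b T : ℝ) (v0 y0 : ℝ → ℝ) (v y g : ℝ → ℝ → ℝ) : Prop where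
  v0_mem : MemL2 a b v0
  y0_mem : MemL2 a b y0
  v_cont : ContL2 a b (Icc 0 T) v
  y_cont : ContL2 a b (Icc 0 T) y
  g_int : IntegrableOn (fun p : ℝ × ℝ => g p.1 p.2) (Ioo a b ×ˢ Ioo 0 T)
  eq_v : ∀ n, ∀ t ∈ Icc 0 T, coef a b (sinB a b) n (fun x => v x t) = coef a b (sinB a b) n v0 +
    ∫ s in 0..t, (-freq a b n * coef a b (cosB a b) n (fun x => y x s) -
      coef a b (sinB a b) n (fun x => g x s))
  eq_y : ∀ n, ∀ t ∈ Icc 0 T, coef a b (cosB a b) n (fun x => y x t) = coef a b (cosB a b) n y0 +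
    ∫ s in 0..t, freq a b n * coef a b (sinB a b) n (fun x => v x s)

/-- The mode-by-mode form of `θ_t = θ_xx + h - G_x`, without flux through the boundary. -/
structure HeatSys (a b T : ℝ) (θ0 : ℝ → ℝ) (θ θx h G : ℝ → ℝ → ℝ) : Prop where
  θ0_mem : MemL2 a b θ0
  θ_cont : ContL2 a b (Icc 0 T) θ
  θx_int : IntegrableOn (fun p : ℝ × ℝ => θx p.1 p.2) (Ioo a b ×ˢ Ioo 0 T)
  θx_sq_int : IntegrableOn (fun p : ℝ × ℝ => θx p.1 p.2 ^ 2) (Ioo a b ×ˢ Ioo 0 T)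
  isH1 : ∀ᵐ t ∂volume.restrict (Ioo 0 T), IsH1 a b (fun x => θ x t) (fun x => θx x t)
  h_int : IntegrableOn (fun p : ℝ × ℝ => h p.1 p.2) (Ioo a b ×ˢ Ioo 0 T)
  G_int : IntegrableOn (fun p : ℝ × ℝ => G p.1 p.2) (Ioo a b ×ˢ Ioo 0 T)
  eq_θ : ∀ n, ∀ t ∈ Icc 0 T, coef a b (cosB a b) n (fun x => θ x t) = coef a b (cosB a b) n θ0 +
    ∫ s in 0..t, (freq a b n * coef a b (sinB a b) n (fun x => θx x s) +
      coef a b (cosB a b) n (fun x => h x s) - freq a b n * coef a b (sinB a b) n (fun x => G x s))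

theorem intervalIntegrable_of_Ioo {T : ℝ} (hT : 0 ≤ T) {F : ℝ → ℝ}
    (hF : IntegrableOn F (Ioo 0 T)) : IntervalIntegrable F volume 0 T :=
  (intervalIntegrable_iff_integrableOn_Ioo_of_le hT).2 hF

theorem ae_slice_memL2 {a b T : ℝ} {F : ℝ → ℝ → ℝ}
    (hF : IntegrableOn (fun p : ℝ × ℝ => F p.1 p.2) (Ioo a b ×ˢ Ioo 0 T))
    (hF2 : IntegrableOn (fun p : ℝ × ℝ => F p.1 p.2 ^ 2) (Ioo a b ×ˢ Ioo 0 T)) :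
    ∀ᵐ t ∂volume.restrict (Ioo 0 T), MemL2 a b (fun x => F x t) := by
  filter_upwards [ae_slice_integrable hF, ae_slice_integrable (F := fun x t => F x t ^ 2) hF2]
    with t h1 h2
  exact ⟨h1.aestronglyMeasurable, h2⟩

theorem coef_time_integral {a b T : ℝ} {F : ℝ → ℝ → ℝ}
    (hF : IntegrableOn (fun p : ℝ × ℝ => F p.1 p.2) (Ioo a b ×ˢ Ioo 0 T))
    {e : ℕ → ℝ → ℝ} (n : ℕ) (he : Continuous (e n)) {χ : ℝ → ℝ} (hχ : Continuous χ) :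
    coef a b e n (fun x => ∫ t in Ioo 0 T, F x t * χ t) =
      ∫ t in Ioo 0 T, coef a b e n (fun x => F x t) * χ t := by
  rw [← intOmT_mul_tensor hF n he hχ, intOmT_mul_tensor' hF he hχ, coef]

theorem pdt_tensor (ψ χ : ℝ → ℝ) :
    pdt (fun x t => ψ x * χ t) = fun x t => ψ x * deriv χ t := by
  ext x t
  exact deriv_const_mul_field _

theorem pdx_tensor (ψ χ : ℝ → ℝ) :
    pdx (fun x t => ψ x * χ t) = fun x t => deriv ψ x * χ t := by
  ext x t
  exact deriv_mul_const_field _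

theorem contDiff_tensor {ψ χ : ℝ → ℝ} (hψ : ContDiff ℝ (⊤ : ℕ∞) ψ)
    (hχ : ContDiff ℝ (⊤ : ℕ∞) χ) : ContDiff ℝ (⊤ : ℕ∞) (uncurry fun x t => ψ x * χ t) :=
  (hψ.comp contDiff_fst).mul (hχ.comp contDiff_snd)

theorem exists_compact_of_tsupport_subset {a b : ℝ} {ψ : ℝ → ℝ} (h : tsupport ψ ⊆ Ioo a b) :
    ∃ K : Set ℝ, IsCompact K ∧ K ⊆ Ioo a b ∧ ∀ x, x ∉ K → ψ x = 0 :=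
  ⟨tsupport ψ, isCompact_Icc.of_isClosed_subset (isClosed_tsupport ψ)
    (h.trans Ioo_subset_Icc_self), h, fun _ hx => image_eq_zero_of_notMem_tsupport hx⟩

section Modes

variable {a b T : ℝ} {f f' u0 u0x u0t Θ0 : ℝ → ℝ} {u ut ux Θ Θx : ℝ → ℝ → ℝ}

theorem IsWeakSol.coef_ut_weak (hab : a < b)
    (hsol : IsWeakSol a b T f f' u0 u0t Θ0 u ut ux Θ Θx) (n : ℕ) {χ : ℝ → ℝ}
    (hχ : ContDiff ℝ (⊤ : ℕ∞) χ)
    (hK : ∃ K : Set ℝ, IsCompact K ∧ K ⊆ Ioo 0 T ∧ ∀ t, t ∉ K → χ t = 0) :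
    ∫ s in Ioo 0 T, coef a b (sinB a b) n (fun x => u x s) * deriv χ s =
      - ∫ s in Ioo 0 T, coef a b (sinB a b) n (fun x => ut x s) * χ s := by
  have hdχ : Continuous (deriv χ) :=
    (hχ.of_le (by exact_mod_cast le_top) : ContDiff ℝ 1 χ).continuous_deriv le_rfl
  have hV := integrableOn_time_integral_mul hsol.u_int hdχ
  have hW := integrableOn_time_integral_mul hsol.ut_int hχ.continuous
  have hweak : WeakDerivI a b (fun _ => 0)
      (fun x => (∫ t in Ioo 0 T, u x t * deriv χ t) + ∫ t in Ioo 0 T, ut x t * χ t) := by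
    intro ψ hψ hs
    obtain ⟨K, hKc, hKs, hK0⟩ := hK
    obtain ⟨J, hJc, hJs, hJ0⟩ := exists_compact_of_tsupport_subset hs
    have h1 := hsol.ut_weak (fun x t => ψ x * χ t) ⟨contDiff_tensor hψ hχ,
      ⟨J, hJc, hJs, fun x t hx => by rw [hJ0 x hx, zero_mul]⟩,
      ⟨K, hKc, hKs, fun x t ht => by rw [hK0 t ht, mul_zero]⟩⟩
    rw [pdt_tensor, intOmT_mul_tensor' hsol.u_int hψ.continuous hdχ,
      intOmT_mul_tensor' hsol.ut_int hψ.continuous hχ.continuous] at h1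
    simp only [zero_mul, integral_zero, add_mul]
    rw [integral_add (integrableOn_mul_continuous hV hψ.continuous)
      (integrableOn_mul_continuous hW hψ.continuous), h1]
    ring
  have h2 := hweak.coef_sinB hab integrableOn_zero (hV.add hW) n
  rw [coef_add n (continuous_sinB a b n) hV hW, coef_time_integral hsol.u_int n
    (continuous_sinB a b n) hdχ, coef_time_integral hsol.ut_int n
    (continuous_sinB a b n) hχ.continuous] at h2
  simp only [coef, zero_mul, integral_zero, mul_zero] at h2 ⊢
  linarith

theorem coef_mul_const {e : ℕ → ℝ → ℝ} (n : ℕ) (g : ℝ → ℝ) (c : ℝ) :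
    coef a b e n (fun x => g x * c) = coef a b e n g * c := by
  unfold coef
  rw [← integral_mul_const]
  congr 1
  ext x
  ring

theorem IsWeakSol.coef_u_weak (hab : a < b)
    (hsol : IsWeakSol a b T f f' u0 u0t Θ0 u ut ux Θ Θx)
    (hdata : DataI a b u0 u0x u0t Θ0) (n : ℕ) {χ : ℝ → ℝ}
    (hχ : ContDiff ℝ (⊤ : ℕ∞) χ) (hK : ∃ T' < T, ∀ t, T' ≤ t → χ t = 0) :
    (∫ s in Ioo 0 T, coef a b (sinB a b) n (fun x => u x s) * deriv (deriv χ) s) +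
      (∫ s in Ioo 0 T, coef a b (sinB a b) n (fun x => f' (Θ x s) * Θx x s) * χ s) -
      coef a b (sinB a b) n u0t * χ 0 + coef a b (sinB a b) n u0 * deriv χ 0 =
      - freq a b n * ∫ s in Ioo 0 T, coef a b (cosB a b) n (fun x => ux x s) * χ s := by
  have hdχ' : ContDiff ℝ (⊤ : ℕ∞) (deriv χ) := (contDiff_infty_iff_deriv.1 hχ).2
  have hddχ : Continuous (deriv (deriv χ)) := (contDiff_infty_iff_deriv.1 hdχ').2.continuous
  have hU := integrableOn_time_integral_mul hsol.u_int hddχ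
  have hX := integrableOn_time_integral_mul hsol.ux_int hχ.continuous
  have hG := integrableOn_time_integral_mul (F := fun x t => f' (Θ x t) * Θx x t)
    hsol.g1_int hχ.continuous
  have h1i : IntegrableOn (fun x => u0t x * χ 0) (Ioo a b) := hdata.u0t_L2.integrable.mul_const _
  have h0i : IntegrableOn (fun x => u0 x * deriv χ 0) (Ioo a b) :=
    hdata.u0_L2.integrable.mul_const _
  have hA : IntegrableOn (fun x => (∫ t in Ioo 0 T, u x t * deriv (deriv χ) t) +
    ∫ t in Ioo 0 T, f' (Θ x t) * Θx x t * χ t) (Ioo a b) := hU.add hG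
  have hB : IntegrableOn (fun x => ((∫ t in Ioo 0 T, u x t * deriv (deriv χ) t) +
    ∫ t in Ioo 0 T, f' (Θ x t) * Θx x t * χ t) - u0t x * χ 0) (Ioo a b) := hA.sub h1i
  have hC : IntegrableOn (fun x => (((∫ t in Ioo 0 T, u x t * deriv (deriv χ) t) +
    ∫ t in Ioo 0 T, f' (Θ x t) * Θx x t * χ t) - u0t x * χ 0) + u0 x * deriv χ 0) (Ioo a b) :=
    hB.add h0i
  have hweak : WeakDerivI a b (fun x => ∫ t in Ioo 0 T, ux x t * χ t)
      (fun x => (((∫ t in Ioo 0 T, u x t * deriv (deriv χ) t) +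
    ∫ t in Ioo 0 T, f' (Θ x t) * Θx x t * χ t) - u0t x * χ 0) + u0 x * deriv χ 0) := by
    intro ψ hψ hs
    obtain ⟨J, hJc, hJs, hJ0⟩ := exists_compact_of_tsupport_subset hs
    obtain ⟨T', hT', h0⟩ := hK
    have hψc := hψ.continuous
    have hdψ : Continuous (deriv ψ) := (contDiff_infty_iff_deriv.1 hψ).2.continuous
    have h1 := hsol.weak_u (fun x t => ψ x * χ t) ⟨contDiff_tensor hψ hχ,
      ⟨J, hJc, hJs, fun x t hx => by rw [hJ0 x hx, zero_mul]⟩,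
      ⟨T', hT', fun x t ht => by rw [h0 t ht, mul_zero]⟩⟩
    rw [pdt_tensor, pdt_tensor, pdx_tensor, intOmT_mul_tensor' hsol.u_int hψc hddχ,
      intOmT_mul_tensor' hsol.ux_int hdψ hχ.continuous,
      intOmT_mul_tensor' (F := fun x t => f' (Θ x t) * Θx x t) hsol.g1_int hψc hχ.continuous,
      intOm, intOm] at h1
    simp only [add_mul, sub_mul]
    have e1 := integrableOn_mul_continuous hU hψc
    have e2 := integrableOn_mul_continuous hG hψc
    have e3 := integrableOn_mul_continuous h1i hψc
    have e4 := integrableOn_mul_continuous h0i hψc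
    have e12 : IntegrableOn (fun x => (∫ t in Ioo 0 T, u x t * deriv (deriv χ) t) * ψ x +
      (∫ t in Ioo 0 T, f' (Θ x t) * Θx x t * χ t) * ψ x) (Ioo a b) := e1.add e2
    have e123 : IntegrableOn (fun x => (∫ t in Ioo 0 T, u x t * deriv (deriv χ) t) * ψ x +
      (∫ t in Ioo 0 T, f' (Θ x t) * Θx x t * χ t) * ψ x - u0t x * χ 0 * ψ x) (Ioo a b) :=
      e12.sub e3
    rw [integral_add e123 e4, integral_sub e12 e3, integral_add e1 e2]
    have e5 : ∫ x in Ioo a b, u0t x * χ 0 * ψ x = ∫ x in Ioo a b, u0t x * (ψ x * χ 0) := by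
      congr 1; ext x; ring
    have e6 : ∫ x in Ioo a b, u0 x * deriv χ 0 * ψ x =
        ∫ x in Ioo a b, u0 x * (ψ x * deriv χ 0) := by
      congr 1; ext x; ring
    rw [e5, e6]
    linarith
  have h2 := hweak.coef_sinB hab hX hC n
  have hs := continuous_sinB a b n
  rw [coef_add n hs hB h0i, coef_sub n hs hA h1i, coef_add n hs hU hG, coef_mul_const,
    coef_mul_const, coef_time_integral hsol.u_int n hs hddχ,
    coef_time_integral (F := fun x t => f' (Θ x t) * Θx x t) hsol.g1_int n hs hχ.continuous,
    coef_time_integral hsol.ux_int n (continuous_cosB a b n) hχ.continuous] at h2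
  exact h2

theorem IsWeakSol.waveSys (hab : a < b) (hT : 0 < T)
    (hsol : IsWeakSol a b T f f' u0 u0t Θ0 u ut ux Θ Θx)
    (hdata : DataI a b u0 u0x u0t Θ0) (hreg : RegT a b T u ut ux Θ Θx) :
    WaveSys a b T u0t u0x ut ux (fun x t => f' (Θ x t) * Θx x t) := by
  have key : ∀ n, (∀ t ∈ Icc 0 T, coef a b (sinB a b) n (fun x => ut x t) =
      coef a b (sinB a b) n u0t +
    ∫ s in 0..t, (-freq a b n * coef a b (cosB a b) n (fun x => ux x s) -
      coef a b (sinB a b) n (fun x => f' (Θ x s) * Θx x s))) ∧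
      ∀ t ∈ Icc 0 T, coef a b (sinB a b) n (fun x => u x t) = coef a b (sinB a b) n u0 +
        ∫ s in 0..t, coef a b (sinB a b) n (fun x => ut x s) := by
    intro n
    have hsn := continuous_sinB a b n
    set A : ℝ → ℝ := fun s => coef a b (sinB a b) n (fun x => u x s) with hA
    set d : ℝ → ℝ := fun s => coef a b (sinB a b) n (fun x => ut x s) with hd
    set X : ℝ → ℝ := fun s => coef a b (cosB a b) n (fun x => ux x s) with hX
    set γ : ℝ → ℝ := fun s => coef a b (sinB a b) n (fun x => f' (Θ x s) * Θx x s) with hγ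
    set β := coef a b (sinB a b) n u0t
    set α₀ := coef a b (sinB a b) n u0
    have hAc : ContinuousOn A (Icc 0 T) := hreg.u_cont.continuousOn_coef n hsn
    have hdc : ContinuousOn d (Icc 0 T) := hreg.ut_cont.continuousOn_coef n hsn
    have hXc : ContinuousOn X (Icc 0 T) :=
      hreg.ux_cont.continuousOn_coef n (continuous_cosB a b n)
    have hγi : IntervalIntegrable γ volume 0 T := intervalIntegrable_of_Ioo hT.le
      (integrableOn_coef_slice (F := fun x t => f' (Θ x t) * Θx x t) hsol.g1_int n hsn)
    have hri : IntervalIntegrable (fun s => -freq a b n * X s - γ s) volume 0 T :=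
      ((hXc.intervalIntegrable_of_Icc hT.le).const_mul _).sub hγi
    set D : ℝ → ℝ := fun t => β + ∫ s in 0..t, (-freq a b n * X s - γ s) with hD
    have hDc : ContinuousOn D (Icc 0 T) := continuousOn_of_primitive hri fun t _ => rfl
    have h1 : ∀ t ∈ Icc 0 T, A t = α₀ + ∫ s in 0..t, D s := by
      refine eq_primitive_of_forall_test hT (hDc.intervalIntegrable_of_Icc hT.le) hAc
        fun χ hχ hK => ?_
      obtain ⟨χ₂, hχ₂, hdχ₂, hK₂⟩ := exists_primitive_test hχ hK
      have e1 := hsol.coef_u_weak hab hdata n hχ₂ hK₂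
      obtain ⟨T', hT', h0⟩ := hK₂
      have e2 := integral_primitive_mul_deriv hT.le (A := D) hri (fun t _ => rfl)
        (hχ₂.of_le (by exact_mod_cast le_top) : ContDiff ℝ 1 χ₂) (h0 T hT'.le)
      rw [hdχ₂] at e1 e2
      rw [integral_Ioo_eq_interval hT.le, integral_Ioo_eq_interval hT.le,
        integral_Ioo_eq_interval hT.le] at e1
      have e3 : ∫ s in 0..T, (-freq a b n * X s - γ s) * χ₂ s =
          -freq a b n * (∫ s in 0..T, X s * χ₂ s) - ∫ s in 0..T, γ s * χ₂ s := by
        rw [← intervalIntegral.integral_const_mul, ← intervalIntegral.integral_sub]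
        · congr 1; ext s; ring
        · exact ((hXc.mul hχ₂.continuous.continuousOn).intervalIntegrable_of_Icc hT.le).const_mul _
        · exact hγi.mul_continuousOn hχ₂.continuous.continuousOn
      rw [e3] at e2
      linarith
    have h2 : ∀ t ∈ Icc 0 T, d t - D t = 0 := by
      refine eqOn_zero_of_forall_integral_eq_zero hT (hdc.sub hDc) fun ψ hψ hK => ?_
      have e1 := hsol.coef_ut_weak hab n hψ hK
      obtain ⟨K, hKc, hKs, hK0⟩ := hK
      have hψ0 : ψ 0 = 0 := hK0 0 fun h => lt_irrefl _ (hKs h).1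
      have hψT : ψ T = 0 := hK0 T fun h => lt_irrefl _ (hKs h).2
      have e2 := integral_primitive_mul_deriv hT.le (A := A)
        (hDc.intervalIntegrable_of_Icc hT.le) h1
        (hψ.of_le (by exact_mod_cast le_top) : ContDiff ℝ 1 ψ) hψT
      rw [integral_Ioo_eq_interval hT.le, integral_Ioo_eq_interval hT.le] at e1
      rw [integral_Ioo_eq_interval hT.le]
      simp_rw [sub_mul]
      rw [intervalIntegral.integral_sub]
      · rw [hψ0] at e2
        linarith
      · exact (hdc.mul hψ.continuous.continuousOn).intervalIntegrable_of_Icc hT.le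
      · exact (hDc.mul hψ.continuous.continuousOn).intervalIntegrable_of_Icc hT.le
    refine ⟨fun t ht => sub_eq_zero.1 (h2 t ht), fun t ht => ?_⟩
    refine (h1 t ht).trans (congrArg (α₀ + ·) ?_)
    refine intervalIntegral.integral_congr fun s hs => ?_
    rw [uIcc_of_le ht.1] at hs
    exact (sub_eq_zero.1 (h2 s ⟨hs.1, hs.2.trans ht.2⟩)).symm
  refine ⟨hdata.u0t_L2, hdata.u0x_L2, hreg.ut_cont, hreg.ux_cont, hsol.g1_int,
    fun n => (key n).1, fun n t ht => ?_⟩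
  rw [(hreg.u_W0 t ht).coef_cosB, hdata.u0_W0.coef_cosB, (key n).2 t ht,
    intervalIntegral.integral_const_mul]
  ring

theorem IsWeakSol.heatSys (hab : a < b) (hT : 0 < T)
    (hsol : IsWeakSol a b T f f' u0 u0t Θ0 u ut ux Θ Θx)
    (hdata : DataI a b u0 u0x u0t Θ0) (hreg : RegT a b T u ut ux Θ Θx) :
    HeatSys a b T Θ0 Θ Θx (fun x t => f' (Θ x t) * Θx x t * ut x t)
      (fun x t => f (Θ x t) * ut x t) := by
  refine ⟨hdata.Θ0_L2, hreg.Θ_cont, hsol.Θx_int, hreg.Θx_sq_int, ?_, hsol.g2_int, hsol.g3_int,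
    fun n => ?_⟩
  · filter_upwards [hsol.Θ_W, ae_slice_memL2 hsol.Θx_int hreg.Θx_sq_int,
      ae_restrict_mem measurableSet_Ioo] with t h1 h2 ht
    exact h1.isH1 hab (hreg.Θ_cont.1 t (Ioo_subset_Icc_self ht)) h2
  · have hsn := continuous_sinB a b n
    have hcn := continuous_cosB a b n
    have i1 := integrableOn_coef_slice hsol.Θx_int n hsn
    have i2 := integrableOn_coef_slice (F := fun x t => f' (Θ x t) * Θx x t * ut x t)
      hsol.g2_int n hcn
    have i3 := integrableOn_coef_slice (F := fun x t => f (Θ x t) * ut x t) hsol.g3_int n hsn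
    have j1 := (intervalIntegrable_of_Ioo hT.le i1).const_mul (freq a b n)
    have j2 := intervalIntegrable_of_Ioo hT.le i2
    have j3 := (intervalIntegrable_of_Ioo hT.le i3).const_mul (freq a b n)
    refine eq_primitive_of_forall_test hT ((j1.add j2).sub j3)
      (hreg.Θ_cont.continuousOn_coef n hcn) fun χ hχ hK => ?_
    have hχc := hχ.continuous
    have hdχ : Continuous (deriv χ) := (contDiff_infty_iff_deriv.1 hχ).2.continuous
    obtain ⟨T', hT', h0⟩ := hK
    have h1 := hsol.weak_Θ (fun x t => cosB a b n x * χ t) ⟨contDiff_tensor (contDiff_cosB a b n)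
      hχ, ⟨T', hT', fun x t ht => by rw [h0 t ht, mul_zero]⟩⟩
    have hneg : ∀ F : ℝ → ℝ → ℝ, intOmT a b T (fun x t => F x t *
        (-freq a b n * sinB a b n x * χ t)) =
        -freq a b n * intOmT a b T (fun x t => F x t * (sinB a b n x * χ t)) := by
      intro F
      unfold intOmT
      rw [← integral_const_mul]
      congr 1; ext p; ring
    rw [pdt_tensor, pdx_tensor, deriv_cosB, hneg, hneg (fun x t => f (Θ x t) * ut x t),
      intOmT_mul_tensor hsol.Θ_int n hcn hdχ, intOmT_mul_tensor hsol.Θx_int n hsn hχc,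
      intOmT_mul_tensor (F := fun x t => f' (Θ x t) * Θx x t * ut x t) hsol.g2_int n hcn hχc,
      intOmT_mul_tensor (F := fun x t => f (Θ x t) * ut x t) hsol.g3_int n hsn hχc,
      integral_Ioo_eq_interval hT.le, integral_Ioo_eq_interval hT.le,
      integral_Ioo_eq_interval hT.le, integral_Ioo_eq_interval hT.le, intOm] at h1
    have e0 : ∫ x in Ioo a b, Θ0 x * (cosB a b n x * χ 0) = coef a b (cosB a b) n Θ0 * χ 0 := by
      rw [coef, ← integral_mul_const]
      congr 1; ext x; ring
    rw [e0] at h1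
    simp_rw [sub_mul, add_mul]
    have k1 := j1.mul_continuousOn hχc.continuousOn
    have k2 := j2.mul_continuousOn hχc.continuousOn
    have k3 := j3.mul_continuousOn hχc.continuousOn
    rw [intervalIntegral.integral_sub (k1.add k2) k3, intervalIntegral.integral_add k1 k2]
    simp_rw [mul_assoc (freq a b n)]
    rw [intervalIntegral.integral_const_mul, intervalIntegral.integral_const_mul]
    linarith

end Modes

/-! ### Energy identities -/

theorem ae_Ioo_of_le {T t : ℝ} (ht : t ≤ T) {p : ℝ → Prop}
    (h : ∀ᵐ s ∂volume.restrict (Ioo 0 T), p s) : ∀ᵐ s ∂volume.restrict (Ioo 0 t), p s :=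
  ae_restrict_of_ae_restrict_of_subset (Ioo_subset_Ioo_right ht) h

theorem integrableOn_sqOm_slice {a b T : ℝ} {F : ℝ → ℝ → ℝ}
    (hF : IntegrableOn (fun p : ℝ × ℝ => F p.1 p.2 ^ 2) (Ioo a b ×ˢ Ioo 0 T)) :
    IntegrableOn (fun t => sqOm a b (fun x => F x t)) (Ioo 0 T) :=
  integrableOn_slice_integral (F := fun x t => F x t ^ 2) hF

theorem supBd_le {a b : ℝ} (g g' : ℝ → ℝ) :
    supBd a b g g' ≤ (1 / (b - a) + 1) * sqOm a b g + sqOm a b g' := by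
  have h1 := Real.sq_sqrt (sqOm_nonneg a b g)
  have h2 := Real.sq_sqrt (sqOm_nonneg a b g')
  unfold supBd
  nlinarith [sq_nonneg (√(sqOm a b g) - √(sqOm a b g'))]

theorem ContL2.integrableOn_sqOm {a b T : ℝ} {w : ℝ → ℝ → ℝ} (hw : ContL2 a b (Icc 0 T) w) :
    IntegrableOn (fun t => sqOm a b (fun x => w x t)) (Ioo 0 T) :=
  (hw.continuousOn_sqOm.integrableOn_Icc).mono_set Ioo_subset_Icc_self

/-- Passage to the limit in the energy identities of the individual modes. -/
theorem tendsto_integral_modes {t : ℝ} {w A B : ℕ → ℝ} {r : ℕ → ℝ → ℝ} {a₀ b₀ : ℝ}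
    {bd ρ : ℝ → ℝ} (hA : HasSum (fun n => w n * A n) a₀) (hB : HasSum (fun n => w n * B n) b₀)
    (hr : ∀ n, IntegrableOn (r n) (Ioo 0 t)) (h : ∀ n, A n = B n + ∫ s in Ioo 0 t, r n s)
    (hbd : IntegrableOn bd (Ioo 0 t))
    (hle : ∀ᵐ s ∂volume.restrict (Ioo 0 t), ∀ N,
      |∑ n ∈ Finset.range N, w n * r n s| ≤ bd s)
    (hlim : ∀ᵐ s ∂volume.restrict (Ioo 0 t),
      Tendsto (fun N => ∑ n ∈ Finset.range N, w n * r n s) atTop (nhds (ρ s))) :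
    IntegrableOn ρ (Ioo 0 t) ∧ a₀ = b₀ + ∫ s in Ioo 0 t, ρ s := by
  have hi : ∀ N, IntegrableOn (fun s => ∑ n ∈ Finset.range N, w n * r n s) (Ioo 0 t) := fun N =>
    integrable_finsetSum _ fun n _ => (hr n).const_mul _
  refine ⟨Integrable.mono' hbd (aestronglyMeasurable_of_tendsto_ae atTop
    (fun N => (hi N).aestronglyMeasurable) hlim) ?_, ?_⟩
  · filter_upwards [hle, hlim] with s h1 h2
    exact le_of_tendsto h2.norm (Eventually.of_forall h1)
  have h1 : Tendsto (fun N => ∫ s in Ioo 0 t, ∑ n ∈ Finset.range N, w n * r n s) atTop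
      (nhds (∫ s in Ioo 0 t, ρ s)) := by
    refine tendsto_integral_of_dominated_convergence bd (fun N => (hi N).aestronglyMeasurable)
      hbd (fun N => ?_) hlim
    filter_upwards [hle] with s hs
    exact hs N
  have h2 := hB.tendsto_sum_nat.add h1
  refine tendsto_nhds_unique hA.tendsto_sum_nat (h2.congr fun N => ?_)
  rw [integral_finsetSum _ fun n _ => (hr n).const_mul _, ← Finset.sum_add_distrib]
  refine Finset.sum_congr rfl fun n _ => ?_
  rw [integral_const_mul, h n]
  ring

namespace WaveSys

variable {a b T : ℝ} {v0 y0 v0' y0' : ℝ → ℝ} {v y g v' y' g' : ℝ → ℝ → ℝ}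

theorem sub (h : WaveSys a b T v0 y0 v y g) (h' : WaveSys a b T v0' y0' v' y' g') :
    WaveSys a b T (fun x => v0 x - v0' x) (fun x => y0 x - y0' x) (fun x t => v x t - v' x t)
      (fun x t => y x t - y' x t) (fun x t => g x t - g' x t) := by
  refine ⟨h.v0_mem.sub h'.v0_mem, h.y0_mem.sub h'.y0_mem, h.v_cont.sub h'.v_cont,
    h.y_cont.sub h'.y_cont, h.g_int.sub h'.g_int, fun n t ht => ?_, fun n t ht => ?_⟩
  · have hs := continuous_sinB a b n
    have hc := continuous_cosB a b n
    rw [coef_sub n hs (h.v_cont.1 t ht).integrable (h'.v_cont.1 t ht).integrable,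
      coef_sub n hs h.v0_mem.integrable h'.v0_mem.integrable, h.eq_v n t ht, h'.eq_v n t ht,
      ← integral_Ioo_eq_interval ht.1, ← integral_Ioo_eq_interval ht.1,
      ← integral_Ioo_eq_interval ht.1, add_sub_add_comm]
    have hsub : Ioo 0 t ⊆ Icc 0 T := fun s hs => ⟨hs.1.le, hs.2.le.trans ht.2⟩
    have i1 : IntegrableOn (fun s => -freq a b n * coef a b (cosB a b) n (fun x => y x s) -
        coef a b (sinB a b) n (fun x => g x s)) (Ioo 0 t) :=
      ((((h.y_cont.continuousOn_coef n hc).integrableOn_Icc).mono_set hsub).const_mul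
        (-freq a b n)).sub
        ((integrableOn_coef_slice h.g_int n hs).mono_set (Ioo_subset_Ioo_right ht.2))
    have i1' : IntegrableOn (fun s => -freq a b n * coef a b (cosB a b) n (fun x => y' x s) -
        coef a b (sinB a b) n (fun x => g' x s)) (Ioo 0 t) :=
      ((((h'.y_cont.continuousOn_coef n hc).integrableOn_Icc).mono_set hsub).const_mul
        (-freq a b n)).sub
        ((integrableOn_coef_slice h'.g_int n hs).mono_set (Ioo_subset_Ioo_right ht.2))
    rw [← integral_sub i1 i1']
    congr 1
    refine integral_congr_ae ?_
    filter_upwards [ae_Ioo_of_le ht.2 (ae_slice_integrable h.g_int),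
      ae_Ioo_of_le ht.2 (ae_slice_integrable h'.g_int), ae_restrict_mem measurableSet_Ioo]
      with s h1 h2 hs3
    rw [coef_sub n hs h1 h2, coef_sub n hc (h.y_cont.1 s (hsub hs3)).integrable
      (h'.y_cont.1 s (hsub hs3)).integrable]
    ring
  · have hs := continuous_sinB a b n
    have hc := continuous_cosB a b n
    rw [coef_sub n hc (h.y_cont.1 t ht).integrable (h'.y_cont.1 t ht).integrable,
      coef_sub n hc h.y0_mem.integrable h'.y0_mem.integrable, h.eq_y n t ht, h'.eq_y n t ht,
      ← integral_Ioo_eq_interval ht.1, ← integral_Ioo_eq_interval ht.1,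
      ← integral_Ioo_eq_interval ht.1, add_sub_add_comm]
    have hsub : Ioo 0 t ⊆ Icc 0 T := fun s hs => ⟨hs.1.le, hs.2.le.trans ht.2⟩
    have i1 : IntegrableOn _ (Ioo 0 t) :=
      (((h.v_cont.continuousOn_coef n hs).integrableOn_Icc).mono_set hsub).const_mul (freq a b n)
    have i1' : IntegrableOn _ (Ioo 0 t) :=
      (((h'.v_cont.continuousOn_coef n hs).integrableOn_Icc).mono_set hsub).const_mul (freq a b n)
    rw [← integral_sub i1 i1']
    congr 1
    refine integral_congr_ae ?_
    filter_upwards [ae_restrict_mem measurableSet_Ioo] with s hs3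
    rw [coef_sub n hs (h.v_cont.1 s (hsub hs3)).integrable (h'.v_cont.1 s (hsub hs3)).integrable]
    ring

theorem energy (hab : a < b) (hT : 0 < T) (h : WaveSys a b T v0 y0 v y g)
    (hg2 : IntegrableOn (fun p : ℝ × ℝ => g p.1 p.2 ^ 2) (Ioo a b ×ˢ Ioo 0 T)) :
    ∀ t ∈ Icc 0 T, IntegrableOn (fun s => -2 * ∫ x in Ioo a b, g x s * v x s) (Ioo 0 t) ∧
      sqOm a b (fun x => v x t) + sqOm a b (fun x => y x t) =
      sqOm a b v0 + sqOm a b y0 + ∫ s in Ioo 0 t, -2 * ∫ x in Ioo a b, g x s * v x s := by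
  intro t ht
  have hS := isParsevalSystem_sinB hab
  have hC := isParsevalSystem_cosB hab
  have hsub : Ioo 0 t ⊆ Icc 0 T := fun s hs => ⟨hs.1.le, hs.2.le.trans ht.2⟩
  have hgi : ∀ n, IntervalIntegrable (fun s => coef a b (sinB a b) n (fun x => g x s)) volume 0 T :=
    fun n => intervalIntegrable_of_Ioo hT.le
      (integrableOn_coef_slice h.g_int n (continuous_sinB a b n))
  have hvc : ∀ n, ContinuousOn (fun s => coef a b (sinB a b) n (fun x => v x s)) (Icc 0 T) :=
    fun n => h.v_cont.continuousOn_coef n (continuous_sinB a b n)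
  have hyc : ∀ n, ContinuousOn (fun s => coef a b (cosB a b) n (fun x => y x s)) (Icc 0 T) :=
    fun n => h.y_cont.continuousOn_coef n (continuous_cosB a b n)
  have hgv : ∀ n, IntegrableOn (fun s => coef a b (sinB a b) n (fun x => g x s) *
      coef a b (sinB a b) n (fun x => v x s)) (Ioo 0 T) := fun n =>
    (intervalIntegrable_iff_integrableOn_Ioo_of_le hT.le).1
      ((hgi n).mul_continuousOn (by rw [uIcc_of_le hT.le]; exact hvc n))
  refine tendsto_integral_modes (w := wgt a b)
    (A := fun n => coef a b (sinB a b) n (fun x => v x t) ^ 2 +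
      coef a b (cosB a b) n (fun x => y x t) ^ 2)
    (B := fun n => coef a b (sinB a b) n v0 ^ 2 + coef a b (cosB a b) n y0 ^ 2)
    (r := fun n s => -2 * (coef a b (sinB a b) n (fun x => g x s) *
      coef a b (sinB a b) n (fun x => v x s)))
    (bd := fun s => 2 * (sqOm a b (fun x => g x s) + sqOm a b (fun x => v x s))) ?_ ?_ ?_ ?_ ?_ ?_ ?_
  · simp_rw [mul_add]
    exact (hS.parseval _ (h.v_cont.1 t ht)).add (hC.parseval _ (h.y_cont.1 t ht))
  · simp_rw [mul_add]
    exact (hS.parseval _ h.v0_mem).add (hC.parseval _ h.y0_mem)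
  · exact fun n => ((hgv n).mono_set (Ioo_subset_Ioo_right ht.2)).const_mul _
  · intro n
    have i1 := (((hyc n).intervalIntegrable_of_Icc (μ := volume) hT.le).const_mul (-freq a b n)).sub (hgi n)
    have i2 := ((hvc n).intervalIntegrable_of_Icc (μ := volume) hT.le).const_mul (freq a b n)
    have e1 := mul_eq_add_integral_of_primitive hT.le i1 i1 (h.eq_v n) (h.eq_v n) ht
    have e2 := mul_eq_add_integral_of_primitive hT.le i2 i2 (h.eq_y n) (h.eq_y n) ht
    rw [← integral_Ioo_eq_interval ht.1] at e1 e2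
    have j1 : IntegrableOn (fun s => (-freq a b n * coef a b (cosB a b) n (fun x => y x s) -
        coef a b (sinB a b) n (fun x => g x s)) * coef a b (sinB a b) n (fun x => v x s) +
        coef a b (sinB a b) n (fun x => v x s) * (-freq a b n *
        coef a b (cosB a b) n (fun x => y x s) - coef a b (sinB a b) n (fun x => g x s)))
        (Ioo 0 t) := by
      have k1 : IntegrableOn (fun s => coef a b (cosB a b) n (fun x => y x s) *
          coef a b (sinB a b) n (fun x => v x s)) (Icc 0 T) :=
        ((hyc n).mul (hvc n)).integrableOn_Icc
      have k2 := (((k1.mono_set hsub).const_mul (-2 * freq a b n)).add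
        (((hgv n).mono_set (Ioo_subset_Ioo_right ht.2)).const_mul (-2)))
      refine k2.congr (Eventually.of_forall fun s => ?_)
      simp only [Pi.add_apply]
      ring
    have j2 : IntegrableOn (fun s => freq a b n * coef a b (sinB a b) n (fun x => v x s) *
        coef a b (cosB a b) n (fun x => y x s) + coef a b (cosB a b) n (fun x => y x s) *
        (freq a b n * coef a b (sinB a b) n (fun x => v x s))) (Ioo 0 t) := by
      have k1 : IntegrableOn (fun s => coef a b (cosB a b) n (fun x => y x s) *
          coef a b (sinB a b) n (fun x => v x s)) (Icc 0 T) :=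
        ((hyc n).mul (hvc n)).integrableOn_Icc
      refine ((k1.mono_set hsub).const_mul (2 * freq a b n)).congr (Eventually.of_forall fun s => ?_)
      dsimp only
      ring
    rw [sq, sq, sq, sq, e1, e2, add_add_add_comm, ← integral_add j1 j2]
    congr 1
    congr 1
    ext s
    ring
  · exact ((((integrableOn_sqOm_slice hg2).add h.v_cont.integrableOn_sqOm).mono_set
      (Ioo_subset_Ioo_right ht.2)).const_mul 2)
  · filter_upwards [ae_Ioo_of_le ht.2 (ae_slice_memL2 h.g_int hg2),
      ae_restrict_mem measurableSet_Ioo] with s hs1 hs2 N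
    have e := hS.abs_sum_mul_le hs1 (h.v_cont.1 s (hsub hs2)) N
    simp_rw [mul_left_comm _ (-2 : ℝ)]
    rw [← Finset.mul_sum, abs_mul, abs_neg, abs_two]
    linarith
  · filter_upwards [ae_Ioo_of_le ht.2 (ae_slice_memL2 h.g_int hg2),
      ae_restrict_mem measurableSet_Ioo] with s hs1 hs2
    simp_rw [mul_left_comm _ (-2 : ℝ)]
    exact ((hS.hasSum_mul hs1 (h.v_cont.1 s (hsub hs2))).mul_left (-2)).tendsto_sum_nat

end WaveSys

namespace HeatSys

variable {a b T : ℝ} {θ0 θ0' : ℝ → ℝ} {θ θx h G θ' θx' h' G' : ℝ → ℝ → ℝ}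

theorem integrableOn_rhs (H : HeatSys a b T θ0 θ θx h G) (n : ℕ) :
    IntegrableOn (fun s => freq a b n * coef a b (sinB a b) n (fun x => θx x s) +
      coef a b (cosB a b) n (fun x => h x s) -
      freq a b n * coef a b (sinB a b) n (fun x => G x s)) (Ioo 0 T) :=
  (((integrableOn_coef_slice H.θx_int n (continuous_sinB a b n)).const_mul _).add
    (integrableOn_coef_slice H.h_int n (continuous_cosB a b n))).sub
    ((integrableOn_coef_slice H.G_int n (continuous_sinB a b n)).const_mul _)

theorem sub (H : HeatSys a b T θ0 θ θx h G) (H' : HeatSys a b T θ0' θ' θx' h' G') :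
    HeatSys a b T (fun x => θ0 x - θ0' x) (fun x t => θ x t - θ' x t)
      (fun x t => θx x t - θx' x t) (fun x t => h x t - h' x t) (fun x t => G x t - G' x t) := by
  refine ⟨H.θ0_mem.sub H'.θ0_mem, H.θ_cont.sub H'.θ_cont, H.θx_int.sub H'.θx_int, ?_, ?_,
    H.h_int.sub H'.h_int, H.G_int.sub H'.G_int, fun n t ht => ?_⟩
  · have m1 := (memLp_two_iff_integrable_sq H.θx_int.aestronglyMeasurable).2 H.θx_sq_int
    have m2 := (memLp_two_iff_integrable_sq H'.θx_int.aestronglyMeasurable).2 H'.θx_sq_int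
    exact (m1.sub m2).integrable_sq
  · filter_upwards [H.isH1, H'.isH1] with t h1 h2
    exact h1.sub h2
  · have hs := continuous_sinB a b n
    have hc := continuous_cosB a b n
    rw [coef_sub n hc (H.θ_cont.1 t ht).integrable (H'.θ_cont.1 t ht).integrable,
      coef_sub n hc H.θ0_mem.integrable H'.θ0_mem.integrable, H.eq_θ n t ht, H'.eq_θ n t ht,
      ← integral_Ioo_eq_interval ht.1, ← integral_Ioo_eq_interval ht.1,
      ← integral_Ioo_eq_interval ht.1, add_sub_add_comm,
      ← integral_sub ((H.integrableOn_rhs n).mono_set (Ioo_subset_Ioo_right ht.2))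
        ((H'.integrableOn_rhs n).mono_set (Ioo_subset_Ioo_right ht.2))]
    congr 1
    refine integral_congr_ae ?_
    filter_upwards [ae_Ioo_of_le ht.2 (ae_slice_integrable H.h_int),
      ae_Ioo_of_le ht.2 (ae_slice_integrable H'.h_int),
      ae_Ioo_of_le ht.2 (ae_slice_integrable H.G_int),
      ae_Ioo_of_le ht.2 (ae_slice_integrable H'.G_int),
      ae_Ioo_of_le ht.2 (ae_slice_integrable H.θx_int),
      ae_Ioo_of_le ht.2 (ae_slice_integrable H'.θx_int)]
      with s h1 h2 h3 h4 h5 h6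
    rw [coef_sub n hc h1 h2, coef_sub n hs h3 h4, coef_sub n hs h5 h6]
    ring

theorem energy (hab : a < b) (hT : 0 < T) (H : HeatSys a b T θ0 θ θx h G)
    (hG2 : IntegrableOn (fun p : ℝ × ℝ => G p.1 p.2 ^ 2) (Ioo a b ×ˢ Ioo 0 T)) {κ : ℝ → ℝ}
    (hκ : IntegrableOn (fun t => κ t ^ 2) (Ioo 0 T))
    (hh : ∀ᵐ t ∂volume.restrict (Ioo 0 T), ∫ x in Ioo a b, |h x t| ≤ κ t) :
    ∀ t ∈ Icc 0 T, IntegrableOn (fun s => 2 * (-sqOm a b (fun x => θx x s) +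
        (∫ x in Ioo a b, h x s * θ x s) + ∫ x in Ioo a b, G x s * θx x s)) (Ioo 0 t) ∧
      sqOm a b (fun x => θ x t) = sqOm a b θ0 + ∫ s in Ioo 0 t,
        2 * (-sqOm a b (fun x => θx x s) + (∫ x in Ioo a b, h x s * θ x s) +
        ∫ x in Ioo a b, G x s * θx x s) := by
  intro t ht
  have hS := isParsevalSystem_sinB hab
  have hC := isParsevalSystem_cosB hab
  have hsub : Ioo 0 t ⊆ Icc 0 T := fun s hs => ⟨hs.1.le, hs.2.le.trans ht.2⟩
  have hbc : ∀ n, ContinuousOn (fun s => coef a b (cosB a b) n (fun x => θ x s)) (Icc 0 T) :=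
    fun n => H.θ_cont.continuousOn_coef n (continuous_cosB a b n)
  have hri := fun n => intervalIntegrable_of_Ioo hT.le (H.integrableOn_rhs n)
  have hsplit : ∀ s, IsH1 a b (fun x => θ x s) (fun x => θx x s) → ∀ N,
      ∑ n ∈ Finset.range N, wgt a b n * (2 * ((freq a b n * coef a b (sinB a b) n (fun x => θx x s) +
      coef a b (cosB a b) n (fun x => h x s) -
      freq a b n * coef a b (sinB a b) n (fun x => G x s)) *
      coef a b (cosB a b) n (fun x => θ x s))) =
      2 * (-(∑ n ∈ Finset.range N, wgt a b n * coef a b (sinB a b) n (fun x => θx x s) ^ 2) +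
        (∑ n ∈ Finset.range N, wgt a b n * (coef a b (cosB a b) n (fun x => θ x s) *
          coef a b (cosB a b) n (fun x => h x s))) +
        ∑ n ∈ Finset.range N, wgt a b n * (coef a b (sinB a b) n (fun x => G x s) *
          coef a b (sinB a b) n (fun x => θx x s))) := by
    intro s hs N
    rw [← Finset.sum_neg_distrib, ← Finset.sum_add_distrib, ← Finset.sum_add_distrib,
      Finset.mul_sum]
    refine Finset.sum_congr rfl fun n _ => ?_
    rw [hs.coef_eq]
    ring
  refine tendsto_integral_modes (w := wgt a b)
    (A := fun n => coef a b (cosB a b) n (fun x => θ x t) ^ 2)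
    (B := fun n => coef a b (cosB a b) n θ0 ^ 2)
    (r := fun n s => 2 * ((freq a b n * coef a b (sinB a b) n (fun x => θx x s) +
      coef a b (cosB a b) n (fun x => h x s) -
      freq a b n * coef a b (sinB a b) n (fun x => G x s)) *
      coef a b (cosB a b) n (fun x => θ x s)))
    (bd := fun s => 2 * (sqOm a b (fun x => θx x s) + (κ s ^ 2 +
      ((1 / (b - a) + 1) * sqOm a b (fun x => θ x s) + sqOm a b (fun x => θx x s))) +
      (sqOm a b (fun x => G x s) + sqOm a b (fun x => θx x s)))) ?_ ?_ ?_ ?_ ?_ ?_ ?_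
  · exact hC.parseval _ (H.θ_cont.1 t ht)
  · exact hC.parseval _ H.θ0_mem
  · intro n
    have hrb : IntegrableOn (fun s => (freq a b n * coef a b (sinB a b) n (fun x => θx x s) +
        coef a b (cosB a b) n (fun x => h x s) -
        freq a b n * coef a b (sinB a b) n (fun x => G x s)) *
        coef a b (cosB a b) n (fun x => θ x s)) (Ioo 0 T) :=
      (intervalIntegrable_iff_integrableOn_Ioo_of_le hT.le).1
        ((hri n).mul_continuousOn (by rw [uIcc_of_le hT.le]; exact hbc n))
    exact (hrb.mono_set (Ioo_subset_Ioo_right ht.2)).const_mul 2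
  · intro n
    rw [sq, sq, mul_eq_add_integral_of_primitive hT.le (hri n) (hri n) (H.eq_θ n) (H.eq_θ n) ht,
      ← integral_Ioo_eq_interval ht.1]
    congr 1
    congr 1
    ext s
    ring
  · have i1 := integrableOn_sqOm_slice H.θx_sq_int
    have i2 := integrableOn_sqOm_slice hG2
    have i3 := H.θ_cont.integrableOn_sqOm
    exact IntegrableOn.mono_set
      (((i1.add (hκ.add ((i3.const_mul _).add i1))).add (i2.add i1)).const_mul 2)
      (Ioo_subset_Ioo_right ht.2)
  · filter_upwards [ae_Ioo_of_le ht.2 H.isH1, ae_Ioo_of_le ht.2 (ae_slice_memL2 H.G_int hG2),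
      ae_Ioo_of_le ht.2 (ae_slice_integrable H.h_int), ae_Ioo_of_le ht.2 hh] with s h1 h2 h3 h4 N
    rw [hsplit s h1 N, abs_mul, abs_two]
    refine mul_le_mul_of_nonneg_left ?_ zero_le_two
    refine (abs_add_three _ _ _).trans (add_le_add (add_le_add ?_ ?_) ?_)
    · rw [abs_neg, abs_of_nonneg
        (Finset.sum_nonneg fun n _ => mul_nonneg (wgt_nonneg hab n) (sq_nonneg _))]
      exact hS.sum_sq_le h1.right N
    · refine (h1.abs_sum_le hab h3 N).trans ?_
      have e1 := supBd_le (a := a) (b := b) (fun x => θ x s) (fun x => θx x s)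
      have e2 := Real.sq_sqrt (supBd_nonneg hab (fun x => θ x s) (fun x => θx x s))
      have e3 : 0 ≤ ∫ x in Ioo a b, |h x s| := integral_nonneg fun _ => abs_nonneg _
      have e4 := Real.sqrt_nonneg (supBd a b (fun x => θ x s) (fun x => θx x s))
      nlinarith [mul_le_mul_of_nonneg_right h4 e4,
        sq_nonneg (κ s - √(supBd a b (fun x => θ x s) (fun x => θx x s)))]
    · exact hS.abs_sum_mul_le h2 h1.right N
  · filter_upwards [ae_Ioo_of_le ht.2 H.isH1, ae_Ioo_of_le ht.2 (ae_slice_memL2 H.G_int hG2),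
      ae_Ioo_of_le ht.2 (ae_slice_integrable H.h_int)] with s h1 h2 h3
    simp_rw [hsplit s h1]
    exact (((hS.parseval _ h1.right).tendsto_sum_nat.neg.add (h1.tendsto_sum hab h3)).add
      (hS.hasSum_mul h2 h1.right).tendsto_sum_nat).const_mul 2

end HeatSys

/-! ### Square integrability of the coupling terms -/

/-- Quantitative consequences of the hypothesis (F). -/
structure CouplingBound (f f' : ℝ → ℝ) (M : ℝ) : Prop where
  nonneg : 0 ≤ M
  le_mul : ∀ x, 0 ≤ x → |f x| ≤ M * x
  deriv_le : ∀ x, 0 ≤ x → |f' x| ≤ M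
  sub_le : ∀ x y, 0 ≤ x → 0 ≤ y → |f x - f y| ≤ M * |x - y|
  deriv_sub_le : ∀ x y, 0 ≤ x → 0 ≤ y → |f' x - f' y| ≤ M * |x - y|

theorem HypF.exists_couplingBound {f f' f'' : ℝ → ℝ} (hf : HypF f f' f'') :
    ∃ M, CouplingBound f f' M := by
  obtain ⟨M, hM⟩ := hf.bdd
  have h0 : (0 : ℝ) ∈ Ici (0 : ℝ) := self_mem_Ici
  have lip : ∀ x y, 0 ≤ x → 0 ≤ y → |f x - f y| ≤ M * |x - y| := fun x y hx hy =>
    (convex_Ici 0).norm_image_sub_le_of_norm_hasDerivWithin_le hf.hasDeriv₁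
      (fun z hz => (hM z hz).1) hy hx
  refine ⟨M, (abs_nonneg _).trans (hM 0 h0).1, fun x hx => ?_, fun x hx => (hM x hx).1, lip,
    fun x y hx hy => (convex_Ici 0).norm_image_sub_le_of_norm_hasDerivWithin_le hf.hasDeriv₂
      (fun z hz => (hM z hz).2) hy hx⟩
  have := lip x 0 hx le_rfl
  rwa [hf.zero, sub_zero, sub_zero, abs_of_nonneg hx] at this

/-- The mode-by-mode form of the thermoelastic system (P). -/
structure ThermoSys (a b T : ℝ) (f f' : ℝ → ℝ) (v0 y0 θ0 : ℝ → ℝ) (v y θ θx : ℝ → ℝ → ℝ) :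
    Prop where
  wave : WaveSys a b T v0 y0 v y (fun x t => f' (θ x t) * θx x t)
  heat : HeatSys a b T θ0 θ θx (fun x t => f' (θ x t) * θx x t * v x t)
    (fun x t => f (θ x t) * v x t)
  nonneg : ∀ᵐ p ∂volume.restrict (Ioo a b ×ˢ Ioo 0 T), 0 ≤ θ p.1 p.2

theorem IsWeakSol.thermoSys {a b T : ℝ} {f f' u0 u0x u0t Θ0 : ℝ → ℝ} {u ut ux Θ Θx : ℝ → ℝ → ℝ}
    (hab : a < b) (hT : 0 < T) (hsol : IsWeakSol a b T f f' u0 u0t Θ0 u ut ux Θ Θx)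
    (hdata : DataI a b u0 u0x u0t Θ0) (hreg : RegT a b T u ut ux Θ Θx) :
    ThermoSys a b T f f' u0t u0x Θ0 ut ux Θ Θx :=
  ⟨hsol.waveSys hab hT hdata hreg, hsol.heatSys hab hT hdata hreg, hsol.Θ_nonneg⟩

theorem ae_slice {a b T : ℝ} {p : ℝ → ℝ → Prop}
    (h : ∀ᵐ z ∂volume.restrict (Ioo a b ×ˢ Ioo 0 T), p z.1 z.2) :
    ∀ᵐ t ∂volume.restrict (Ioo 0 T), ∀ᵐ x ∂volume.restrict (Ioo a b), p x t := by
  rw [volume_restrict_cylinder] at h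
  exact Measure.ae_ae_of_ae_prod
    ((Measure.measurePreserving_swap (μ := volume.restrict (Ioo 0 T))
      (ν := volume.restrict (Ioo a b))).quasiMeasurePreserving.ae h)

/-- `∫ F ≤ ∫ |F| ≤ ∫ B` for a pointwise majorant `B`. -/
theorem integral_abs_le_of_ae_le {a b : ℝ} {F B : ℝ → ℝ} (hB : IntegrableOn B (Ioo a b))
    (h : ∀ᵐ x ∂volume.restrict (Ioo a b), |F x| ≤ B x) :
    ∫ x in Ioo a b, |F x| ≤ ∫ x in Ioo a b, B x :=
  integral_mono_of_nonneg (Eventually.of_forall fun _ => abs_nonneg _) hB h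

theorem MemL2.abs_mul_abs_integrable {a b : ℝ} {g h : ℝ → ℝ} (hg : MemL2 a b g)
    (hh : MemL2 a b h) : IntegrableOn (fun x => |g x| * |h x|) (Ioo a b) :=
  (hg.integrable_mul hh).abs.congr (Eventually.of_forall fun _ => abs_mul _ _)

namespace ThermoSys

variable {a b T M : ℝ} {f f' v0 y0 θ0 : ℝ → ℝ} {v y θ θx : ℝ → ℝ → ℝ}

theorem slice_memL2 (h : ThermoSys a b T f f' v0 y0 θ0 v y θ θx) :
    ∀ᵐ t ∂volume.restrict (Ioo 0 T), MemL2 a b (fun x => v x t) ∧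
      IsH1 a b (fun x => θ x t) (fun x => θx x t) ∧
      ∀ᵐ x ∂volume.restrict (Ioo a b), 0 ≤ θ x t := by
  filter_upwards [h.heat.isH1, ae_slice (p := fun x t => 0 ≤ θ x t) h.nonneg,
    ae_restrict_mem measurableSet_Ioo]
    with t h1 h2 h3
  exact ⟨h.wave.v_cont.1 t (Ioo_subset_Icc_self h3), h1, h2⟩

theorem g_sq_int (hM : CouplingBound f f' M) (h : ThermoSys a b T f f' v0 y0 θ0 v y θ θx) :
    IntegrableOn (fun p : ℝ × ℝ => (f' (θ p.1 p.2) * θx p.1 p.2) ^ 2) (Ioo a b ×ˢ Ioo 0 T) := by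
  refine Integrable.mono' (h.heat.θx_sq_int.const_mul (M ^ 2))
    (h.wave.g_int.aestronglyMeasurable.pow 2) ?_
  filter_upwards [h.nonneg] with p hp
  rw [Real.norm_of_nonneg (sq_nonneg _), mul_pow]
  exact mul_le_mul_of_nonneg_right (sq_le_sq' (abs_le.1 (hM.deriv_le _ hp)).1
    (abs_le.1 (hM.deriv_le _ hp)).2) (sq_nonneg _)

theorem G_sq_int (hab : a < b) (hM : CouplingBound f f' M)
    (h : ThermoSys a b T f f' v0 y0 θ0 v y θ θx) :
    IntegrableOn (fun p : ℝ × ℝ => (f (θ p.1 p.2) * v p.1 p.2) ^ 2) (Ioo a b ×ˢ Ioo 0 T) := by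
  obtain ⟨K, hK0, hK⟩ := h.wave.v_cont.exists_bound
  have hmeas : AEStronglyMeasurable (fun p : ℝ × ℝ => (f (θ p.1 p.2) * v p.1 p.2) ^ 2)
      (volume.restrict (Ioo a b ×ˢ Ioo 0 T)) := h.heat.G_int.aestronglyMeasurable.pow 2
  have key : ∀ᵐ t ∂volume.restrict (Ioo 0 T),
      IntegrableOn (fun x => (f (θ x t) * v x t) ^ 2) (Ioo a b) ∧
      ∫ x in Ioo a b, (f (θ x t) * v x t) ^ 2 ≤ M ^ 2 * K *
        ((1 / (b - a) + 1) * sqOm a b (fun x => θ x t) + sqOm a b (fun x => θx x t)) := by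
    filter_upwards [h.slice_memL2, 
      ae_slice_integrable (F := fun x t => f (θ x t) * v x t) h.heat.G_int,
      ae_restrict_mem measurableSet_Ioo] with t ⟨h1, h2, h3⟩ h4 h5
    have hle : ∀ᵐ x ∂volume.restrict (Ioo a b), (f (θ x t) * v x t) ^ 2 ≤
        M ^ 2 * supBd a b (fun x => θ x t) (fun x => θx x t) * v x t ^ 2 := by
      filter_upwards [h3, h2.ae_abs_le hab] with x hx hx2
      rw [mul_pow]
      refine mul_le_mul_of_nonneg_right ?_ (sq_nonneg _)
      rw [← Real.sq_sqrt (supBd_nonneg hab _ _), ← mul_pow, ← sq_abs]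
      refine pow_le_pow_left₀ (abs_nonneg _) ?_ 2
      refine (hM.le_mul _ hx).trans (mul_le_mul_of_nonneg_left ?_ hM.nonneg)
      exact (le_abs_self _).trans hx2
    have hInt := h1.2.const_mul (M ^ 2 * supBd a b (fun x => θ x t) (fun x => θx x t))
    have hi : IntegrableOn (fun x => (f (θ x t) * v x t) ^ 2) (Ioo a b) := by
      refine Integrable.mono' hInt (h4.aestronglyMeasurable.pow 2) ?_
      filter_upwards [hle] with x hx
      rwa [Real.norm_of_nonneg (sq_nonneg _)]
    refine ⟨hi, (integral_mono_ae hi hInt hle).trans ?_⟩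
    rw [integral_const_mul, mul_assoc, mul_assoc]
    refine mul_le_mul_of_nonneg_left ?_ (sq_nonneg _)
    rw [mul_comm]
    exact mul_le_mul (hK t (Ioo_subset_Icc_self h5)) (supBd_le _ _) (supBd_nonneg hab _ _) hK0
  rw [volume_restrict_cylinder] at hmeas
  rw [IntegrableOn, volume_restrict_cylinder]
  rw [integrable_prod_iff' hmeas]
  refine ⟨key.mono fun t ht => ht.1, ?_⟩
  refine Integrable.mono' (((h.heat.θ_cont.integrableOn_sqOm.const_mul (1 / (b - a) + 1)).add
    (integrableOn_sqOm_slice h.heat.θx_sq_int)).const_mul (M ^ 2 * K))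
    hmeas.norm.prod_swap.integral_prod_right' ?_
  filter_upwards [key] with t ht
  have e : ∀ x, ‖(f (θ x t) * v x t) ^ 2‖ = (f (θ x t) * v x t) ^ 2 := fun x =>
    Real.norm_of_nonneg (sq_nonneg _)
  simp only [e]
  rw [Real.norm_of_nonneg (integral_nonneg fun _ => sq_nonneg _)]
  exact ht.2

theorem h_bound (hM : CouplingBound f f' M) (h : ThermoSys a b T f f' v0 y0 θ0 v y θ θx) :
    ∃ c, 0 ≤ c ∧ ∀ᵐ t ∂volume.restrict (Ioo 0 T),
      (∫ x in Ioo a b, |f' (θ x t) * θx x t * v x t|) ^ 2 ≤ c * sqOm a b (fun x => θx x t) := by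
  obtain ⟨K, hK0, hK⟩ := h.wave.v_cont.exists_bound
  refine ⟨M ^ 2 * K, mul_nonneg (sq_nonneg _) hK0, ?_⟩
  filter_upwards [h.slice_memL2, ae_restrict_mem measurableSet_Ioo] with t ⟨h1, h2, h3⟩ h5
  have e1 : ∫ x in Ioo a b, |f' (θ x t) * θx x t * v x t| ≤
      ∫ x in Ioo a b, M * (|θx x t| * |v x t|) := by
    refine integral_abs_le_of_ae_le ((h2.right.abs_mul_abs_integrable h1).const_mul M) ?_
    filter_upwards [h3] with x hx
    rw [abs_mul, abs_mul, mul_assoc]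
    exact mul_le_mul_of_nonneg_right (hM.deriv_le _ hx)
      (mul_nonneg (abs_nonneg _) (abs_nonneg _))
  rw [integral_const_mul] at e1
  have e2 := e1.trans (mul_le_mul_of_nonneg_left (integral_abs_mul_le h2.right h1) hM.nonneg)
  refine (pow_le_pow_left₀ (integral_nonneg fun _ => abs_nonneg _) e2 2).trans ?_
  rw [mul_pow, mul_pow, Real.sq_sqrt (sqOm_nonneg _ _ _), Real.sq_sqrt (sqOm_nonneg _ _ _),
    mul_assoc]
  refine mul_le_mul_of_nonneg_left ?_ (sq_nonneg _)
  rw [mul_comm]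
  exact mul_le_mul_of_nonneg_right (hK t (Ioo_subset_Icc_self h5)) (sqOm_nonneg _ _ _)

end ThermoSys

/-! ### Estimates for the coupling terms on a time slice -/

theorem energy_gronwall {T : ℝ} (hT : 0 < T) {y ρ z m : ℝ → ℝ} {y0 C : ℝ}
    (hyc : ContinuousOn y (Icc 0 T)) (hy : ∀ t ∈ Icc 0 T, 0 ≤ y t) (hy0 : 0 ≤ y0)
    (hz : IntegrableOn z (Ioo 0 T)) (hz0 : ∀ t, 0 ≤ z t)
    (hm : IntegrableOn m (Ioo 0 T)) (hm0 : ∀ t, 0 ≤ m t) (hC : ∫ t in Ioo 0 T, m t ≤ C)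
    (hE : ∀ t ∈ Icc 0 T, IntegrableOn ρ (Ioo 0 t) ∧ y t = y0 + ∫ s in Ioo 0 t, ρ s)
    (hρ : ∀ᵐ s ∂volume.restrict (Ioo 0 T), ρ s ≤ -z s + m s * y s) :
    (∀ t ∈ Ioo 0 T, y t ≤ y0 * Real.exp C) ∧
      ∫ t in Ioo 0 T, z t ≤ y0 * (1 + C * Real.exp C) := by
  have hmi := intervalIntegrable_of_Ioo hT.le hm
  have hmyi : IntervalIntegrable (fun s => m s * y s) volume 0 T :=
    hmi.mul_continuousOn (by rwa [uIcc_of_le hT.le])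
  have hmy : IntegrableOn (fun s => m s * y s) (Ioo 0 T) :=
    (intervalIntegrable_iff_integrableOn_Ioo_of_le hT.le).1 hmyi
  have key : ∀ t ∈ Icc 0 T,
      y t + ∫ s in Ioo 0 t, z s ≤ y0 + ∫ s in Ioo 0 t, m s * y s := by
    intro t ht
    have hsub : Ioo 0 t ⊆ Ioo 0 T := Ioo_subset_Ioo_right ht.2
    rw [(hE t ht).2]
    have hzn : IntegrableOn (fun s => -z s) (Ioo 0 t) := (hz.mono_set hsub).neg
    have h1 : ∫ s in Ioo 0 t, ρ s ≤ ∫ s in Ioo 0 t, (-z s + m s * y s) :=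
      integral_mono_ae (hE t ht).1 (hzn.add (hmy.mono_set hsub)) (ae_Ioo_of_le ht.2 hρ)
    rw [integral_add hzn (hmy.mono_set hsub), integral_neg] at h1
    linarith
  obtain ⟨K, hK⟩ := isCompact_Icc.exists_bound_of_continuousOn hyc
  have hexp : ∀ t ∈ Ioo 0 T, y t ≤ y0 * Real.exp C := by
    intro t ht
    refine (gronwall_integral hT.le hmi (Eventually.of_forall hm0) hmyi hy0 (K := K)
      (fun s hs => (le_abs_self _).trans (hK s (Ioo_subset_Icc_self hs))) (fun s hs => ?_) t
      ht).trans ?_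
    · have h1 := key s (Ioo_subset_Icc_self hs)
      have h2 : 0 ≤ ∫ τ in Ioo 0 s, z τ := integral_nonneg fun τ => hz0 τ
      rw [← integral_Ioo_eq_interval hs.1.le]
      linarith
    · rw [← integral_Ioo_eq_interval hT.le]
      exact mul_le_mul_of_nonneg_left (Real.exp_le_exp.2 hC) hy0
  refine ⟨hexp, ?_⟩
  have h1 := key T ⟨hT.le, le_rfl⟩
  have h2 := hy T ⟨hT.le, le_rfl⟩
  have h3 : ∫ s in Ioo 0 T, m s * y s ≤ ∫ s in Ioo 0 T, m s * (y0 * Real.exp C) := by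
    refine integral_mono_ae hmy (hm.mul_const _) ?_
    filter_upwards [ae_restrict_mem measurableSet_Ioo] with s hs
    exact mul_le_mul_of_nonneg_left (hexp s hs) (hm0 s)
  rw [integral_mul_const] at h3
  have h4 := mul_le_mul_of_nonneg_right hC (mul_nonneg hy0 (Real.exp_nonneg C))
  linarith

theorem abs_integral_le_of_ae_le {a b : ℝ} {F B : ℝ → ℝ} (hB : IntegrableOn B (Ioo a b))
    (h : ∀ᵐ x ∂volume.restrict (Ioo a b), |F x| ≤ B x) :
    |∫ x in Ioo a b, F x| ≤ ∫ x in Ioo a b, B x :=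
  (abs_integral_le_integral_abs).trans (integral_abs_le_of_ae_le hB h)

theorem sq_sqrt_supBd {a b : ℝ} (hab : a < b) (g g' : ℝ → ℝ) :
    √(supBd a b g g') ^ 2 = 1 / (b - a) * √(sqOm a b g) ^ 2 +
      2 * (√(sqOm a b g) * √(sqOm a b g')) := by
  rw [Real.sq_sqrt (supBd_nonneg hab g g'), Real.sq_sqrt (sqOm_nonneg a b g), supBd]

namespace CouplingBound

variable {a b M : ℝ} {f f' v θ θx v' θ' θx' : ℝ → ℝ}

theorem heat_source_le (hM : CouplingBound f f' M) (hab : a < b) (hv : MemL2 a b v)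
    (hθ : IsH1 a b θ θx) (h0 : ∀ᵐ x ∂volume.restrict (Ioo a b), 0 ≤ θ x) :
    (∫ x in Ioo a b, f' (θ x) * θx x * v x * θ x) ≤
      M * √(supBd a b θ θx) * (√(sqOm a b θx) * √(sqOm a b v)) := by
  refine (le_abs_self _).trans ((abs_integral_le_of_ae_le
    (B := fun x => M * √(supBd a b θ θx) * (|θx x| * |v x|))
    ((hθ.right.abs_mul_abs_integrable hv).const_mul _) ?_).trans ?_)
  · filter_upwards [h0, hθ.ae_abs_le hab] with x h1 h2
    have h3 := mul_le_mul (hM.deriv_le _ h1) h2 (abs_nonneg _) hM.nonneg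
    have h4 := mul_le_mul_of_nonneg_right h3 (mul_nonneg (abs_nonneg (θx x)) (abs_nonneg (v x)))
    rw [abs_mul, abs_mul, abs_mul]
    linarith
  · rw [integral_const_mul]
    exact mul_le_mul_of_nonneg_left (integral_abs_mul_le hθ.right hv)
      (mul_nonneg hM.nonneg (Real.sqrt_nonneg _))

theorem heat_flux_le (hM : CouplingBound f f' M) (hab : a < b) (hv : MemL2 a b v)
    (hθ : IsH1 a b θ θx) (h0 : ∀ᵐ x ∂volume.restrict (Ioo a b), 0 ≤ θ x) :
    (∫ x in Ioo a b, f (θ x) * v x * θx x) ≤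
      M * √(supBd a b θ θx) * (√(sqOm a b θx) * √(sqOm a b v)) := by
  refine (le_abs_self _).trans ((abs_integral_le_of_ae_le
    (B := fun x => M * √(supBd a b θ θx) * (|θx x| * |v x|))
    ((hθ.right.abs_mul_abs_integrable hv).const_mul _) ?_).trans ?_)
  · filter_upwards [h0, hθ.ae_abs_le hab] with x h1 h2
    have h3 := (hM.le_mul _ h1).trans
      (mul_le_mul_of_nonneg_left ((le_abs_self _).trans h2) hM.nonneg)
    have h4 := mul_le_mul_of_nonneg_right h3 (mul_nonneg (abs_nonneg (θx x)) (abs_nonneg (v x)))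
    rw [abs_mul, abs_mul]
    linarith
  · rw [integral_const_mul]
    exact mul_le_mul_of_nonneg_left (integral_abs_mul_le hθ.right hv)
      (mul_nonneg hM.nonneg (Real.sqrt_nonneg _))

theorem abs_deriv_mul_sub_le (hM : CouplingBound f f' M) {s s' p p' : ℝ} (hs : 0 ≤ s)
    (hs' : 0 ≤ s') : |f' s * p - f' s' * p'| ≤ M * |p - p'| + M * |s - s'| * |p'| := by
  have e : f' s * p - f' s' * p' = f' s * (p - p') + (f' s - f' s') * p' := by ring
  rw [e]
  refine (abs_add_le _ _).trans (add_le_add ?_ ?_) <;> rw [abs_mul]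
  · exact mul_le_mul_of_nonneg_right (hM.deriv_le _ hs) (abs_nonneg _)
  · exact mul_le_mul_of_nonneg_right (hM.deriv_sub_le _ _ hs hs') (abs_nonneg _)

theorem abs_source_sub_le (hM : CouplingBound f f' M) {s s' p p' q q' : ℝ} (hs : 0 ≤ s)
    (hs' : 0 ≤ s') : |f' s * p * q - f' s' * p' * q'| ≤
      M * (|p| * |q - q'|) + M * (|p - p'| * |q'|) + M * |s - s'| * (|p'| * |q'|) := by
  have e : f' s * p * q - f' s' * p' * q' =
    f' s * p * (q - q') + (f' s * p - f' s' * p') * q' := by ring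
  rw [e]
  refine (abs_add_le _ _).trans ?_
  rw [abs_mul, abs_mul, abs_mul]
  have h1 := mul_le_mul_of_nonneg_right (hM.deriv_le _ hs)
    (mul_nonneg (abs_nonneg p) (abs_nonneg (q - q')))
  have h2 := mul_le_mul_of_nonneg_right (hM.abs_deriv_mul_sub_le (p := p) (p' := p') hs hs')
    (abs_nonneg q')
  linarith

theorem abs_flux_sub_le (hM : CouplingBound f f' M) {s s' q q' : ℝ} (hs : 0 ≤ s)
    (hs' : 0 ≤ s') : |f s * q - f s' * q'| ≤ M * s * |q - q'| + M * |s - s'| * |q'| := by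
  have e : f s * q - f s' * q' = f s * (q - q') + (f s - f s') * q' := by ring
  rw [e]
  refine (abs_add_le _ _).trans (add_le_add ?_ ?_) <;> rw [abs_mul]
  · exact mul_le_mul_of_nonneg_right (hM.le_mul _ hs) (abs_nonneg _)
  · exact mul_le_mul_of_nonneg_right (hM.sub_le _ _ hs hs') (abs_nonneg _)

theorem wave_source_sub_le (hM : CouplingBound f f' M) (hab : a < b) (hv : MemL2 a b v)
    (hv' : MemL2 a b v') (hθ : IsH1 a b θ θx) (hθ' : IsH1 a b θ' θx')
    (h0 : ∀ᵐ x ∂volume.restrict (Ioo a b), 0 ≤ θ x)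
    (h0' : ∀ᵐ x ∂volume.restrict (Ioo a b), 0 ≤ θ' x) :
    |∫ x in Ioo a b, (f' (θ x) * θx x - f' (θ' x) * θx' x) * (v x - v' x)| ≤
      M * (√(sqOm a b (fun x => θx x - θx' x)) * √(sqOm a b (fun x => v x - v' x))) +
      M * √(supBd a b (fun x => θ x - θ' x) (fun x => θx x - θx' x)) *
        (√(sqOm a b θx') * √(sqOm a b (fun x => v x - v' x))) := by
  set S := √(supBd a b (fun x => θ x - θ' x) (fun x => θx x - θx' x)) with hS
  have hw := hv.sub hv'
  have hd := hθ.sub hθ'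
  have i1 := (hd.right.abs_mul_abs_integrable hw).const_mul M
  have i2 := (hθ'.right.abs_mul_abs_integrable hw).const_mul (M * S)
  refine (abs_integral_le_of_ae_le (i1.add i2) ?_).trans ?_
  · filter_upwards [h0, h0', hd.ae_abs_le hab] with x h1 h2 h3
    have h4 := mul_le_mul_of_nonneg_right (hM.abs_deriv_mul_sub_le (p := θx x) (p' := θx' x) h1 h2)
      (abs_nonneg (v x - v' x))
    have h5 := mul_le_mul_of_nonneg_right (mul_le_mul_of_nonneg_left h3 hM.nonneg)
      (mul_nonneg (abs_nonneg (θx' x)) (abs_nonneg (v x - v' x)))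
    rw [abs_mul]
    simp only [Pi.add_apply]
    linarith
  · rw [integral_add' i1 i2, integral_const_mul, integral_const_mul]
    exact add_le_add (mul_le_mul_of_nonneg_left (integral_abs_mul_le hd.right hw) hM.nonneg)
      (mul_le_mul_of_nonneg_left (integral_abs_mul_le hθ'.right hw)
        (mul_nonneg hM.nonneg (Real.sqrt_nonneg _)))

theorem heat_source_sub_le (hM : CouplingBound f f' M) (hab : a < b) (hv : MemL2 a b v)
    (hv' : MemL2 a b v') (hθ : IsH1 a b θ θx) (hθ' : IsH1 a b θ' θx')
    (h0 : ∀ᵐ x ∂volume.restrict (Ioo a b), 0 ≤ θ x)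
    (h0' : ∀ᵐ x ∂volume.restrict (Ioo a b), 0 ≤ θ' x) {S : ℝ}
    (hS : S = √(supBd a b (fun x => θ x - θ' x) (fun x => θx x - θx' x))) :
    |∫ x in Ioo a b, (f' (θ x) * θx x * v x - f' (θ' x) * θx' x * v' x) * (θ x - θ' x)| ≤
      M * S * (√(sqOm a b θx) * √(sqOm a b (fun x => v x - v' x))) +
      M * S * (√(sqOm a b (fun x => θx x - θx' x)) * √(sqOm a b v')) +
      M * S ^ 2 * (√(sqOm a b θx') * √(sqOm a b v')) := by
  have hS0 : 0 ≤ S := hS ▸ Real.sqrt_nonneg _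
  have hw := hv.sub hv'
  have hd := hθ.sub hθ'
  have i1 := (hθ.right.abs_mul_abs_integrable hw).const_mul (M * S)
  have i2 := (hd.right.abs_mul_abs_integrable hv').const_mul (M * S)
  have i3 := (hθ'.right.abs_mul_abs_integrable hv').const_mul (M * S ^ 2)
  refine (abs_integral_le_of_ae_le ((i1.add i2).add i3) ?_).trans ?_
  · filter_upwards [h0, h0', hd.ae_abs_le hab] with x h1 h2 h3
    rw [← hS] at h3
    have h4 := mul_le_mul (hM.abs_source_sub_le (p := θx x) (p' := θx' x) (q := v x) (q' := v' x)
      h1 h2) h3 (abs_nonneg _) ((abs_nonneg _).trans (hM.abs_source_sub_le h1 h2))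
    have h5 := mul_le_mul_of_nonneg_right (mul_le_mul_of_nonneg_left h3
      (mul_nonneg hM.nonneg hS0)) (mul_nonneg (abs_nonneg (θx' x)) (abs_nonneg (v' x)))
    rw [abs_mul]
    simp only [Pi.add_apply]
    linarith
  · rw [integral_add' (i1.add i2) i3, integral_add' i1 i2, integral_const_mul, integral_const_mul,
      integral_const_mul]
    exact add_le_add (add_le_add
      (mul_le_mul_of_nonneg_left (integral_abs_mul_le hθ.right hw) (mul_nonneg hM.nonneg hS0))
      (mul_le_mul_of_nonneg_left (integral_abs_mul_le hd.right hv') (mul_nonneg hM.nonneg hS0)))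
      (mul_le_mul_of_nonneg_left (integral_abs_mul_le hθ'.right hv')
        (mul_nonneg hM.nonneg (sq_nonneg S)))

theorem heat_flux_sub_le (hM : CouplingBound f f' M) (hab : a < b) (hv : MemL2 a b v)
    (hv' : MemL2 a b v') (hθ : IsH1 a b θ θx) (hθ' : IsH1 a b θ' θx')
    (h0 : ∀ᵐ x ∂volume.restrict (Ioo a b), 0 ≤ θ x)
    (h0' : ∀ᵐ x ∂volume.restrict (Ioo a b), 0 ≤ θ' x) :
    |∫ x in Ioo a b, (f (θ x) * v x - f (θ' x) * v' x) * (θx x - θx' x)| ≤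
      M * √(supBd a b θ θx) *
        (√(sqOm a b (fun x => v x - v' x)) * √(sqOm a b (fun x => θx x - θx' x))) +
      M * √(supBd a b (fun x => θ x - θ' x) (fun x => θx x - θx' x)) *
        (√(sqOm a b v') * √(sqOm a b (fun x => θx x - θx' x))) := by
  set S := √(supBd a b (fun x => θ x - θ' x) (fun x => θx x - θx' x)) with hS
  set R := √(supBd a b θ θx) with hR
  have hw := hv.sub hv'
  have hd := hθ.sub hθ'
  have i1 := (hw.abs_mul_abs_integrable hd.right).const_mul (M * R)
  have i2 := (hv'.abs_mul_abs_integrable hd.right).const_mul (M * S)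
  refine (abs_integral_le_of_ae_le (i1.add i2) ?_).trans ?_
  · filter_upwards [h0, h0', hd.ae_abs_le hab, hθ.ae_abs_le hab] with x h1 h2 h3 h6
    have h4 := mul_le_mul_of_nonneg_right (hM.abs_flux_sub_le (q := v x) (q' := v' x) h1 h2)
      (abs_nonneg (θx x - θx' x))
    have h5 := mul_le_mul_of_nonneg_right (mul_le_mul_of_nonneg_left h3 hM.nonneg)
      (mul_nonneg (abs_nonneg (v' x)) (abs_nonneg (θx x - θx' x)))
    have h7 := mul_le_mul_of_nonneg_right (mul_le_mul_of_nonneg_left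
      ((le_abs_self _).trans h6) hM.nonneg)
      (mul_nonneg (abs_nonneg (v x - v' x)) (abs_nonneg (θx x - θx' x)))
    rw [abs_mul]
    simp only [Pi.add_apply]
    linarith
  · rw [integral_add' i1 i2, integral_const_mul, integral_const_mul]
    exact add_le_add (mul_le_mul_of_nonneg_left (integral_abs_mul_le hw hd.right)
        (mul_nonneg hM.nonneg (Real.sqrt_nonneg _)))
      (mul_le_mul_of_nonneg_left (integral_abs_mul_le hv' hd.right)
        (mul_nonneg hM.nonneg (Real.sqrt_nonneg _)))

end CouplingBound

/-! ### A priori bounds and stability -/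

theorem single_absorption {M U l S r P q : ℝ} (hM : 0 ≤ M) (hS : 0 ≤ S) (hP : 0 ≤ P)
    (hSe : S ^ 2 = l * r ^ 2 + 2 * (r * P)) (hq : q ≤ U) :
    2 * (-P ^ 2 + M * S * (P * q) + M * S * (P * q)) ≤
      -P ^ 2 + (8 * (M * U) ^ 2 * l + 128 * (M * U) ^ 4) * r ^ 2 := by
  have h1 : M * S * (P * q) ≤ M * S * (P * U) := by gcongr
  have h2 := sq_nonneg (P - 4 * (M * U) * S)
  have h3 := sq_nonneg (P - 16 * (M * U) ^ 2 * r)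
  have h4 : (M * U) ^ 2 * S ^ 2 = (M * U) ^ 2 * (l * r ^ 2 + 2 * (r * P)) := by rw [hSe]
  linarith

theorem difference_absorption {M R l S Z p q r s P P' V : ℝ} (hM : 0 ≤ M) (hR : 0 ≤ R)
    (hl : 0 ≤ l) (hS : 0 ≤ S) (hp : 0 ≤ p) (hP' : 0 ≤ P') (hs : 0 ≤ s)
    (hSe : S ^ 2 = l * r ^ 2 + 2 * (r * p))
    (hZe : Z ^ 2 = l * s ^ 2 + 2 * (s * P)) (hV : V ≤ R) (hsR : s ≤ R) :
    2 * (M * (p * q) + M * S * (P' * q)) +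
      2 * (-p ^ 2 + (M * S * (P * q) + M * S * (p * V) + M * S ^ 2 * (P' * V)) +
        (M * Z * (q * p) + M * S * (V * p))) ≤
      -p ^ 2 + (9 * M ^ 2 + 8 * M ^ 2 * ((l + 1) * R ^ 2 + 1) + 2 * (l + 8) +
        32 * (M * R) ^ 2 * l + 8192 * (M * R) ^ 4 + M * R * l + 32 * (M * R) ^ 2) *
        (1 + P ^ 2 + P' ^ 2) * (q ^ 2 + r ^ 2) := by
  have e1 : M * S * (p * V) ≤ M * S * (p * R) := by gcongr
  have e2 : M * S ^ 2 * (P' * V) ≤ M * S ^ 2 * (P' * R) := by gcongr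
  have hs2 : s ^ 2 ≤ R ^ 2 := by gcongr
  have hZ : Z ^ 2 ≤ (l + 1) * R ^ 2 + P ^ 2 := by
    have := mul_le_mul_of_nonneg_left hs2 hl
    nlinarith [sq_nonneg (s - P)]
  have hS2 : S ^ 2 ≤ (l + 8) * r ^ 2 + 1 / 8 * p ^ 2 := by
    nlinarith [sq_nonneg (p - 8 * r)]
  have t1 : 2 * (M * (p * q)) ≤ 1 / 8 * p ^ 2 + 8 * M ^ 2 * q ^ 2 := by
    nlinarith [sq_nonneg (p - 8 * (M * q))]
  have t2 : 2 * (M * S * (P' * q)) ≤ S ^ 2 + M ^ 2 * P' ^ 2 * q ^ 2 := by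
    nlinarith [sq_nonneg (S - M * P' * q)]
  have t3 : 2 * (M * S * (P * q)) ≤ S ^ 2 + M ^ 2 * P ^ 2 * q ^ 2 := by
    nlinarith [sq_nonneg (S - M * P * q)]
  have t4 : 4 * (M * S * (p * R)) ≤ 1 / 4 * p ^ 2 +
      (32 * (M * R) ^ 2 * l + 8192 * (M * R) ^ 4) * r ^ 2 := by
    have h2 := sq_nonneg (p - 16 * (M * R) * S)
    have h3 := sq_nonneg (p - 256 * (M * R) ^ 2 * r)
    have h4 : (M * R) ^ 2 * S ^ 2 = (M * R) ^ 2 * (l * r ^ 2 + 2 * (r * p)) := by rw [hSe]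
    linarith
  have t5 : 2 * (M * S ^ 2 * (P' * R)) ≤ 1 / 8 * p ^ 2 +
      (M * R * l * (1 + P' ^ 2) + 32 * (M * R) ^ 2 * P' ^ 2) * r ^ 2 := by
    rw [hSe]
    have h2 := sq_nonneg (p - 16 * (M * R) * P' * r)
    have h3 := mul_nonneg (mul_nonneg (mul_nonneg (mul_nonneg hM hR) hl) (sq_nonneg (1 - P')))
      (sq_nonneg r)
    linarith
  have t6 : 2 * (M * Z * (q * p)) ≤ 1 / 8 * p ^ 2 + 8 * M ^ 2 * ((l + 1) * R ^ 2 + P ^ 2) * q ^ 2 := by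
    have h2 := sq_nonneg (p - 8 * (M * Z * q))
    have h3 := mul_le_mul_of_nonneg_left hZ (mul_nonneg (sq_nonneg M) (sq_nonneg q))
    linarith
  have hRl : 0 ≤ (l + 1) * R ^ 2 := by positivity
  have hm : 0 ≤ M * R * l := by positivity
  have c1 : 8 * M ^ 2 + M ^ 2 * P' ^ 2 + M ^ 2 * P ^ 2 + 8 * M ^ 2 * ((l + 1) * R ^ 2 + P ^ 2) ≤
      (9 * M ^ 2 + 8 * M ^ 2 * ((l + 1) * R ^ 2 + 1)) * (1 + P ^ 2 + P' ^ 2) := by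
    have : 0 ≤ M ^ 2 * (9 + 8 * P ^ 2 + 16 * P' ^ 2 + 8 * ((l + 1) * R ^ 2) * (P ^ 2 + P' ^ 2)) := by
      positivity
    linarith
  have c2 : 2 * (l + 8) + (32 * (M * R) ^ 2 * l + 8192 * (M * R) ^ 4) +
      (M * R * l * (1 + P' ^ 2) + 32 * (M * R) ^ 2 * P' ^ 2) ≤
      (2 * (l + 8) + 32 * (M * R) ^ 2 * l + 8192 * (M * R) ^ 4 + M * R * l + 32 * (M * R) ^ 2) *
        (1 + P ^ 2 + P' ^ 2) := by
    have : 0 ≤ (2 * (l + 8) + 32 * (M * R) ^ 2 * l + 8192 * (M * R) ^ 4) * (P ^ 2 + P' ^ 2) +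
        M * R * l * P ^ 2 + 32 * (M * R) ^ 2 * (1 + P ^ 2) := by positivity
    linarith
  have d1 := mul_le_mul_of_nonneg_right c1 (sq_nonneg q)
  have d2 := mul_le_mul_of_nonneg_right c2 (sq_nonneg r)
  have d3 : 0 ≤ (9 * M ^ 2 + 8 * M ^ 2 * ((l + 1) * R ^ 2 + 1)) * (1 + P ^ 2 + P' ^ 2) * r ^ 2 := by
    positivity
  have d4 : 0 ≤ (2 * (l + 8) + 32 * (M * R) ^ 2 * l + 8192 * (M * R) ^ 4 + M * R * l +
      32 * (M * R) ^ 2) * (1 + P ^ 2 + P' ^ 2) * q ^ 2 := by positivity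
  linarith [sq_nonneg p]

namespace ThermoSys

variable {a b T M : ℝ} {f f' v0 y0 θ0 v0' y0' θ0' : ℝ → ℝ} {v y θ θx v' y' θ' θx' : ℝ → ℝ → ℝ}

theorem velocity_le (hab : a < b) (hT : 0 < T) (hM : CouplingBound f f' M)
    (h : ThermoSys a b T f f' v0 y0 θ0 v y θ θx) :
    ∀ᵐ t ∂volume.restrict (Ioo 0 T), sqOm a b (fun x => v x t) ≤
      sqOm a b v0 + sqOm a b y0 + (b - a + sqOm a b θ0) := by
  have hcoef : ∀ g : ℝ → ℝ, coef a b (cosB a b) 0 g = ∫ x in Ioo a b, g x := by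
    intro g
    simp [coef, cosB, freq]
  have hfreq : freq a b 0 = 0 := by simp [freq]
  have h0 : 2 * ∫ x in Ioo a b, θ0 x ≤ b - a + sqOm a b θ0 := by
    have e1 : ∫ x in Ioo a b, (1 + θ0 x ^ 2) = b - a + sqOm a b θ0 := by
      rw [integral_add (integrable_const _) h.heat.θ0_mem.2, sqOm]
      simp [hab.le]
    rw [← e1, ← integral_const_mul]
    refine integral_mono (h.heat.θ0_mem.integrable.const_mul 2)
      ((integrable_const _).add h.heat.θ0_mem.2) fun x => ?_
    dsimp only
    nlinarith [sq_nonneg (1 - θ0 x)]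
  filter_upwards [h.slice_memL2, ae_restrict_mem measurableSet_Ioo] with t ⟨_, _, h3⟩ ht
  have ht' := Ioo_subset_Icc_self ht
  have e1 := (h.wave.energy hab hT (h.g_sq_int hM) t ht').2
  have e2 := h.heat.eq_θ 0 t ht'
  simp only [hcoef, hfreq, zero_mul, zero_add, sub_zero] at e2
  rw [← integral_Ioo_eq_interval ht.1.le] at e2
  rw [integral_const_mul] at e1
  have e3 : 0 ≤ ∫ x in Ioo a b, θ x t := integral_nonneg_of_ae h3
  have e4 := sqOm_nonneg a b (fun x => y x t)
  linarith

theorem exists_apriori (hab : a < b) (hT : 0 < T) (hM : CouplingBound f f' M) {D : ℝ}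
    (hD : 0 ≤ D) : ∃ R, 0 ≤ R ∧ ∀ (v0 y0 θ0 : ℝ → ℝ) (v y θ θx : ℝ → ℝ → ℝ),
      ThermoSys a b T f f' v0 y0 θ0 v y θ θx →
      sqOm a b v0 ≤ D → sqOm a b y0 ≤ D → sqOm a b θ0 ≤ D →
      (∀ᵐ t ∂volume.restrict (Ioo 0 T), √(sqOm a b (fun x => v x t)) ≤ R) ∧
      (∀ t ∈ Ioo 0 T, √(sqOm a b (fun x => θ x t)) ≤ R) ∧
      ∫ t in Ioo 0 T, sqOm a b (fun x => θx x t) ≤ R := by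
  have hL : 0 ≤ b - a := (sub_pos.2 hab).le
  set U := √(D + D + (b - a + D)) with hU
  set k := 8 * (M * U) ^ 2 * (1 / (b - a)) + 128 * (M * U) ^ 4 with hk
  have hk0 : 0 ≤ k := by positivity
  set E := D * Real.exp (k * T) with hE
  set F := D * (1 + k * T * Real.exp (k * T)) with hF
  have hE0 : 0 ≤ E := by positivity
  have hF0 : 0 ≤ F := by positivity
  have hU0 : 0 ≤ U := Real.sqrt_nonneg _
  refine ⟨U + √E + F, by positivity, fun v0 y0 θ0 v y θ θx h hv0 hy0 hθ0 => ?_⟩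
  have hvU : ∀ᵐ t ∂volume.restrict (Ioo 0 T), √(sqOm a b (fun x => v x t)) ≤ U := by
    filter_upwards [h.velocity_le hab hT hM] with t ht
    exact Real.sqrt_le_sqrt (by linarith)
  obtain ⟨c, hc0, hc⟩ := h.h_bound hM
  have hen := h.heat.energy hab hT (h.G_sq_int hab hM)
    (κ := fun t => √(c * sqOm a b (fun x => θx x t)))
    (((integrableOn_sqOm_slice h.heat.θx_sq_int).const_mul c).congr
      (Eventually.of_forall fun t => (Real.sq_sqrt (mul_nonneg hc0 (sqOm_nonneg _ _ _))).symm))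
    (hc.mono fun t ht => Real.le_sqrt_of_sq_le ht)
  obtain ⟨g1, g2⟩ := energy_gronwall hT (z := fun t => sqOm a b (fun x => θx x t))
    (m := fun _ => k) (C := k * T) h.heat.θ_cont.continuousOn_sqOm
    (fun t _ => sqOm_nonneg _ _ _) (sqOm_nonneg _ _ _)
    (integrableOn_sqOm_slice h.heat.θx_sq_int) (fun t => sqOm_nonneg _ _ _)
    (integrable_const k) (fun _ => hk0) (by simp [hT.le, mul_comm]) hen (by
      filter_upwards [h.slice_memL2, hvU] with t ⟨h1, h2, h3⟩ h4
      have e1 := hM.heat_source_le hab h1 h2 h3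
      have e2 := hM.heat_flux_le hab h1 h2 h3
      have e3 := single_absorption hM.nonneg (Real.sqrt_nonneg _) (Real.sqrt_nonneg _)
        (sq_sqrt_supBd hab (fun x => θ x t) (fun x => θx x t)) h4
      rw [Real.sq_sqrt (sqOm_nonneg _ _ _), Real.sq_sqrt (sqOm_nonneg _ _ _)] at e3
      linarith)
  refine ⟨hvU.mono fun t ht => by linarith [Real.sqrt_nonneg E], fun t ht => ?_, ?_⟩
  · have : √(sqOm a b (fun x => θ x t)) ≤ √E := Real.sqrt_le_sqrt
      ((g1 t ht).trans (mul_le_mul_of_nonneg_right hθ0 (Real.exp_nonneg _)))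
    linarith
  · have : sqOm a b θ0 * (1 + k * T * Real.exp (k * T)) ≤ F :=
      mul_le_mul_of_nonneg_right hθ0 (by positivity)
    linarith [Real.sqrt_nonneg E]

theorem exists_stability (hab : a < b) (hT : 0 < T) (hM : CouplingBound f f' M) {R : ℝ}
    (hR : 0 ≤ R) : ∃ C, 0 ≤ C ∧ ∀ (v0 y0 θ0 v0' y0' θ0' : ℝ → ℝ)
      (v y θ θx v' y' θ' θx' : ℝ → ℝ → ℝ),
      ThermoSys a b T f f' v0 y0 θ0 v y θ θx → ThermoSys a b T f f' v0' y0' θ0' v' y' θ' θx' →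
      (∀ᵐ t ∂volume.restrict (Ioo 0 T), √(sqOm a b (fun x => v' x t)) ≤ R) →
      (∀ t ∈ Ioo 0 T, √(sqOm a b (fun x => θ x t)) ≤ R) →
      ∫ t in Ioo 0 T, sqOm a b (fun x => θx x t) ≤ R →
      ∫ t in Ioo 0 T, sqOm a b (fun x => θx' x t) ≤ R →
      (∀ t ∈ Ioo 0 T, sqOm a b (fun x => v x t - v' x t) + sqOm a b (fun x => y x t - y' x t) +
        sqOm a b (fun x => θ x t - θ' x t) ≤ (sqOm a b (fun x => v0 x - v0' x) +
        sqOm a b (fun x => y0 x - y0' x) + sqOm a b (fun x => θ0 x - θ0' x)) * C) ∧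
      intOmT a b T (fun x t => (θx x t - θx' x t) ^ 2) ≤ (sqOm a b (fun x => v0 x - v0' x) +
        sqOm a b (fun x => y0 x - y0' x) + sqOm a b (fun x => θ0 x - θ0' x)) * C := by
  have hl : 0 ≤ 1 / (b - a) := one_div_nonneg.2 (sub_pos.2 hab).le
  have hM0 := hM.nonneg
  set k := 9 * M ^ 2 + 8 * M ^ 2 * ((1 / (b - a) + 1) * R ^ 2 + 1) + 2 * (1 / (b - a) + 8) +
    32 * (M * R) ^ 2 * (1 / (b - a)) + 8192 * (M * R) ^ 4 + M * R * (1 / (b - a)) +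
    32 * (M * R) ^ 2 with hk
  have hk0 : 0 ≤ k := by positivity
  set Q := k * (T + R + R) with hQ
  have hQ0 : 0 ≤ Q := by positivity
  refine ⟨Real.exp Q + (1 + Q * Real.exp Q), by positivity,
    fun v0 y0 θ0 v0' y0' θ0' v y θ θx v' y' θ' θx' h h' hv' hθ hθx hθx' => ?_⟩
  have hw := h.wave.sub h'.wave
  have hd := h.heat.sub h'.heat
  have hg2 : IntegrableOn (fun p : ℝ × ℝ => (f' (θ p.1 p.2) * θx p.1 p.2 -
      f' (θ' p.1 p.2) * θx' p.1 p.2) ^ 2) (Ioo a b ×ˢ Ioo 0 T) :=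
    (((memLp_two_iff_integrable_sq h.wave.g_int.aestronglyMeasurable).2 (h.g_sq_int hM)).sub
      ((memLp_two_iff_integrable_sq h'.wave.g_int.aestronglyMeasurable).2
        (h'.g_sq_int hM))).integrable_sq
  have hG2 : IntegrableOn (fun p : ℝ × ℝ => (f (θ p.1 p.2) * v p.1 p.2 -
      f (θ' p.1 p.2) * v' p.1 p.2) ^ 2) (Ioo a b ×ˢ Ioo 0 T) :=
    (((memLp_two_iff_integrable_sq h.heat.G_int.aestronglyMeasurable).2 (h.G_sq_int hab hM)).sub
      ((memLp_two_iff_integrable_sq h'.heat.G_int.aestronglyMeasurable).2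
        (h'.G_sq_int hab hM))).integrable_sq
  obtain ⟨c, hc0, hc⟩ := h.h_bound hM
  obtain ⟨c', hc0', hc'⟩ := h'.h_bound hM
  have hP := integrableOn_sqOm_slice h.heat.θx_sq_int
  have hP' := integrableOn_sqOm_slice h'.heat.θx_sq_int
  have hκ : IntegrableOn (fun t => √(2 * (c * sqOm a b (fun x => θx x t) +
      c' * sqOm a b (fun x => θx' x t))) ^ 2) (Ioo 0 T) := by
    refine (((hP.const_mul c).add (hP'.const_mul c')).const_mul 2).congr
      (Eventually.of_forall fun t => (Real.sq_sqrt ?_).symm)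
    exact mul_nonneg zero_le_two (add_nonneg (mul_nonneg hc0 (sqOm_nonneg _ _ _))
      (mul_nonneg hc0' (sqOm_nonneg _ _ _)))
  have hh : ∀ᵐ t ∂volume.restrict (Ioo 0 T), ∫ x in Ioo a b, |f' (θ x t) * θx x t * v x t -
      f' (θ' x t) * θx' x t * v' x t| ≤ √(2 * (c * sqOm a b (fun x => θx x t) +
      c' * sqOm a b (fun x => θx' x t))) := by
    filter_upwards [hc, hc',
      ae_slice_integrable (F := fun x t => f' (θ x t) * θx x t * v x t) h.heat.h_int,
      ae_slice_integrable (F := fun x t => f' (θ' x t) * θx' x t * v' x t) h'.heat.h_int]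
      with t h1 h2 h3 h4
    refine Real.le_sqrt_of_sq_le ?_
    have e1 := integral_abs_le_of_ae_le (h3.abs.add h4.abs)
      (F := fun x => f' (θ x t) * θx x t * v x t - f' (θ' x t) * θx' x t * v' x t)
      (Eventually.of_forall fun x => abs_sub _ _)
    rw [integral_add' h3.abs h4.abs] at e1
    refine (pow_le_pow_left₀ (integral_nonneg fun _ => abs_nonneg _) e1 2).trans ?_
    refine add_sq_le.trans ?_
    exact mul_le_mul_of_nonneg_left (add_le_add h1 h2) zero_le_two
  have ew := hw.energy hab hT hg2
  have ed := hd.energy hab hT hG2 hκ hh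
  have hz := integrableOn_sqOm_slice (F := fun x t => θx x t - θx' x t) hd.θx_sq_int
  have hm : IntegrableOn (fun t => k * (1 + sqOm a b (fun x => θx x t) +
      sqOm a b (fun x => θx' x t))) (Ioo 0 T) :=
    (((integrable_const 1).add hP).add hP').const_mul k
  have hmQ : ∫ t in Ioo 0 T, k * (1 + sqOm a b (fun x => θx x t) +
      sqOm a b (fun x => θx' x t)) ≤ Q := by
    have hP1 : IntegrableOn (fun t => 1 + sqOm a b (fun x => θx x t)) (Ioo 0 T) :=
      (integrable_const 1).add hP
    rw [integral_const_mul, integral_add hP1 hP', integral_add (integrable_const 1) hP]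
    refine mul_le_mul_of_nonneg_left (add_le_add (add_le_add ?_ hθx) hθx') hk0
    simp [hT.le]
  obtain ⟨g1, g2⟩ := energy_gronwall hT (z := fun t => sqOm a b (fun x => θx x t - θx' x t))
    (y := fun t => sqOm a b (fun x => v x t - v' x t) + sqOm a b (fun x => y x t - y' x t) +
        sqOm a b (fun x => θ x t - θ' x t))
    (y0 := sqOm a b (fun x => v0 x - v0' x) +
        sqOm a b (fun x => y0 x - y0' x) + sqOm a b (fun x => θ0 x - θ0' x))
    ((hw.v_cont.continuousOn_sqOm.add hw.y_cont.continuousOn_sqOm).add hd.θ_cont.continuousOn_sqOm)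
    (fun t _ => add_nonneg (add_nonneg (sqOm_nonneg _ _ _) (sqOm_nonneg _ _ _))
      (sqOm_nonneg _ _ _))
    (add_nonneg (add_nonneg (sqOm_nonneg _ _ _) (sqOm_nonneg _ _ _)) (sqOm_nonneg _ _ _))
    hz (fun t => sqOm_nonneg _ _ _) hm
    (fun t => mul_nonneg hk0 (add_nonneg (add_nonneg zero_le_one (sqOm_nonneg _ _ _))
      (sqOm_nonneg _ _ _))) hmQ
    (fun t ht => ⟨(ew t ht).1.add (ed t ht).1, by
      rw [(ew t ht).2, (ed t ht).2, integral_add' (ew t ht).1 (ed t ht).1]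
      ring⟩) (by
      filter_upwards [h.slice_memL2, h'.slice_memL2, hv', ae_restrict_mem measurableSet_Ioo]
        with t ⟨h1, h2, h3⟩ ⟨h1', h2', h3'⟩ h4 h5
      have e1 := (neg_le_abs _).trans (hM.wave_source_sub_le hab h1 h1' h2 h2' h3 h3')
      have e2 := (le_abs_self _).trans (hM.heat_source_sub_le hab h1 h1' h2 h2' h3 h3' rfl)
      have e3 := (le_abs_self _).trans (hM.heat_flux_sub_le hab h1 h1' h2 h2' h3 h3')
      have e4 := difference_absorption hM0 hR hl
        (q := √(sqOm a b (fun x => v x t - v' x t))) (P' := √(sqOm a b (fun x => θx' x t)))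
        (Real.sqrt_nonneg _) (Real.sqrt_nonneg _) (Real.sqrt_nonneg _) (Real.sqrt_nonneg _)
        (sq_sqrt_supBd hab (fun x => θ x t - θ' x t) (fun x => θx x t - θx' x t))
        (sq_sqrt_supBd hab (fun x => θ x t) (fun x => θx x t)) h4 (hθ t h5)
      rw [Real.sq_sqrt (sqOm_nonneg _ _ _), Real.sq_sqrt (sqOm_nonneg _ _ _),
        Real.sq_sqrt (sqOm_nonneg _ _ _), Real.sq_sqrt (sqOm_nonneg _ _ _),
        Real.sq_sqrt (sqOm_nonneg _ _ _), ← hk] at e4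
      have e5 : 0 ≤ k * (1 + sqOm a b (fun x => θx x t) + sqOm a b (fun x => θx' x t)) *
          sqOm a b (fun x => y x t - y' x t) :=
        mul_nonneg (mul_nonneg hk0 (add_nonneg (add_nonneg zero_le_one (sqOm_nonneg _ _ _))
          (sqOm_nonneg _ _ _))) (sqOm_nonneg _ _ _)
      simp only [Pi.add_apply]
      linarith)
  have hy0 := add_nonneg (add_nonneg (sqOm_nonneg a b (fun x => v0 x - v0' x))
    (sqOm_nonneg a b (fun x => y0 x - y0' x))) (sqOm_nonneg a b (fun x => θ0 x - θ0' x))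
  have he := Real.exp_nonneg Q
  refine ⟨fun t ht => (g1 t ht).trans (mul_le_mul_of_nonneg_left (by nlinarith) hy0), ?_⟩
  rw [intOmT_eq_integral_slice (F := fun x t => (θx x t - θx' x t) ^ 2) hd.θx_sq_int]
  exact g2.trans (mul_le_mul_of_nonneg_left (by linarith) hy0)

end ThermoSys

theorem sqOm_le_of_sub {a b : ℝ} {g h : ℝ → ℝ} (hg : MemL2 a b g) (hh : MemL2 a b h) :
    sqOm a b g ≤ 2 * sqOm a b h + 2 * sqOm a b (fun x => g x - h x) := by
  simpa using sqOm_add_le hh (hg.sub hh)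

/-- Lemma 3.7: Cauchy property of solutions from Cauchy sequences of data. -/
theorem statement9
    (a b : ℝ) (hab : a < b)
    (f f' f'' : ℝ → ℝ) (hf : HypF f f' f'')
    (T : ℝ) (hT : 0 < T)
    (u0 u0x u0t Θ0 : ℕ → ℝ → ℝ)
    (u ut ux Θ Θx : ℕ → ℝ → ℝ → ℝ)
    (hdata : ∀ k, DataI a b (u0 k) (u0x k) (u0t k) (Θ0 k))
    (hsol : ∀ k, IsWeakSol a b T f f' (u0 k) (u0t k) (Θ0 k)
      (u k) (ut k) (ux k) (Θ k) (Θx k))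
    (hreg : ∀ k, RegT a b T (u k) (ut k) (ux k) (Θ k) (Θx k))
    (hCu : ∀ η > (0 : ℝ), ∃ N : ℕ, ∀ k ≥ N, ∀ k' ≥ N,
      sqOm a b (fun x => u0 k x - u0 k' x) + sqOm a b (fun x => u0x k x - u0x k' x) ≤ η)
    (hCut : ∀ η > (0 : ℝ), ∃ N : ℕ, ∀ k ≥ N, ∀ k' ≥ N,
      sqOm a b (fun x => u0t k x - u0t k' x) ≤ η)
    (hCΘ : ∀ η > (0 : ℝ), ∃ N : ℕ, ∀ k ≥ N, ∀ k' ≥ N,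
      sqOm a b (fun x => Θ0 k x - Θ0 k' x) ≤ η) :
    ∀ η > (0 : ℝ), ∃ N : ℕ, ∀ k ≥ N, ∀ k', k < k' →
      (∀ t ∈ Ioo 0 T,
        sqOm a b (fun x => ut k x t - ut k' x t)
          + sqOm a b (fun x => ux k x t - ux k' x t)
          + sqOm a b (fun x => Θ k x t - Θ k' x t) ≤ η) ∧
      intOmT a b T (fun x t => (Θx k x t - Θx k' x t) ^ 2) ≤ η := by
  obtain ⟨M, hM⟩ := hf.exists_couplingBound
  have hsys := fun k => (hsol k).thermoSys hab hT (hdata k) (hreg k)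
  have huniv : ∀ η > (0 : ℝ), ∃ N : ℕ, ∀ k ≥ N, ∀ k' ≥ N,
      sqOm a b (fun x => u0t k x - u0t k' x) ≤ η ∧ sqOm a b (fun x => u0x k x - u0x k' x) ≤ η ∧
        sqOm a b (fun x => Θ0 k x - Θ0 k' x) ≤ η := by
    intro η hη
    obtain ⟨N₁, h₁⟩ := hCu η hη
    obtain ⟨N₂, h₂⟩ := hCut η hη
    obtain ⟨N₃, h₃⟩ := hCΘ η hη
    refine ⟨max N₁ (max N₂ N₃), fun k hk k' hk' => ?_⟩
    simp only [ge_iff_le, max_le_iff] at hk hk'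
    exact ⟨h₂ k hk.2.1 k' hk'.2.1, by
      linarith [h₁ k hk.1 k' hk'.1, sqOm_nonneg a b (fun x => u0 k x - u0 k' x)],
      h₃ k hk.2.2 k' hk'.2.2⟩
  obtain ⟨N₀, hN₀⟩ := huniv 1 one_pos
  have hn₁ := sqOm_nonneg a b (u0t N₀)
  have hn₂ := sqOm_nonneg a b (u0x N₀)
  have hn₃ := sqOm_nonneg a b (Θ0 N₀)
  obtain ⟨R, hR, hbd⟩ := ThermoSys.exists_apriori hab hT hM
    (D := 2 * (sqOm a b (u0t N₀) + sqOm a b (u0x N₀) + sqOm a b (Θ0 N₀)) + 2) (by positivity)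
  have hbd' := fun k (hk : k ≥ N₀) => by
    obtain ⟨h₁, h₂, h₃⟩ := hN₀ k hk N₀ le_rfl
    exact hbd _ _ _ _ _ _ _ (hsys k)
      (by linarith [sqOm_le_of_sub (hdata k).u0t_L2 (hdata N₀).u0t_L2])
      (by linarith [sqOm_le_of_sub (hdata k).u0x_L2 (hdata N₀).u0x_L2])
      (by linarith [sqOm_le_of_sub (hdata k).Θ0_L2 (hdata N₀).Θ0_L2])
  obtain ⟨C, hC, hstab⟩ := ThermoSys.exists_stability hab hT hM hR
  intro η hη
  obtain ⟨N, hN⟩ := huniv (η / (3 * (C + 1))) (by positivity)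
  refine ⟨max N₀ N, fun k hk k' hkk' => ?_⟩
  simp only [ge_iff_le, max_le_iff] at hk
  obtain ⟨h₁, h₂, h₃⟩ := hN k hk.2 k' (hk.2.trans hkk'.le)
  obtain ⟨-, b₂, b₃⟩ := hbd' k hk.1
  obtain ⟨b₁, -, b₄⟩ := hbd' k' (hk.1.trans hkk'.le)
  obtain ⟨s₁, s₂⟩ := hstab _ _ _ _ _ _ _ _ _ _ _ _ _ _ (hsys k) (hsys k') b₁ b₂ b₃ b₄
  have hle : (sqOm a b (fun x => u0t k x - u0t k' x) + sqOm a b (fun x => u0x k x - u0x k' x) +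
      sqOm a b (fun x => Θ0 k x - Θ0 k' x)) * C ≤ η :=
    calc _ ≤ (3 * (η / (3 * (C + 1)))) * (C + 1) :=
          mul_le_mul (by linarith) (by linarith) hC (by positivity)
      _ = η := by field_simp
  exact ⟨fun t ht => (s₁ t ht).trans hle, s₂.trans hle⟩
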